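/- There exists a function L₀ : (0,∞) → ℕ* with L₀(t) → ∞ as t → ∞, such that for every t > 0 and every pair ω, σ ∈ LO_0 there is a probability measure 𝒫^{t,ω,σ} on Ω × Ω whose first marginal is the pushforward under θ of P_t(ω, ·) and whose second marginal is the pushforward under θ of P_t(σ, ·), and such that inf_{ω,σ ∈ LO_0} 𝒫^{t,ω,σ}( {(η, ξ) : η_x = ξ_x for all x ∈ ⟦1, L₀(t)⟧} ) tends to 1 as t → ∞. (A coupling of the configurations seen from the front started from any two initial configurations which agree near the front with probability tending to 1, uniformly in the initial configurations.) -/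

import Mathlib

open MeasureTheory ProbabilityTheory Filter Topology

noncomputable section

/-- The configuration space of the East model on `ℤ`: `0` ↔ `false` (empty), `1` ↔ `true`. -/
abbrev Config : Type := ℤ → Bool

/-- The configuration `ω` flipped at site `x`. -/
def flipAt (ω : Config) (x : ℤ) : Config := fun y => if y = x then !ω x else ω y

/-- `f` depends only on the coordinates in `S`. -/
def DependsOnF (f : Config → ℝ) (S : Set ℤ) : Prop :=
  ∀ ω ω' : Config, (∀ x ∈ S, ω x = ω' x) → f ω = f ω'

/-- The set `A` depends only on the coordinates in `S`. -/
def DependsOnSet (A : Set Config) (S : Set ℤ) : Prop :=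
  ∀ ω ω' : Config, (∀ x ∈ S, ω x = ω' x) → (ω ∈ A ↔ ω' ∈ A)

/-- A cylinder (local) function: depends on finitely many coordinates. -/
def IsCylinder (f : Config → ℝ) : Prop := ∃ S : Finset ℤ, DependsOnF f ↑S

/-- The East generator at density `p` of ones. -/
def eastGen (p : ℝ) (f : Config → ℝ) (ω : Config) : ℝ :=
  ∑' x : ℤ, (if ω (x + 1) = false then (1 : ℝ) else 0) *
    (if ω x = false then p else 1 - p) * (f (flipAt ω x) - f ω)

/-- Spatial translation: `(shift y ω) x = ω (x + y)`. -/
def shift (y : ℤ) (ω : Config) : Config := fun x => ω (x + y)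

/-- Left-occupied configurations: identically `1` on a left half-line, with an empty site. -/
def LO : Set Config := {ω | (∃ y : ℤ, ∀ x < y, ω x = true) ∧ ∃ x, ω x = false}

/-- The front: position of the left-most zero. -/
def front (ω : Config) : ℤ := sInf {x : ℤ | ω x = false}

/-- Left-occupied configurations with front at the origin. -/
def LO₀ : Set Config := {ω ∈ LO | front ω = 0}

/-- The configuration seen at distance `L` behind the front. -/
def θL (L : ℤ) (ω : Config) : Config := fun x =>
  if x < 0 then true else if x = 0 then false else ω (front ω + L + x)

/-- `f` averaged over the coordinate at site `1` w.r.t. Bernoulli(p). -/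
def avg1 (p : ℝ) (f : Config → ℝ) (ω : Config) : ℝ :=
  p * f (Function.update ω 1 true) + (1 - p) * f (Function.update ω 1 false)

/-- The East process on `ℤ` at density `p`, together with its equilibrium measure. -/
structure EastProcess where
  /-- equilibrium density of ones -/
  p : ℝ
  hp0 : 0 < p
  hp1 : p < 1
  /-- the Markov semigroup -/
  P : ℝ → Kernel Config Config
  markov : ∀ t : ℝ, IsMarkovKernel (P t)
  P0 : P 0 = Kernel.id
  semigroup : ∀ s t : ℝ, 0 ≤ s → 0 ≤ t → P (t + s) = (P s).comp (P t)
  feller : ∀ t : ℝ, 0 ≤ t → ∀ f : Config → ℝ, Continuous f →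
    Continuous fun ω : Config => ∫ η, f η ∂(P t ω)
  timeCont : ∀ f : Config → ℝ, Continuous f → ∀ ω : Config,
    Continuous fun t : ℝ => ∫ η, f η ∂(P t ω)
  shiftComm : ∀ t : ℝ, 0 ≤ t → ∀ y : ℤ, ∀ ω : Config,
    P t (shift y ω) = Measure.map (shift y) (P t ω)
  generator : ∀ f : Config → ℝ, IsCylinder f → ∀ ω : Config,
    HasDerivWithinAt (fun u : ℝ => ∫ η, f η ∂(P u ω)) (eastGen p f ω) (Set.Ici 0) 0
  /-- the product Bernoulli(p) measure -/
  μ : Measure Config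
  μprob : IsProbabilityMeasure μ
  μprod : ∀ (S : Finset ℤ) (σ : ℤ → Bool),
    μ {ω : Config | ∀ x ∈ S, ω x = σ x} = ∏ x ∈ S, ENNReal.ofReal (if σ x then p else 1 - p)
  /-- LO is stable for the dynamics -/
  loStable : ∀ t : ℝ, 0 ≤ t → ∀ ω ∈ LO, P t ω LO = 1

/-- The set of Rayleigh quotients defining the spectral gap. -/
def gapSet (E : EastProcess) : Set ℝ :=
  {r | ∃ f : Config → ℝ, IsCylinder f ∧ 0 < variance f E.μ ∧
    r = (-∫ ω, f ω * eastGen E.p f ω ∂E.μ) / variance f E.μ}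

/-- The spectral gap of the East process. -/
def gap (E : EastProcess) : ℝ := sInf (gapSet E)

/-- The product measure `μ̃`: all ones on the negative half-line, a zero at the origin,
Bernoulli(p) on the positive half-line. -/
def IsMuTilde (p : ℝ) (μt : Measure Config) : Prop :=
  IsProbabilityMeasure μt ∧
  ∀ (S : Finset ℤ) (σ : ℤ → Bool),
    μt {ω : Config | ∀ x ∈ S, ω x = σ x} =
      ∏ x ∈ S, ENNReal.ofReal
        (if x < 0 then (if σ x then 1 else 0)
         else if x = 0 then (if σ x then 0 else 1)
         else (if σ x then p else 1 - p))

/-- The law at time `t` of the process seen from the front started from `π`. -/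
def Qt (E : EastProcess) (t : ℝ) (π : Measure Config) : Measure Config :=
  Measure.map (θL 0) (π.bind fun ω => E.P t ω)



namespace EA

/-- Bernoulli average at the site `x`. -/
def Ex (p : ℝ) (x : ℤ) (f : Config → ℝ) (ω : Config) : ℝ :=
  p * f (Function.update ω x true) + (1 - p) * f (Function.update ω x false)

/-- Constrained resampling at the site `x`. -/
def K (p : ℝ) (x : ℤ) (f : Config → ℝ) (ω : Config) : ℝ :=
  if ω (x + 1) = false then Ex p x f ω else f ω

/-- One Euler step of size `h` for the generator restricted to `s`. -/
def Q (p h : ℝ) (s : Finset ℤ) (f : Config → ℝ) (ω : Config) : ℝ :=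
  f ω + h * ∑ x ∈ s, (K p x f ω - f ω)

/-- `f` depends only on the sites in `[a,b]`. -/
def Dep (a b : ℤ) (f : Config → ℝ) : Prop := DependsOnF f (Set.Icc a b)

lemma flipAt_eq (ω : Config) (x : ℤ) : flipAt ω x = Function.update ω x (!ω x) := by
  funext y
  by_cases h : y = x
  · subst h; simp [flipAt]
  · simp [flipAt, h]

lemma update_eq_of {ω : Config} {x : ℤ} {b : Bool} (h : ω x = b) : Function.update ω x b = ω := by
  subst h; simp

lemma gen_term (p : ℝ) (f : Config → ℝ) (ω : Config) (x : ℤ) :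
    (if ω (x + 1) = false then (1 : ℝ) else 0) *
    (if ω x = false then p else 1 - p) * (f (flipAt ω x) - f ω) = K p x f ω - f ω := by
  rw [flipAt_eq, K, Ex]
  by_cases h : ω (x + 1) = false
  · simp only [h, if_true]
    cases hx : ω x
    · have := update_eq_of hx
      simp only [if_true, Bool.not_false]
      rw [this]; ring
    · have := update_eq_of hx
      simp only [Bool.not_true]
      rw [this]; simp; ring
  · simp [h]

lemma Ex_of_not_mem {p : ℝ} {f : Config → ℝ} {S : Set ℤ} (hf : DependsOnF f S) {x : ℤ}
    (hx : x ∉ S) (ω : Config) : Ex p x f ω = f ω := by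
  have h1 : ∀ b, f (Function.update ω x b) = f ω := by
    intro b
    apply hf
    intro y hy
    have : y ≠ x := by rintro rfl; exact hx hy
    simp [this]
  rw [Ex, h1, h1]; ring

lemma K_of_not_mem {p : ℝ} {f : Config → ℝ} {S : Set ℤ} (hf : DependsOnF f S) {x : ℤ}
    (hx : x ∉ S) (ω : Config) : K p x f ω = f ω := by
  rw [K, Ex_of_not_mem hf hx]; simp

lemma eastGen_eq {p : ℝ} {f : Config → ℝ} {S : Set ℤ} {s : Finset ℤ} (hf : DependsOnF f S)
    (hs : S ⊆ ↑s) (ω : Config) : eastGen p f ω = ∑ x ∈ s, (K p x f ω - f ω) := by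
  rw [eastGen]
  simp_rw [gen_term]
  apply tsum_eq_sum
  intro x hx
  rw [K_of_not_mem hf (fun h => hx (by exact_mod_cast hs h))]; ring

lemma DependsOnF.mono' {f : Config → ℝ} {S T : Set ℤ} (hf : DependsOnF f S) (h : S ⊆ T) :
    DependsOnF f T := fun ω ω' H => hf ω ω' (fun x hx => H x (h hx))

lemma Dep.mono {a b a' b' : ℤ} {f : Config → ℝ} (hf : Dep a b f) (h1 : a' ≤ a) (h2 : b ≤ b') :
    Dep a' b' f := DependsOnF.mono' hf (Set.Icc_subset_Icc h1 h2)

lemma Dep.cyl {a b : ℤ} {f : Config → ℝ} (hf : Dep a b f) : IsCylinder f :=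
  ⟨Finset.Icc a b, by simpa [Dep] using hf⟩

lemma dep_K {p : ℝ} {f : Config → ℝ} {S : Set ℤ} (hf : DependsOnF f S) {x : ℤ}
    (hx : x ∈ S → x + 1 ∈ S) : DependsOnF (K p x f) S := by
  intro ω ω' H
  by_cases h : x ∈ S
  · have h1 : ∀ b, f (Function.update ω x b) = f (Function.update ω' x b) := by
      intro b
      apply hf
      intro y hy
      by_cases hyx : y = x
      · subst hyx; simp
      · simp [hyx, H y hy]
    rw [K, K, Ex, Ex, H _ (hx h), h1, h1, hf _ _ H]
  · rw [K_of_not_mem hf h, K_of_not_mem hf h]; exact hf _ _ H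

lemma dep_Ex {p : ℝ} {f : Config → ℝ} {S : Set ℤ} (hf : DependsOnF f S) {x : ℤ} :
    DependsOnF (Ex p x f) (S \ {x}) := by
  intro ω ω' H
  have h1 : ∀ b, f (Function.update ω x b) = f (Function.update ω' x b) := by
    intro b
    apply hf
    intro y hy
    by_cases hyx : y = x
    · subst hyx; simp
    · simp [hyx, H y ⟨hy, hyx⟩]
  rw [Ex, Ex, h1, h1]

lemma dep_Q {p h : ℝ} {s : Finset ℤ} {f : Config → ℝ} {S : Set ℤ} (hf : DependsOnF f S)
    (hs : ∀ x ∈ s, x ∈ S → x + 1 ∈ S) : DependsOnF (Q p h s f) S := by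
  intro ω ω' H
  rw [Q, Q, hf _ _ H]
  congr 2
  apply Finset.sum_congr rfl
  intro x hx
  rw [dep_K hf (hs x hx) _ _ H]

lemma Dep.Q {p h : ℝ} {a N : ℤ} {l : ℤ} {f : Config → ℝ} (hf : Dep a N f) :
    Dep a N (Q p h (Finset.Ico l N) f) := by
  apply dep_Q hf
  intro x hx h
  simp only [Finset.mem_Ico, Set.mem_Icc] at *
  omega

lemma Dep.Qiter {p h : ℝ} {a N : ℤ} {l : ℤ} {f : Config → ℝ} (hf : Dep a N f) (m : ℕ) :
    Dep a N ((EA.Q p h (Finset.Ico l N))^[m] f) := by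
  induction m with
  | zero => exact hf
  | succ m ih => rw [Function.iterate_succ_apply']; exact ih.Q

section ops
variable {p : ℝ}

lemma K_add (x : ℤ) (f g : Config → ℝ) (ω : Config) :
    K p x (fun ω => f ω + g ω) ω = K p x f ω + K p x g ω := by
  simp only [K, Ex]; split_ifs <;> ring

lemma K_sub (x : ℤ) (f g : Config → ℝ) (ω : Config) :
    K p x (fun ω => f ω - g ω) ω = K p x f ω - K p x g ω := by
  simp only [K, Ex]; split_ifs <;> ring

lemma K_smul (x : ℤ) (c : ℝ) (f : Config → ℝ) (ω : Config) :
    K p x (fun ω => c * f ω) ω = c * K p x f ω := by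
  simp only [K, Ex]; split_ifs <;> ring

lemma K_const (x : ℤ) (c : ℝ) (ω : Config) : K p x (fun _ => c) ω = c := by
  simp only [K, Ex]; split_ifs <;> ring

lemma Ex_mono (h0 : 0 ≤ p) (h1 : p ≤ 1) (x : ℤ) {f g : Config → ℝ} (hfg : ∀ ω, f ω ≤ g ω)
    (ω : Config) : Ex p x f ω ≤ Ex p x g ω := by
  simp only [Ex]
  have := mul_le_mul_of_nonneg_left (hfg (Function.update ω x true)) h0
  have := mul_le_mul_of_nonneg_left (hfg (Function.update ω x false)) (sub_nonneg.2 h1)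
  linarith

lemma K_mono (h0 : 0 ≤ p) (h1 : p ≤ 1) (x : ℤ) {f g : Config → ℝ} (hfg : ∀ ω, f ω ≤ g ω)
    (ω : Config) : K p x f ω ≤ K p x g ω := by
  simp only [K]
  split_ifs
  · exact Ex_mono h0 h1 x hfg ω
  · exact hfg ω

lemma K_abs_le (h0 : 0 ≤ p) (h1 : p ≤ 1) (x : ℤ) {f : Config → ℝ} {C : ℝ}
    (hf : ∀ ω, |f ω| ≤ C) (ω : Config) : |K p x f ω| ≤ C := by
  rw [abs_le]
  constructor
  · have := K_mono h0 h1 x (f := fun _ => -C) (g := f) (fun ω => (abs_le.1 (hf ω)).1) ω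
    rwa [K_const] at this
  · have := K_mono h0 h1 x (g := fun _ => C) (f := f) (fun ω => (abs_le.1 (hf ω)).2) ω
    rwa [K_const] at this

lemma K_sq_le (h0 : 0 ≤ p) (h1 : p ≤ 1) (x : ℤ) (f : Config → ℝ) (ω : Config) :
    (K p x f ω) ^ 2 ≤ K p x (fun ω => f ω ^ 2) ω := by
  simp only [K, Ex]
  split_ifs
  · set a := f (Function.update ω x true)
    set b := f (Function.update ω x false)
    nlinarith [mul_nonneg (mul_nonneg h0 (sub_nonneg.2 h1)) (sq_nonneg (a - b))]
  · exact le_rfl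

lemma Q_eq {h : ℝ} (s : Finset ℤ) (f : Config → ℝ) (ω : Config) :
    Q p h s f ω = (1 - h * s.card) * f ω + h * ∑ x ∈ s, K p x f ω := by
  rw [Q, Finset.sum_sub_distrib, Finset.sum_const, nsmul_eq_mul]; ring

lemma Q_mono (h0 : 0 ≤ p) (h1 : p ≤ 1) {h : ℝ} {s : Finset ℤ} (hh : 0 ≤ h) (hs : h * s.card ≤ 1)
    {f g : Config → ℝ} (hfg : ∀ ω, f ω ≤ g ω) (ω : Config) : Q p h s f ω ≤ Q p h s g ω := by
  rw [Q_eq, Q_eq]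
  have := mul_le_mul_of_nonneg_left (hfg ω) (sub_nonneg.2 hs)
  have h2 : ∑ x ∈ s, K p x f ω ≤ ∑ x ∈ s, K p x g ω :=
    Finset.sum_le_sum (fun x _ => K_mono h0 h1 x hfg ω)
  have := mul_le_mul_of_nonneg_left h2 hh
  linarith

lemma Q_add {h : ℝ} {s : Finset ℤ} (f g : Config → ℝ) (ω : Config) :
    Q p h s (fun ω => f ω + g ω) ω = Q p h s f ω + Q p h s g ω := by
  simp only [Q_eq, K_add, Finset.sum_add_distrib]; ring

lemma Q_sub {h : ℝ} {s : Finset ℤ} (f g : Config → ℝ) (ω : Config) :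
    Q p h s (fun ω => f ω - g ω) ω = Q p h s f ω - Q p h s g ω := by
  simp only [Q_eq, K_sub, Finset.sum_sub_distrib]; ring

lemma Q_smul {h : ℝ} {s : Finset ℤ} (c : ℝ) (f : Config → ℝ) (ω : Config) :
    Q p h s (fun ω => c * f ω) ω = c * Q p h s f ω := by
  simp only [Q_eq, K_smul, ← Finset.mul_sum]; ring

lemma Q_const {h : ℝ} {s : Finset ℤ} (c : ℝ) (ω : Config) :
    Q p h s (fun _ => c) ω = c := by
  simp [Q, K_const]

lemma Qi_mono (h0 : 0 ≤ p) (h1 : p ≤ 1) {h : ℝ} {s : Finset ℤ} (hh : 0 ≤ h)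
    (hs : h * s.card ≤ 1) (m : ℕ) :
    ∀ {f g : Config → ℝ}, (∀ ω, f ω ≤ g ω) → ∀ ω, (Q p h s)^[m] f ω ≤ (Q p h s)^[m] g ω := by
  induction m with
  | zero => intro f g hfg ω; exact hfg ω
  | succ m ih =>
    intro f g hfg ω
    rw [Function.iterate_succ_apply, Function.iterate_succ_apply]
    exact ih (fun ω => Q_mono h0 h1 hh hs hfg ω) ω

lemma Qi_add {h : ℝ} {s : Finset ℤ} (m : ℕ) :
    ∀ (f g : Config → ℝ) (ω : Config),
    (Q p h s)^[m] (fun ω => f ω + g ω) ω = (Q p h s)^[m] f ω + (Q p h s)^[m] g ω := by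
  induction m with
  | zero => intro f g ω; rfl
  | succ m ih =>
    intro f g ω
    rw [Function.iterate_succ_apply, Function.iterate_succ_apply, Function.iterate_succ_apply,
      ← ih, ← funext (Q_add f g)]

lemma Qi_sub {h : ℝ} {s : Finset ℤ} (m : ℕ) :
    ∀ (f g : Config → ℝ) (ω : Config),
    (Q p h s)^[m] (fun ω => f ω - g ω) ω = (Q p h s)^[m] f ω - (Q p h s)^[m] g ω := by
  induction m with
  | zero => intro f g ω; rfl
  | succ m ih =>
    intro f g ω
    rw [Function.iterate_succ_apply, Function.iterate_succ_apply, Function.iterate_succ_apply,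
      ← ih, ← funext (Q_sub f g)]

lemma Qi_smul {h : ℝ} {s : Finset ℤ} (m : ℕ) (c : ℝ) :
    ∀ (f : Config → ℝ) (ω : Config),
    (Q p h s)^[m] (fun ω => c * f ω) ω = c * (Q p h s)^[m] f ω := by
  induction m with
  | zero => intro f ω; rfl
  | succ m ih =>
    intro f ω
    rw [Function.iterate_succ_apply, Function.iterate_succ_apply,
      ← ih, ← funext (Q_smul c f)]

lemma Qi_const {h : ℝ} {s : Finset ℤ} (m : ℕ) (c : ℝ) (ω : Config) :
    (Q p h s)^[m] (fun _ => c) ω = c := by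
  induction m with
  | zero => rfl
  | succ m ih =>
    rw [Function.iterate_succ_apply, funext (Q_const (p := p) (h := h) (s := s) c), ih]

lemma Qi_abs_le (h0 : 0 ≤ p) (h1 : p ≤ 1) {h : ℝ} {s : Finset ℤ} (hh : 0 ≤ h)
    (hs : h * s.card ≤ 1) (m : ℕ) {f : Config → ℝ} {C : ℝ}
    (hf : ∀ ω, |f ω| ≤ C) (ω : Config) : |(Q p h s)^[m] f ω| ≤ C := by
  rw [abs_le]
  constructor
  · have := Qi_mono h0 h1 hh hs m (f := fun _ => -C) (g := f) (fun ω => (abs_le.1 (hf ω)).1) ω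
    rwa [Qi_const] at this
  · have := Qi_mono h0 h1 hh hs m (g := fun _ => C) (f := f) (fun ω => (abs_le.1 (hf ω)).2) ω
    rwa [Qi_const] at this

/-- Weighted bound on the discrete gradients. -/
def W (C : ℝ) (f : Config → ℝ) : Prop :=
  ∀ (x : ℤ) (ω : Config), |f (Function.update ω x true) - f (Function.update ω x false)|
    ≤ C * Real.exp (-(x : ℝ))

lemma Ex_sub_abs (h0 : 0 ≤ p) (h1 : p ≤ 1) {f : Config → ℝ} {D : ℝ} {x : ℤ}
    (hf : ∀ ω : Config, |f (Function.update ω x true) - f (Function.update ω x false)| ≤ D)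
    (ω : Config) : |Ex p x f ω - f ω| ≤ D := by
  have h := hf ω
  have hD : 0 ≤ D := (abs_nonneg _).trans h
  rw [Ex]
  cases hx : ω x
  · have e := update_eq_of hx
    rw [e] at h ⊢
    have : p * f (Function.update ω x true) + (1 - p) * f ω - f ω
      = p * (f (Function.update ω x true) - f ω) := by ring
    rw [this, abs_mul, abs_of_nonneg h0]
    nlinarith [abs_nonneg (f (Function.update ω x true) - f ω)]
  · have e := update_eq_of hx
    rw [e] at h ⊢
    have : p * f ω + (1 - p) * f (Function.update ω x false) - f ω
      = -((1 - p) * (f ω - f (Function.update ω x false))) := by ring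
    rw [this, abs_neg, abs_mul, abs_of_nonneg (sub_nonneg.2 h1)]
    nlinarith [abs_nonneg (f ω - f (Function.update ω x false))]

lemma K_grad_le (h0 : 0 ≤ p) (h1 : p ≤ 1) {C : ℝ} {f : Config → ℝ} (hf : W C f) (x y : ℤ)
    (ω : Config) :
    |K p y f (Function.update ω x true) - K p y f (Function.update ω x false)|
      ≤ C * Real.exp (-(x : ℝ)) + if y = x - 1 then C * Real.exp (-(y : ℝ)) else 0 := by
  have hD := hf x ω
  have hD0 : 0 ≤ C * Real.exp (-(x : ℝ)) := (abs_nonneg _).trans hD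
  by_cases hy : y = x - 1
  · subst hy
    simp only [if_true, K, sub_add_cancel, Function.update_self]
    simp only [Bool.true_eq_false, if_false, if_true]
    have := Ex_sub_abs h0 h1 (hf (x - 1)) (Function.update ω x false)
    have e : f (Function.update ω x true) - Ex p (x - 1) f (Function.update ω x false)
      = (f (Function.update ω x true) - f (Function.update ω x false))
        - (Ex p (x - 1) f (Function.update ω x false) - f (Function.update ω x false)) := by ring
    rw [e]
    exact (abs_sub _ _).trans (add_le_add hD this)
  · simp only [hy, if_false, add_zero]
    have hne : y + 1 ≠ x := by omega
    simp only [K, Function.update_of_ne hne]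
    by_cases hc : ω (y + 1) = false
    · simp only [hc, if_true]
      by_cases hyx : y = x
      · subst hyx
        simp [Ex, hD0]
      · have comm : ∀ b b', Function.update (Function.update ω x b) y b'
            = Function.update (Function.update ω y b') x b := by
          intro b b'
          exact Function.update_comm (Ne.symm hyx) b b' ω
        simp only [Ex, comm]
        have a1 := hf x (Function.update ω y true)
        have a2 := hf x (Function.update ω y false)
        have e : ∀ a b c d : ℝ, p * a + (1 - p) * b - (p * c + (1 - p) * d)
          = p * (a - c) + (1 - p) * (b - d) := by intros; ring
        rw [e]
        refine (abs_add_le _ _).trans ?_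
        rw [abs_mul, abs_mul, abs_of_nonneg h0, abs_of_nonneg (sub_nonneg.2 h1)]
        nlinarith [mul_le_mul_of_nonneg_left a1 h0,
          mul_le_mul_of_nonneg_left a2 (sub_nonneg.2 h1)]
    · simp only [hc]; exact hD

lemma W.Q (h0 : 0 ≤ p) (h1 : p ≤ 1) {h : ℝ} {s : Finset ℤ} (hh : 0 ≤ h)
    (hs : h * s.card ≤ 1) {C : ℝ} {f : Config → ℝ} (hf : W C f) :
    W (C * Real.exp (Real.exp 1 * h)) (EA.Q p h s f) := by
  intro x ω
  have hD := hf x ω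
  have hD0 : 0 ≤ C * Real.exp (-(x : ℝ)) := (abs_nonneg _).trans hD
  have hC : 0 ≤ C := by
    by_contra hc
    push Not at hc
    have := mul_neg_of_neg_of_pos hc (Real.exp_pos (-(x:ℝ)))
    linarith
  rw [Q_eq, Q_eq]
  have e : ∀ a b c d u : ℝ, u * a + h * b - (u * c + h * d) = u * (a - c) + h * (b - d) := by
    intros; ring
  rw [e, ← Finset.sum_sub_distrib]
  refine (abs_add_le _ _).trans ?_
  rw [abs_mul, abs_mul, abs_of_nonneg (sub_nonneg.2 hs), abs_of_nonneg hh]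
  have h3 : |∑ y ∈ s, (K p y f (Function.update ω x true) - K p y f (Function.update ω x false))|
      ≤ s.card * (C * Real.exp (-(x : ℝ))) + C * Real.exp (-(x : ℝ)) * Real.exp 1 := by
    refine (Finset.abs_sum_le_sum_abs _ _).trans ?_
    refine (Finset.sum_le_sum (fun y _ => K_grad_le h0 h1 hf x y ω)).trans ?_
    rw [Finset.sum_add_distrib, Finset.sum_const, nsmul_eq_mul, Finset.sum_ite_eq']
    gcongr
    split_ifs
    · rw [mul_assoc, ← Real.exp_add]
      apply le_of_eq; congr 2; push_cast; ring
    · positivity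
  have h4 := mul_le_mul_of_nonneg_left h3 hh
  have h5 := mul_le_mul_of_nonneg_left hD (sub_nonneg.2 hs)
  have h6 : 1 + Real.exp 1 * h ≤ Real.exp (Real.exp 1 * h) := by
    have := Real.add_one_le_exp (Real.exp 1 * h); linarith
  have h7 := mul_le_mul_of_nonneg_left h6 hD0
  calc _ ≤ _ := add_le_add h5 h4
    _ = C * Real.exp (-(x : ℝ)) * (1 + Real.exp 1 * h) := by ring
    _ ≤ _ := h7
    _ = _ := by ring

lemma W.Qi (h0 : 0 ≤ p) (h1 : p ≤ 1) {h : ℝ} {s : Finset ℤ} (hh : 0 ≤ h)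
    (hs : h * s.card ≤ 1) {C : ℝ} {f : Config → ℝ} (hf : W C f) (m : ℕ) :
    W (C * Real.exp (Real.exp 1 * (m * h))) ((EA.Q p h s)^[m] f) := by
  induction m with
  | zero => simpa using hf
  | succ m ih =>
    rw [Function.iterate_succ_apply']
    have := ih.Q h0 h1 hh hs
    rw [mul_assoc, ← Real.exp_add] at this
    convert this using 3
    push_cast; ring

lemma W_of_dep {f : Config → ℝ} {S : Set ℤ} {r : ℤ} (hf : DependsOnF f S) (hS : ∀ x ∈ S, x ≤ r)
    (hb : ∀ ω, |f ω| ≤ 1) : W (2 * Real.exp (r : ℝ)) f := by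
  intro x ω
  by_cases hx : x ∈ S
  · have h1 := hb (Function.update ω x true)
    have h2 := hb (Function.update ω x false)
    have h3 : (x : ℝ) ≤ r := by exact_mod_cast hS x hx
    have h4 : 1 ≤ Real.exp (r : ℝ) * Real.exp (-(x : ℝ)) := by
      rw [← Real.exp_add]; apply Real.one_le_exp; linarith
    have := abs_sub (f (Function.update ω x true)) (f (Function.update ω x false))
    nlinarith
  · have : f (Function.update ω x true) = f (Function.update ω x false) := by
      apply hf
      intro y hy
      have : y ≠ x := by rintro rfl; exact hx hy
      simp [this]
    rw [this]; simp; positivity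

end ops
end EA

namespace EA

/-- The semigroup acting on functions. -/
def Pt (E : EastProcess) (t : ℝ) (f : Config → ℝ) (ω : Config) : ℝ := ∫ η, f η ∂(E.P t ω)

/-- Bounded measurable functions. -/
def BM (f : Config → ℝ) : Prop := Measurable f ∧ ∃ C, ∀ ω, |f ω| ≤ C

lemma BM.integrable {f : Config → ℝ} (hf : BM f) (ν : Measure Config) [IsFiniteMeasure ν] :
    Integrable f ν := by
  obtain ⟨hm, C, hC⟩ := hf
  exact Integrable.of_bound hm.aestronglyMeasurable C (ae_of_all _ hC)

lemma cyl_continuous {f : Config → ℝ} (hf : IsCylinder f) : Continuous f := by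
  obtain ⟨S, hS⟩ := hf
  let g : (S → Bool) → ℝ := fun τ => f (fun x => if h : x ∈ S then τ ⟨x, h⟩ else true)
  have : f = g ∘ (fun ω : Config => fun x : S => ω x) := by
    funext ω
    apply hS
    intro x hx
    have hx' : x ∈ S := hx
    simp [hx']
  rw [this]
  exact continuous_of_discreteTopology.comp (by fun_prop)

lemma bm_of_continuous {f : Config → ℝ} (hf : Continuous f) : BM f := by
  refine ⟨hf.measurable, ?_⟩
  obtain ⟨C, hC⟩ := isCompact_univ.exists_bound_of_continuousOn hf.continuousOn
  exact ⟨C, fun ω => hC ω trivial⟩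

lemma Dep.cont {a b : ℤ} {f : Config → ℝ} (hf : Dep a b f) : Continuous f := cyl_continuous hf.cyl
lemma Dep.bm {a b : ℤ} {f : Config → ℝ} (hf : Dep a b f) : BM f := bm_of_continuous hf.cont

lemma BM.add {f g : Config → ℝ} (hf : BM f) (hg : BM g) : BM (fun ω => f ω + g ω) := by
  obtain ⟨h1, C, hC⟩ := hf
  obtain ⟨h2, D, hD⟩ := hg
  exact ⟨h1.add h2, C + D, fun ω => (abs_add_le _ _).trans (add_le_add (hC ω) (hD ω))⟩

lemma BM.smul {f : Config → ℝ} (c : ℝ) (hf : BM f) : BM (fun ω => c * f ω) := by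
  obtain ⟨h1, C, hC⟩ := hf
  refine ⟨h1.const_mul c, |c| * C, fun ω => ?_⟩
  rw [abs_mul]; exact mul_le_mul_of_nonneg_left (hC ω) (abs_nonneg _)

lemma BM.sub {f g : Config → ℝ} (hf : BM f) (hg : BM g) : BM (fun ω => f ω - g ω) := by
  have := hf.add (hg.smul (-1))
  convert this using 2; ring

lemma BM.mul {f g : Config → ℝ} (hf : BM f) (hg : BM g) : BM (fun ω => f ω * g ω) := by
  obtain ⟨h1, C, hC⟩ := hf
  obtain ⟨h2, D, hD⟩ := hg
  refine ⟨h1.mul h2, C * D, fun ω => ?_⟩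
  rw [abs_mul]
  exact mul_le_mul (hC ω) (hD ω) (abs_nonneg _) ((abs_nonneg _).trans (hC ω))

lemma BM.abs {f : Config → ℝ} (hf : BM f) : BM (fun ω => |f ω|) := by
  obtain ⟨h1, C, hC⟩ := hf
  exact ⟨h1.abs, C, fun ω => by rw [abs_abs]; exact hC ω⟩

lemma bm_const (c : ℝ) : BM (fun _ => c) := ⟨measurable_const, |c|, fun _ => le_rfl⟩

lemma bm_ind {A : Set Config} (hA : MeasurableSet A) : BM (A.indicator fun _ => (1 : ℝ)) := by
  refine ⟨measurable_const.indicator hA, 1, fun ω => ?_⟩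
  by_cases h : ω ∈ A <;> simp [h]

lemma BM.sum {ι : Type*} (s : Finset ι) {f : ι → Config → ℝ} (hf : ∀ i ∈ s, BM (f i)) :
    BM (fun ω => ∑ i ∈ s, f i ω) := by
  classical
  induction s using Finset.induction_on with
  | empty => simpa using bm_const 0
  | insert a s ha ih =>
    simp only [Finset.sum_insert ha]
    exact (hf a (by simp)).add (ih (fun i hi => hf i (by simp [hi])))

section
variable (E : EastProcess)

instance (t : ℝ) : IsMarkovKernel (E.P t) := E.markov t

lemma p0' : 0 ≤ E.p := E.hp0.le
lemma p1' : E.p ≤ 1 := E.hp1.le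

variable {E}

lemma BM.int {f : Config → ℝ} (hf : BM f) (t : ℝ) (ω : Config) : Integrable f (E.P t ω) :=
  hf.integrable _

lemma Pt_mono {f g : Config → ℝ} (hf : BM f) (hg : BM g) (t : ℝ) (h : ∀ ω, f ω ≤ g ω)
    (ω : Config) : Pt E t f ω ≤ Pt E t g ω :=
  integral_mono (hf.int t ω) (hg.int t ω) h

lemma Pt_mono_ae {f g : Config → ℝ} (hf : BM f) (hg : BM g) (t : ℝ) (ω : Config)
    (h : ∀ᵐ η ∂(E.P t ω), f η ≤ g η) : Pt E t f ω ≤ Pt E t g ω :=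
  integral_mono_ae (hf.int t ω) (hg.int t ω) h

lemma Pt_const (t c : ℝ) (ω : Config) : Pt E t (fun _ => c) ω = c := by
  simp [Pt]

lemma Pt_add {f g : Config → ℝ} (hf : BM f) (hg : BM g) (t : ℝ) (ω : Config) :
    Pt E t (fun η => f η + g η) ω = Pt E t f ω + Pt E t g ω :=
  integral_add (hf.int t ω) (hg.int t ω)

lemma Pt_sub {f g : Config → ℝ} (hf : BM f) (hg : BM g) (t : ℝ) (ω : Config) :
    Pt E t (fun η => f η - g η) ω = Pt E t f ω - Pt E t g ω :=
  integral_sub (hf.int t ω) (hg.int t ω)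

lemma Pt_smul (c : ℝ) {f : Config → ℝ} (t : ℝ) (ω : Config) :
    Pt E t (fun η => c * f η) ω = c * Pt E t f ω := integral_const_mul c f

lemma Pt_sum {ι : Type*} (s : Finset ι) {f : ι → Config → ℝ} (hf : ∀ i ∈ s, BM (f i)) (t : ℝ)
    (ω : Config) : Pt E t (fun η => ∑ i ∈ s, f i η) ω = ∑ i ∈ s, Pt E t (f i) ω :=
  integral_finsetSum s (fun i hi => (hf i hi).int t ω)

lemma Pt_abs {f : Config → ℝ} (t : ℝ) (ω : Config) :
    |Pt E t f ω| ≤ Pt E t (fun η => |f η|) ω := abs_integral_le_integral_abs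

lemma Pt_abs_le_ae {f : Config → ℝ} {C : ℝ} (t : ℝ) (ω : Config)
    (h : ∀ᵐ η ∂(E.P t ω), |f η| ≤ C) : |Pt E t f ω| ≤ C := by
  have h' : ∀ᵐ η ∂(E.P t ω), ‖f η‖ ≤ C := h
  have := norm_integral_le_of_norm_le_const h'
  simpa [Pt] using this

lemma Pt_abs_le {f : Config → ℝ} {C : ℝ} (t : ℝ) (h : ∀ ω, |f ω| ≤ C) (ω : Config) :
    |Pt E t f ω| ≤ C := Pt_abs_le_ae t ω (ae_of_all _ h)

lemma BM.Pt {f : Config → ℝ} (hf : BM f) (t : ℝ) : BM (EA.Pt E t f) := by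
  obtain ⟨h1, C, hC⟩ := hf
  exact ⟨(h1.stronglyMeasurable.integral_kernel).measurable, C, Pt_abs_le t hC⟩

lemma Pt_zero (f : Config → ℝ) (hf : BM f) (ω : Config) : Pt E 0 f ω = f ω := by
  rw [Pt, E.P0, Kernel.id_apply, integral_dirac' _ _ hf.1.stronglyMeasurable]

lemma Pt_semi {f : Config → ℝ} (hf : BM f) {s t : ℝ} (hs : 0 ≤ s) (ht : 0 ≤ t) (ω : Config) :
    Pt E (t + s) f ω = Pt E t (Pt E s f) ω := by
  have h := E.semigroup s t hs ht
  have hi : Integrable f ((E.P s ∘ₖ E.P t) ω) := by rw [← h]; exact hf.int _ _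
  simp only [Pt]
  rw [h, Kernel.integral_comp hi]

lemma Pt_cont {f : Config → ℝ} (hf : Continuous f) {t : ℝ} (ht : 0 ≤ t) : Continuous (Pt E t f) :=
  E.feller t ht f hf

lemma Pt_tcont {f : Config → ℝ} (hf : Continuous f) (ω : Config) :
    Continuous (fun t => Pt E t f ω) := E.timeCont f hf ω

/-- Resolvent at `1`. -/
def Res (E : EastProcess) (f : Config → ℝ) (ω : Config) : ℝ :=
  ∫ t in Set.Ioi (0 : ℝ), Real.exp (-t) * Pt E t f ω

lemma res_intOn {f : Config → ℝ} (hf : Continuous f) (ω : Config) :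
    IntegrableOn (fun t => Real.exp (-t) * Pt E t f ω) (Set.Ioi 0) := by
  obtain ⟨h1, C, hC⟩ := bm_of_continuous hf
  refine Integrable.mono' ((integrableOn_exp_neg_Ioi 0).mul_const C) ?_ ?_
  · exact ((Real.continuous_exp.comp continuous_neg).mul (Pt_tcont hf ω)).aestronglyMeasurable
  · refine ae_of_all _ fun t => ?_
    rw [Real.norm_eq_abs, abs_mul, abs_of_pos (Real.exp_pos _)]
    exact mul_le_mul_of_nonneg_left (Pt_abs_le t hC ω) (Real.exp_pos _).le

lemma res_cont {f : Config → ℝ} (hf : Continuous f) : Continuous (Res E f) := by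
  obtain ⟨h1, C, hC⟩ := bm_of_continuous hf
  refine continuous_of_dominated (bound := fun t => Real.exp (-t) * C)
    (fun ω => (res_intOn hf ω).aestronglyMeasurable) (fun ω => ae_of_all _ fun t => ?_)
    ((integrableOn_exp_neg_Ioi 0).mul_const C) ?_
  · rw [Real.norm_eq_abs, abs_mul, abs_of_pos (Real.exp_pos _)]
    exact mul_le_mul_of_nonneg_left (Pt_abs_le t hC ω) (Real.exp_pos _).le
  · rw [ae_restrict_iff' measurableSet_Ioi]
    exact ae_of_all _ fun t ht => (Pt_cont hf (le_of_lt ht)).const_mul _ |>.congr (fun _ => rfl)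

lemma res_formula {f : Config → ℝ} (hf : Continuous f) (ω : Config) {h : ℝ} (hh : 0 ≤ h) :
    Pt E h (Res E f) ω
      = Real.exp h * (Res E f ω - ∫ r in (0 : ℝ)..h, Real.exp (-r) * Pt E r f ω) := by
  obtain ⟨h1, C, hC⟩ := bm_of_continuous hf
  have hbm := bm_of_continuous hf
  have step1 : Pt E h (Res E f) ω
      = ∫ t in Set.Ioi (0 : ℝ), ∫ η, Real.exp (-t) * Pt E t f η ∂(E.P h ω) := by
    rw [Pt]
    simp only [Res]
    apply integral_integral_swap
    have hm : Measurable (Function.uncurry fun (t : ℝ) (η : Config) => Pt E t f η) :=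
      measurable_uncurry_of_continuous_of_measurable (fun η => Pt_tcont hf η)
        (fun t => (hbm.Pt t).1)
    have hm2 : Measurable (Function.uncurry fun (η : Config) (t : ℝ) => Real.exp (-t) * Pt E t f η) := by
      have : Measurable fun z : Config × ℝ => Pt E z.2 f z.1 := hm.comp measurable_swap
      exact (Real.measurable_exp.comp measurable_snd.neg).mul this
    have hb : Integrable (fun z : Config × ℝ => (1 : ℝ) * (Real.exp (-z.2) * C))
        ((E.P h ω).prod (volume.restrict (Set.Ioi 0))) :=
      Integrable.mul_prod (f := fun _ : Config => (1 : ℝ)) (g := fun t : ℝ => Real.exp (-t) * C)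
        (integrable_const _) ((integrableOn_exp_neg_Ioi 0).mul_const C)
    refine Integrable.mono' hb hm2.aestronglyMeasurable (ae_of_all _ fun z => ?_)
    simp only [Function.uncurry, one_mul]
    rw [Real.norm_eq_abs, abs_mul, abs_of_pos (Real.exp_pos _)]
    exact mul_le_mul_of_nonneg_left (Pt_abs_le _ hC _) (Real.exp_pos _).le
  have step2 : ∀ t ∈ Set.Ioi (0 : ℝ), (∫ η, Real.exp (-t) * Pt E t f η ∂(E.P h ω))
      = Real.exp h * (Real.exp (-(t + h)) * Pt E (t + h) f ω) := by
    intro t ht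
    rw [integral_const_mul, add_comm t h, Pt_semi hbm (le_of_lt ht) hh, ← mul_assoc,
      ← Real.exp_add]
    rw [show h + -(h + t) = -t by ring]; rfl
  have step3 : ∀ g : ℝ → ℝ, ∫ t in Set.Ioi (0 : ℝ), g (t + h) = ∫ t in Set.Ioi h, g t := by
    intro g
    have hmp : MeasurePreserving (fun x : ℝ => x + h) := measurePreserving_add_right volume h
    have := hmp.setIntegral_preimage_emb (Homeomorph.addRight h).measurableEmbedding g (Set.Ioi h)
    rw [← this]; congr 2; ext x; simp
  rw [step1, setIntegral_congr_fun measurableSet_Ioi step2, integral_const_mul,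
    step3 (fun r => Real.exp (-r) * Pt E r f ω)]
  congr 1
  rw [← intervalIntegral.integral_Ioi_sub_Ioi (res_intOn hf ω) hh, Res]; ring

lemma res_deriv {f : Config → ℝ} (hf : Continuous f) (ω : Config) (t : ℝ) :
    HasDerivAt (fun h => Real.exp h * (Res E f ω - ∫ r in (0 : ℝ)..h, Real.exp (-r) * Pt E r f ω))
      (Real.exp t * (Res E f ω - ∫ r in (0 : ℝ)..t, Real.exp (-r) * Pt E r f ω) - Pt E t f ω) t := by
  have hc : Continuous (fun r => Real.exp (-r) * Pt E r f ω) :=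
    (Real.continuous_exp.comp continuous_neg).mul (Pt_tcont hf ω)
  have h1 := (hc.integral_hasStrictDerivAt 0 t).hasDerivAt
  have h2 := (Real.hasDerivAt_exp t).mul (h1.const_sub (Res E f ω))
  refine h2.congr_deriv ?_
  have : Real.exp t * Real.exp (-t) = 1 := by rw [← Real.exp_add]; simp
  linear_combination (-Pt E t f ω) * this

lemma eastGen_dep {f : Config → ℝ} {p : ℝ} {a b : ℤ} (hf : Dep a b f) :
    Dep a (b + 1) (eastGen p f) := by
  intro ω ω' H
  have hs : Set.Icc a b ⊆ ↑(Finset.Icc a b) := by simp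
  rw [eastGen_eq hf hs, eastGen_eq hf hs]
  have hf' := hf.mono (le_refl a) (show b ≤ b + 1 by omega)
  apply Finset.sum_congr rfl
  intro x hx
  simp only [Finset.mem_Icc] at hx
  rw [dep_K hf' (by simp only [Set.mem_Icc]; omega) ω ω' H, hf' _ _ H]

lemma eastGen_bd {f : Config → ℝ} {p : ℝ} (h0 : 0 ≤ p) (h1 : p ≤ 1) {a b : ℤ} (hf : Dep a b f)
    {C : ℝ} (hC : ∀ ω, |f ω| ≤ C) (ω : Config) :
    |eastGen p f ω| ≤ (b + 1 - a).toNat * (2 * C) := by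
  have hs : Set.Icc a b ⊆ ↑(Finset.Icc a b) := by simp
  rw [eastGen_eq hf hs]
  refine (Finset.abs_sum_le_sum_abs _ _).trans ?_
  have : ∀ x ∈ Finset.Icc a b, |K p x f ω - f ω| ≤ 2 * C := by
    intro x _
    have := abs_sub (K p x f ω) (f ω)
    have := K_abs_le h0 h1 x hC ω
    have := hC ω
    linarith
  refine (Finset.sum_le_sum this).trans ?_
  simp

lemma cyl_dep {f : Config → ℝ} (hf : IsCylinder f) : ∃ a b, Dep a b f := by
  obtain ⟨S, hS⟩ := hf
  obtain ⟨a, ha⟩ := S.bddBelow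
  obtain ⟨b, hb⟩ := S.bddAbove
  exact ⟨a, b, DependsOnF.mono' hS (fun x hx => ⟨ha hx, hb hx⟩)⟩

/-- Cylinder functions are in the range of the resolvent. -/
lemma res_eq {f : Config → ℝ} {a b : ℤ} (hf : Dep a b f) (ω : Config) :
    Res E (fun η => f η - eastGen E.p f η) ω = f ω := by
  have hψ : Continuous (fun η => f η - eastGen E.p f η) := hf.cont.sub (eastGen_dep hf).cont
  set ψ := fun η => f η - eastGen E.p f η with hψd
  have hRc : Continuous (Res E ψ) := res_cont hψ
  have hdc : Continuous (fun η => Res E ψ η - f η) := hRc.sub hf.cont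
  have hder : ∀ η, HasDerivWithinAt (fun h => Pt E h (fun η => Res E ψ η - f η) η)
      (Res E ψ η - f η) (Set.Ici 0) 0 := by
    intro η
    have e1 : HasDerivWithinAt (fun h => Pt E h (Res E ψ) η) (Res E ψ η - ψ η) (Set.Ici 0) 0 := by
      have := (res_deriv (E := E) hψ η 0).hasDerivWithinAt (s := Set.Ici 0)
      simp only [Real.exp_zero, intervalIntegral.integral_same, sub_zero, one_mul,
        Pt_zero ψ (bm_of_continuous hψ)] at this
      exact this.congr (fun h hh => res_formula hψ η hh) (res_formula hψ η le_rfl)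
    have e2 := E.generator f hf.cyl η
    have e3 := e1.sub e2
    have e4 : (fun h => Pt E h (fun η => Res E ψ η - f η) η)
        = (fun h => Pt E h (Res E ψ) η) - fun u => ∫ η', f η' ∂(E.P u η) := by
      funext h
      exact Pt_sub (bm_of_continuous hRc) hf.bm h η
    rw [e4]
    refine e3.congr_deriv ?_
    simp only [hψd]; ring
  have hle : ∀ η, Res E ψ η - f η ≤ 0 := by
    obtain ⟨η0, -, h0⟩ := isCompact_univ.exists_isMaxOn (Set.univ_nonempty (α := Config))
      hdc.continuousOn
    have hd0 := hder η0
    have : Res E ψ η0 - f η0 ≤ 0 := by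
      rw [hasDerivWithinAt_iff_tendsto_slope, Set.Ici_sdiff_left] at hd0
      refine le_of_tendsto hd0 ?_
      filter_upwards [self_mem_nhdsWithin] with h hh
      rw [slope_def_field]
      apply div_nonpos_of_nonpos_of_nonneg
      · rw [Pt_zero _ (bm_of_continuous hdc)]
        have := Pt_mono (E := E) (bm_of_continuous hdc) (bm_const (Res E ψ η0 - f η0)) h
          (fun η => h0 (Set.mem_univ η)) η0
        rw [Pt_const] at this
        linarith
      · have : (0:ℝ) < h := hh
        linarith
    intro η
    exact (h0 (Set.mem_univ η)).trans this
  have hge : ∀ η, 0 ≤ Res E ψ η - f η := by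
    obtain ⟨η0, -, h0⟩ := isCompact_univ.exists_isMinOn (Set.univ_nonempty (α := Config))
      hdc.continuousOn
    have hd0 := hder η0
    have : 0 ≤ Res E ψ η0 - f η0 := by
      rw [hasDerivWithinAt_iff_tendsto_slope, Set.Ici_sdiff_left] at hd0
      refine ge_of_tendsto hd0 ?_
      filter_upwards [self_mem_nhdsWithin] with h hh
      rw [slope_def_field]
      apply div_nonneg
      · rw [Pt_zero _ (bm_of_continuous hdc)]
        have := Pt_mono (E := E) (bm_const (Res E ψ η0 - f η0)) (bm_of_continuous hdc) h
          (fun η => h0 (Set.mem_univ η)) η0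
        rw [Pt_const] at this
        linarith
      · have : (0:ℝ) < h := hh
        linarith
    intro η
    exact this.trans (h0 (Set.mem_univ η))
  linarith [hle ω, hge ω]

/-- Kolmogorov forward equation for cylinder functions. -/
lemma fwd {f : Config → ℝ} {a b : ℤ} (hf : Dep a b f) (ω : Config) {t : ℝ} (ht : 0 ≤ t) :
    HasDerivWithinAt (fun u => Pt E u f ω) (Pt E t (eastGen E.p f) ω) (Set.Ici 0) t := by
  have hψ : Continuous (fun η => f η - eastGen E.p f η) := hf.cont.sub (eastGen_dep hf).cont
  have hr := res_deriv (E := E) hψ ω t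
  have hR : Res E (fun η => f η - eastGen E.p f η) = f := funext (res_eq hf)
  have key : ∀ h, 0 ≤ h → Pt E h f ω = Real.exp h * (Res E (fun η => f η - eastGen E.p f η) ω
      - ∫ r in (0 : ℝ)..h, Real.exp (-r) * Pt E r (fun η => f η - eastGen E.p f η) ω) :=
    fun h hh => by
    have := res_formula (E := E) hψ ω hh
    rwa [congrArg (fun g => Pt E h g ω) hR] at this
  rw [← key t ht, Pt_sub hf.bm (eastGen_dep hf).bm, sub_sub_cancel] at hr
  exact hr.hasDerivWithinAt.congr (fun h hh => key h hh) (key t ht)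

lemma Pt_sub_self_le {f : Config → ℝ} {a b : ℤ} (hf : Dep a b f) {C : ℝ}
    (hC : ∀ ω, |eastGen E.p f ω| ≤ C) (ω : Config) {t : ℝ} (ht : 0 ≤ t) :
    |Pt E t f ω - f ω| ≤ C * t := by
  have := Convex.norm_image_sub_le_of_norm_hasDerivWithin_le
    (f := fun u => Pt E u f ω) (f' := fun u => Pt E u (eastGen E.p f) ω) (s := Set.Ici 0)
    (C := C) (fun x hx => fwd hf ω hx) (fun x _ => Pt_abs_le x hC ω) (convex_Ici 0)
    (x := 0) (y := t) (by simp) ht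
  simpa [Pt_zero f hf.bm, abs_of_nonneg ht] using this

lemma Pt_taylor {f : Config → ℝ} {a b : ℤ} (hf : Dep a b f) {C : ℝ}
    (hC : ∀ ω, |eastGen E.p (eastGen E.p f) ω| ≤ C) (ω : Config) {t : ℝ} (ht : 0 ≤ t) :
    |Pt E t f ω - f ω - t * eastGen E.p f ω| ≤ C * t ^ 2 := by
  have hL := eastGen_dep (p := E.p) hf
  have hC0 : 0 ≤ C := (abs_nonneg _).trans (hC ω)
  have := Convex.norm_image_sub_le_of_norm_hasDerivWithin_le
    (f := fun u => Pt E u f ω - u * eastGen E.p f ω)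
    (f' := fun u => Pt E u (eastGen E.p f) ω - eastGen E.p f ω) (s := Set.Icc 0 t)
    (C := C * t) (fun x hx => ?_) (fun x hx => ?_) (convex_Icc 0 t)
    (x := 0) (y := t) (by simp [ht]) (by simp [ht])
  · simp only [Pt_zero f hf.bm, Real.norm_eq_abs, sub_zero, zero_mul, abs_of_nonneg ht] at this
    calc _ = |Pt E t f ω - t * eastGen E.p f ω - f ω| := by congr 1; ring
      _ ≤ _ := this
      _ = _ := by ring
  · have h1 := (fwd (E := E) hf ω hx.1).mono (show Set.Icc 0 t ⊆ Set.Ici 0 from fun y hy => hy.1)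
    have h2 := ((hasDerivAt_id x).mul_const (eastGen E.p f ω)).hasDerivWithinAt (s := Set.Icc 0 t)
    exact (h1.sub h2).congr_deriv (by ring)
  · refine (Pt_sub_self_le hL hC ω hx.1).trans ?_
    exact mul_le_mul_of_nonneg_left hx.2 hC0

/-- One-step comparison of the semigroup with the Euler step. -/
lemma step_err {v : Config → ℝ} {a N : ℤ} (haN : a ≤ N) (hv : Dep a N v) (hb : ∀ ω, |v ω| ≤ 1)
    {D : ℝ} (hW : W D v) {h : ℝ} (hh : 0 ≤ h) (ω : Config) :
    |Pt E h v ω - Q E.p h (Finset.Ico a N) v ω|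
      ≤ 4 * ((N - a + 2 : ℤ) : ℝ) ^ 2 * h ^ 2 + h * (D * Real.exp (-(N : ℝ))) := by
  have h0 := p0' E
  have h1 := p1' E
  have hL := eastGen_dep (p := E.p) hv
  set n : ℝ := ((N - a + 2 : ℤ) : ℝ) with hn
  have hn0 : 0 ≤ n := by rw [hn]; exact_mod_cast (by omega)
  have c1 : ∀ ω, |eastGen E.p v ω| ≤ 2 * n := by
    intro ω
    refine (eastGen_bd h0 h1 hv hb ω).trans ?_
    have : (((N + 1 - a).toNat : ℤ) : ℝ) ≤ n := by rw [hn]; exact_mod_cast (by omega)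
    have : ((N + 1 - a).toNat : ℝ) ≤ n := by exact_mod_cast this
    linarith
  have c2 : ∀ ω, |eastGen E.p (eastGen E.p v) ω| ≤ 4 * n ^ 2 := by
    intro ω
    refine (eastGen_bd h0 h1 hL c1 ω).trans ?_
    have : (((N + 1 + 1 - a).toNat : ℤ) : ℝ) ≤ n := by rw [hn]; exact_mod_cast (by omega)
    have : ((N + 1 + 1 - a).toNat : ℝ) ≤ n := by exact_mod_cast this
    nlinarith
  have t1 := Pt_taylor hv c2 ω hh
  have e : eastGen E.p v ω
      = (∑ x ∈ Finset.Ico a N, (K E.p x v ω - v ω)) + (K E.p N v ω - v ω) := by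
    rw [eastGen_eq (s := insert N (Finset.Ico a N)) hv]
    · rw [Finset.sum_insert (by simp)]; ring
    · intro x hx; simp only [Set.mem_Icc] at hx; simp; omega
  have t2 : |K E.p N v ω - v ω| ≤ D * Real.exp (-(N : ℝ)) := by
    rw [K]
    split_ifs
    · exact Ex_sub_abs h0 h1 (hW N) ω
    · simpa using (abs_nonneg _).trans (hW N ω)
  have t3 : Pt E h v ω - Q E.p h (Finset.Ico a N) v ω
      = (Pt E h v ω - v ω - h * eastGen E.p v ω) + h * (K E.p N v ω - v ω) := by
    rw [Q, e]; ring
  rw [t3]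
  refine (abs_add_le _ _).trans (add_le_add t1 ?_)
  rw [abs_mul, abs_of_nonneg hh]
  exact mul_le_mul_of_nonneg_left t2 hh

lemma iter_err {f : Config → ℝ} {a b N : ℤ} (haN : a ≤ N) (hbN : b ≤ N) (hf : Dep a b f)
    (hb : ∀ ω, |f ω| ≤ 1) {h : ℝ} (hh : 0 ≤ h) (hs : h * (Finset.Ico a N).card ≤ 1) {T : ℝ}
    (k : ℕ) (hk : k * h ≤ T) (ω : Config) :
    |Pt E (k * h) f ω - (Q E.p h (Finset.Ico a N))^[k] f ω|
      ≤ k * (4 * ((N - a + 2 : ℤ) : ℝ) ^ 2 * h ^ 2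
        + h * (2 * Real.exp (b : ℝ) * Real.exp (Real.exp 1 * T) * Real.exp (-(N : ℝ)))) := by
  have h0 := p0' E
  have h1 := p1' E
  induction k generalizing ω with
  | zero => simp [Pt_zero f hf.bm]
  | succ k ih =>
    have hk' : (k : ℝ) * h ≤ T := by push_cast at hk; nlinarith
    have ih := ih hk'
    set v := (Q E.p h (Finset.Ico a N))^[k] f with hv
    have hvD : Dep a N v := (hf.mono le_rfl hbN).Qiter k
    have hvb : ∀ ω, |v ω| ≤ 1 := Qi_abs_le h0 h1 hh hs k hb
    have hvW : W (2 * Real.exp (b : ℝ) * Real.exp (Real.exp 1 * T)) v := by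
      intro x ω
      refine ((W_of_dep hf (r := b) (fun x hx => hx.2) hb).Qi h0 h1 hh hs k x ω).trans ?_
      gcongr
    rw [Function.iterate_succ_apply', ← hv]
    have e1 : Pt E ((k + 1 : ℕ) * h) f ω = Pt E h (Pt E (k * h) f) ω := by
      rw [← Pt_semi hf.bm (by positivity) hh]; congr 1; push_cast; ring
    have e2 := step_err (E := E) haN hvD hvb hvW hh ω
    have e3 := Pt_abs_le (E := E) h (fun η => ih η) ω
    rw [Pt_sub (hf.bm.Pt _) hvD.bm] at e3
    rw [e1]
    calc _ ≤ _ := abs_sub_le _ (Pt E h v ω) _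
      _ ≤ _ := add_le_add e3 e2
      _ = _ := by push_cast; ring

/-- Uniform approximation of the semigroup by the iterated Euler scheme. -/
lemma approx (E : EastProcess) (a b : ℤ) {t : ℝ} (ht : 0 ≤ t) {ε : ℝ} (hε : 0 < ε) :
    ∀ᶠ N : ℤ in atTop, ∀ᶠ m : ℕ in atTop, ∀ f, Dep a b f → (∀ ω, |f ω| ≤ 1) → ∀ ω,
      |Pt E t f ω - (Q E.p (t / m) (Finset.Ico a N))^[m] f ω| ≤ ε := by
  have l1 : Tendsto (fun N : ℤ => t * (2 * Real.exp (b : ℝ) * Real.exp (Real.exp 1 * t)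
      * Real.exp (-(N : ℝ)))) atTop (𝓝 0) := by
    have : Tendsto (fun N : ℤ => Real.exp (-(N : ℝ))) atTop (𝓝 0) :=
      Real.tendsto_exp_neg_atTop_nhds_zero.comp tendsto_intCast_atTop_atTop
    have := (this.const_mul (2 * Real.exp (b : ℝ) * Real.exp (Real.exp 1 * t))).const_mul t
    simpa using this
  filter_upwards [l1.eventually_lt_const (half_pos hε), eventually_ge_atTop a,
    eventually_ge_atTop b] with N hN haN hbN
  have l2 : Tendsto (fun m : ℕ => 4 * ((N - a + 2 : ℤ) : ℝ) ^ 2 * t ^ 2 / (m : ℝ)) atTop (𝓝 0) :=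
    tendsto_const_div_atTop_nhds_zero_nat _
  have l3 : Tendsto (fun m : ℕ => t * (Finset.Ico a N).card / (m : ℝ)) atTop (𝓝 0) :=
    tendsto_const_div_atTop_nhds_zero_nat _
  filter_upwards [l2.eventually_lt_const (half_pos hε), l3.eventually_lt_const zero_lt_one,
    eventually_gt_atTop 0] with m hm1 hm2 hm0 f hf hb ω
  have hm0' : (0 : ℝ) < m := by exact_mod_cast hm0
  have hmt : (m : ℝ) * (t / m) = t := by field_simp
  have := iter_err (E := E) haN hbN hf hb (h := t / m) (by positivity)
    (by rw [div_mul_eq_mul_div]; exact hm2.le) (T := t) m hmt.le ω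
  rw [hmt] at this
  refine this.trans ?_
  have e : (m : ℝ) * (4 * ((N - a + 2 : ℤ) : ℝ) ^ 2 * (t / m) ^ 2
        + (t / m) * (2 * Real.exp (b : ℝ) * Real.exp (Real.exp 1 * t) * Real.exp (-(N : ℝ))))
      = 4 * ((N - a + 2 : ℤ) : ℝ) ^ 2 * t ^ 2 / (m : ℝ)
        + t * (2 * Real.exp (b : ℝ) * Real.exp (Real.exp 1 * t) * Real.exp (-(N : ℝ))) := by
    field_simp
  rw [e]; linarith

/-- Eventually the Euler step is small enough. -/
lemma step_small (t : ℝ) (s : Finset ℤ) :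
    ∀ᶠ m : ℕ in atTop, t / m * s.card ≤ 1 := by
  have l3 : Tendsto (fun m : ℕ => t * s.card / (m : ℝ)) atTop (𝓝 0) :=
    tendsto_const_div_atTop_nhds_zero_nat _
  filter_upwards [l3.eventually_lt_const zero_lt_one] with m hm
  rw [div_mul_eq_mul_div]; exact hm.le

end
end EA

namespace EA
section
variable {E : EastProcess}

lemma Pt_tendsto {f : ℕ → Config → ℝ} {g : Config → ℝ} {C : ℝ} (hf : ∀ n, Measurable (f n))
    (hC : ∀ n ω, |f n ω| ≤ C) (hl : ∀ ω, Tendsto (fun n => f n ω) atTop (𝓝 (g ω))) (t : ℝ)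
    (ω : Config) : Tendsto (fun n => Pt E t (f n) ω) atTop (𝓝 (Pt E t g ω)) := by
  refine tendsto_integral_of_dominated_convergence (fun _ => C)
    (fun n => (hf n).aestronglyMeasurable) (integrable_const _) (fun n => ae_of_all _ (hC n))
    (ae_of_all _ hl)

lemma measurable_shift (y : ℤ) : Measurable (shift y) := by
  unfold shift
  exact measurable_pi_lambda _ (fun x => measurable_pi_apply _)

lemma Pt_shift {f : Config → ℝ} (hf : BM f) {t : ℝ} (ht : 0 ≤ t) (y : ℤ) (ω : Config) :
    Pt E t f (shift y ω) = Pt E t (fun η => f (shift y η)) ω := by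
  rw [Pt, E.shiftComm t ht, integral_map (measurable_shift y).aemeasurable
    hf.1.aestronglyMeasurable]; rfl

open Classical in
/-- Indicator that there is a zero in `[a,b]`. -/
def zf (a b : ℤ) (ω : Config) : ℝ := if ∃ x, a ≤ x ∧ x ≤ b ∧ ω x = false then 1 else 0

lemma zf_dep (a b : ℤ) : Dep a b (zf a b) := by
  intro ω ω' H
  have : (∃ x, a ≤ x ∧ x ≤ b ∧ ω x = false) ↔ (∃ x, a ≤ x ∧ x ≤ b ∧ ω' x = false) := by
    constructor <;> rintro ⟨x, h1, h2, h3⟩ <;> refine ⟨x, h1, h2, ?_⟩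
    · rw [← H x ⟨h1, h2⟩]; exact h3
    · rw [H x ⟨h1, h2⟩]; exact h3
  classical
  unfold zf
  simp only [this]

lemma zf_nonneg (a b : ℤ) (ω : Config) : 0 ≤ zf a b ω := by
  unfold zf; split_ifs <;> norm_num

lemma zf_le_one (a b : ℤ) (ω : Config) : zf a b ω ≤ 1 := by
  unfold zf; split_ifs <;> norm_num

lemma zf_gen {p : ℝ} (h0 : 0 ≤ p) (h1 : p ≤ 1) (a b : ℤ) (ω : Config) :
    eastGen p (zf a b) ω ≤ zf a (b + 1) ω := by
  rw [eastGen_eq (s := Finset.Icc a b) (zf_dep a b) (by simp)]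
  have hKle : ∀ x, K p x (zf a b) ω ≤ 1 := by
    intro x
    have := K_mono h0 h1 x (zf_le_one a b) ω
    rwa [K_const] at this
  by_cases h : ∃ x, a ≤ x ∧ x ≤ b ∧ ω x = false
  · have hz : zf a b ω = 1 := by simp [zf, h]
    refine le_trans (Finset.sum_nonpos fun x _ => ?_) (zf_nonneg _ _ _)
    rw [hz]; linarith [hKle x]
  · have hz : zf a b ω = 0 := by simp only [zf, h, if_false]
    by_cases hab : a ≤ b
    · rw [Finset.sum_eq_single b]
      · rw [hz, sub_zero]
        by_cases hb : ω (b + 1) = false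
        · have : zf a (b + 1) ω = 1 := by
            have : ∃ x, a ≤ x ∧ x ≤ b + 1 ∧ ω x = false := ⟨b + 1, by omega, le_rfl, hb⟩
            simp [zf, this]
          rw [this]; exact hKle b
        · rw [K, if_neg hb, hz]; exact zf_nonneg _ _ _
      · intro x hx hxb
        simp only [Finset.mem_Icc] at hx
        have : ω (x + 1) ≠ false := fun hh => h ⟨x + 1, by omega, by omega, hh⟩
        rw [K, if_neg this, sub_self]
      · intro hb; simp [hab] at hb
    · rw [Finset.Icc_eq_empty hab]; simpa using zf_nonneg _ _ _

/-- Finite speed of propagation of the left-most zero. -/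
lemma speed_fin (a : ℤ) {ω : Config} (hω : ∀ x < 0, ω x = true) (j : ℕ) {t : ℝ} (ht : 0 ≤ t) :
    Pt E t (zf a (-(j : ℤ))) ω ≤ t ^ j / (j.factorial : ℝ) := by
  induction j generalizing t with
  | zero =>
    have := Pt_mono (E := E) (zf_dep a (-((0 : ℕ) : ℤ))).bm (bm_const 1) t (zf_le_one _ _) ω
    rw [Pt_const] at this
    simpa using this
  | succ j ih =>
    set f := zf a (-((j + 1 : ℕ) : ℤ)) with hf
    have hd : Dep a (-((j + 1 : ℕ) : ℤ)) f := zf_dep _ _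
    have hle : ∀ ω, eastGen E.p f ω ≤ zf a (-(j : ℤ)) ω := by
      intro ω
      have := zf_gen (p0' E) (p1' E) a (-((j + 1 : ℕ) : ℤ)) ω
      rw [show -((j + 1 : ℕ) : ℤ) + 1 = -(j : ℤ) by push_cast; ring] at this
      exact this
    have hD : ∀ s, 0 ≤ s → HasDerivWithinAt
        (fun u => Pt E u f ω - u ^ (j + 1) / ((j + 1).factorial : ℝ))
        (Pt E s (eastGen E.p f) ω - s ^ j / (j.factorial : ℝ)) (Set.Ici 0) s := by
      intro s hs
      have h2 := ((hasDerivAt_pow (j + 1) s).div_const ((j + 1).factorial : ℝ)).hasDerivWithinAt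
        (s := Set.Ici 0)
      refine ((fwd (E := E) hd ω hs).sub h2).congr_deriv ?_
      have : (j.factorial : ℝ) ≠ 0 := by positivity
      rw [Nat.factorial_succ]; push_cast
      field_simp
    have hanti : AntitoneOn (fun u => Pt E u f ω - u ^ (j + 1) / ((j + 1).factorial : ℝ))
        (Set.Ici 0) := by
      apply antitoneOn_of_deriv_nonpos (convex_Ici 0)
      · intro s hs; exact (hD s hs).continuousWithinAt
      · intro s hs
        rw [interior_Ici] at hs
        exact ((hD s (le_of_lt hs)).hasDerivAt (Ici_mem_nhds hs)).differentiableAt.differentiableWithinAt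
      · intro s hs
        rw [interior_Ici] at hs
        rw [((hD s (le_of_lt hs)).hasDerivAt (Ici_mem_nhds hs)).deriv]
        have h3 := Pt_mono (E := E) (eastGen_dep hd).bm (zf_dep a (-(j : ℤ))).bm s hle ω
        have h4 := ih (le_of_lt hs)
        linarith
    have h5 := hanti (Set.self_mem_Ici) ht ht
    have hf0 : f ω = 0 := by
      rw [hf, zf, if_neg]
      rintro ⟨x, _, hx, hx2⟩
      rw [hω x (by push_cast at hx; omega)] at hx2
      exact absurd hx2 (by simp)
    simp only [Pt_zero f hd.bm, hf0] at h5
    simp at h5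
    simpa using h5

open Classical in
/-- Indicator that there is a zero in `(-∞,b]`. -/
def zi (b : ℤ) (ω : Config) : ℝ := if ∃ x, x ≤ b ∧ ω x = false then 1 else 0

lemma zf_tendsto (b : ℤ) (ω : Config) :
    Tendsto (fun n : ℕ => zf (-(n : ℤ)) b ω) atTop (𝓝 (zi b ω)) := by
  apply tendsto_const_nhds.congr'
  by_cases h : ∃ x, x ≤ b ∧ ω x = false
  · obtain ⟨x, h1, h2⟩ := h
    filter_upwards [eventually_ge_atTop x.natAbs] with n hn
    unfold zi zf
    rw [if_pos ⟨x, h1, h2⟩, if_pos ⟨x, by omega, h1, h2⟩]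
  · refine Eventually.of_forall fun n => ?_
    unfold zi zf
    beta_reduce
    rw [if_neg h, if_neg]
    rintro ⟨x, _, h1, h2⟩; exact h ⟨x, h1, h2⟩

lemma zi_bm (b : ℤ) : BM (zi b) := by
  refine ⟨measurable_of_tendsto_metrizable (f := fun n : ℕ => zf (-(n : ℤ)) b)
    (fun n => (zf_dep _ _).bm.1) (tendsto_pi_nhds.2 (zf_tendsto b)), 1, fun ω => ?_⟩
  unfold zi; split_ifs <;> simp

lemma speed {ω : Config} (hω : ∀ x < 0, ω x = true) (j : ℕ) {t : ℝ} (ht : 0 ≤ t) :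
    Pt E t (zi (-(j : ℤ))) ω ≤ t ^ j / (j.factorial : ℝ) := by
  refine le_of_tendsto (Pt_tendsto (C := 1) (fun n => (zf_dep (-(n : ℤ)) (-(j : ℤ))).bm.1)
    (fun n ω => ?_) (zf_tendsto _) t ω) (Eventually.of_forall fun n => speed_fin _ hω j ht)
  rw [abs_of_nonneg (zf_nonneg _ _ _)]; exact zf_le_one _ _ _

/-! ### Decorrelation -/

lemma sum_exp_le (l : ℤ) (N : ℤ) (hN : l ≤ N) :
    ∑ x ∈ Finset.Ico l N, Real.exp (-(x : ℝ)) ≤ 2 * (Real.exp (-(l : ℝ)) - Real.exp (-(N : ℝ))) := by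
  induction N, hN using Int.leInduction with
  | base => simp
  | succ N hN ih =>
    have : Finset.Ico l (N + 1) = insert N (Finset.Ico l N) := by ext; simp; omega
    rw [this, Finset.sum_insert (by simp)]
    have e : Real.exp (-((N + 1 : ℤ) : ℝ)) * Real.exp 1 = Real.exp (-(N : ℝ)) := by
      rw [← Real.exp_add]; congr 1; push_cast; ring
    have h2 : (2 : ℝ) ≤ Real.exp 1 := by
      have := Real.add_one_le_exp (1 : ℝ); linarith
    have := Real.exp_pos (-((N + 1 : ℤ) : ℝ))
    nlinarith

lemma K_prod_bd {p : ℝ} (h0 : 0 ≤ p) (h1 : p ≤ 1) {G F : Config → ℝ} {C : ℝ} (hW : W C G)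
    (hF : ∀ ω, |F ω| ≤ 1) (x : ℤ) (ω : Config) :
    |K p x (fun ω => G ω * F ω) ω - G ω * K p x F ω - F ω * K p x G ω + G ω * F ω|
      ≤ 2 * (C * Real.exp (-(x : ℝ))) := by
  have hg := hW x ω
  have hC0 : 0 ≤ C * Real.exp (-(x : ℝ)) := (abs_nonneg _).trans hg
  simp only [K]
  split_ifs
  · simp only [Ex]
    have a1 := hF (Function.update ω x true)
    have a2 := hF (Function.update ω x false)
    have a3 : |F (Function.update ω x true) - F (Function.update ω x false)| ≤ 2 :=
      (abs_sub _ _).trans (by linarith)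
    have a4 := mul_le_mul hg a3 (abs_nonneg _) hC0
    rw [← abs_mul] at a4
    cases hx : ω x
    · have e := update_eq_of hx
      rw [e] at a4 ⊢
      set A := (G (Function.update ω x true) - G ω) * (F (Function.update ω x true) - F ω) with hA
      calc _ = |p * A| := by rw [hA]; congr 1; ring
        _ = p * |A| := by rw [abs_mul, abs_of_nonneg h0]
        _ ≤ 1 * |A| := by gcongr
        _ ≤ _ := by linarith
    · have e := update_eq_of hx
      rw [e] at a4 ⊢
      set A := (G ω - G (Function.update ω x false)) * (F ω - F (Function.update ω x false)) with hA
      calc _ = |(1 - p) * A| := by rw [hA]; congr 1; ring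
        _ = (1 - p) * |A| := by rw [abs_mul, abs_of_nonneg (sub_nonneg.2 h1)]
        _ ≤ 1 * |A| := by gcongr; linarith
        _ ≤ _ := by linarith
  · rw [show G ω * F ω - G ω * F ω - F ω * G ω + G ω * F ω = 0 by ring]; simpa using hC0

lemma gs_bd {p : ℝ} (h0 : 0 ≤ p) (h1 : p ≤ 1) {f : Config → ℝ} (hf : ∀ ω, |f ω| ≤ 1)
    (s : Finset ℤ) (ω : Config) : |∑ x ∈ s, (K p x f ω - f ω)| ≤ 2 * s.card := by
  refine (Finset.abs_sum_le_sum_abs _ _).trans ?_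
  have : ∀ x ∈ s, |K p x f ω - f ω| ≤ 2 := by
    intro x _
    have := abs_sub (K p x f ω) (f ω)
    have := K_abs_le h0 h1 x hf ω
    have := hf ω
    linarith
  refine (Finset.sum_le_sum this).trans ?_
  simp; linarith

lemma Q_prod_bd {p : ℝ} (h0 : 0 ≤ p) (h1 : p ≤ 1) {G F : Config → ℝ} {C : ℝ} (hW : W C G)
    (hG : ∀ ω, |G ω| ≤ 1) (hF : ∀ ω, |F ω| ≤ 1) {a l N : ℤ} (hal : a ≤ l) (hlN : l ≤ N)
    (hFd : Dep l N F) {h : ℝ} (hh : 0 ≤ h) (ω : Config) :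
    |Q p h (Finset.Ico a N) (fun ω => G ω * F ω) ω
        - Q p h (Finset.Ico a N) G ω * Q p h (Finset.Ico a N) F ω|
      ≤ h * (4 * C * Real.exp (-(l : ℝ))) + 4 * h ^ 2 * ((Finset.Ico a N).card : ℝ) ^ 2 := by
  set s := Finset.Ico a N with hs
  have hC0 : 0 ≤ C := by
    have hg := hW 0 ω
    have := (abs_nonneg _).trans hg
    simpa using this
  have e : Q p h s (fun ω => G ω * F ω) ω - Q p h s G ω * Q p h s F ω
      = h * (∑ x ∈ s, (K p x (fun ω => G ω * F ω) ω - G ω * K p x F ω - F ω * K p x G ω + G ω * F ω))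
        - h ^ 2 * ((∑ x ∈ s, (K p x G ω - G ω)) * (∑ x ∈ s, (K p x F ω - F ω))) := by
    have e1 : ∑ x ∈ s, (K p x (fun ω => G ω * F ω) ω - G ω * K p x F ω - F ω * K p x G ω + G ω * F ω)
        = ∑ x ∈ s, (K p x (fun ω => G ω * F ω) ω - G ω * F ω)
          - G ω * ∑ x ∈ s, (K p x F ω - F ω) - F ω * ∑ x ∈ s, (K p x G ω - G ω) := by
      rw [Finset.mul_sum, Finset.mul_sum, ← Finset.sum_sub_distrib, ← Finset.sum_sub_distrib]
      apply Finset.sum_congr rfl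
      intro x _; ring
    rw [e1]; simp only [Q]; ring
  rw [e]
  refine (abs_sub _ _).trans (add_le_add ?_ ?_)
  · rw [abs_mul, abs_of_nonneg hh]
    refine mul_le_mul_of_nonneg_left ?_ hh
    refine (Finset.abs_sum_le_sum_abs _ _).trans ?_
    have hsub : Finset.Ico l N ⊆ s := by
      intro x; simp only [hs, Finset.mem_Ico]; omega
    rw [← Finset.sum_subset hsub]
    · refine (Finset.sum_le_sum fun x _ => K_prod_bd h0 h1 hW hF x ω).trans ?_
      rw [← Finset.mul_sum, ← Finset.mul_sum]
      have := sum_exp_le l N hlN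
      have h3 := Real.exp_pos (-(N : ℝ))
      have : ∑ x ∈ Finset.Ico l N, Real.exp (-(x : ℝ)) ≤ 2 * Real.exp (-(l : ℝ)) := by linarith
      have := mul_le_mul_of_nonneg_left this hC0
      linarith
    · intro x hx hx2
      simp only [hs, Finset.mem_Ico] at hx hx2
      have hxl : x ∉ Set.Icc l N := by simp only [Set.mem_Icc]; omega
      have hK : K p x F ω = F ω := K_of_not_mem hFd hxl ω
      have hu : ∀ b, F (Function.update ω x b) = F ω := by
        intro b
        apply hFd
        intro y hy
        have : y ≠ x := by rintro rfl; exact hxl hy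
        simp [this]
      have hK2 : K p x (fun ω => G ω * F ω) ω = F ω * K p x G ω := by
        simp only [K, Ex, hu]; split_ifs <;> ring
      rw [hK, hK2, abs_eq_zero]; ring
  · rw [abs_mul, abs_mul, abs_of_nonneg (sq_nonneg h)]
    have b1 := gs_bd h0 h1 hG s ω
    have b2 := gs_bd h0 h1 hF s ω
    have := mul_le_mul b1 b2 (abs_nonneg _) (by positivity)
    have := mul_le_mul_of_nonneg_left this (sq_nonneg h)
    linarith

lemma decor_discrete {p : ℝ} (h0 : 0 ≤ p) (h1 : p ≤ 1) {g f : Config → ℝ} {a r l N : ℤ}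
    (hg : Dep a r g) (hf : Dep l N f) (hal : a ≤ l) (hlN : l ≤ N)
    (hgb : ∀ ω, |g ω| ≤ 1) (hfb : ∀ ω, |f ω| ≤ 1) {h : ℝ} (hh : 0 ≤ h)
    (hs : h * (Finset.Ico a N).card ≤ 1) {T : ℝ} (k : ℕ) (hk : k * h ≤ T) (ω : Config) :
    |(Q p h (Finset.Ico a N))^[k] (fun ω => g ω * f ω) ω
        - (Q p h (Finset.Ico a N))^[k] g ω * (Q p h (Finset.Ico a N))^[k] f ω|
      ≤ k * (h * (8 * Real.exp (r : ℝ) * Real.exp (Real.exp 1 * T) * Real.exp (-(l : ℝ)))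
        + 4 * h ^ 2 * ((Finset.Ico a N).card : ℝ) ^ 2) := by
  induction k generalizing ω with
  | zero => simp
  | succ k ih =>
    have hk' : (k : ℝ) * h ≤ T := by push_cast at hk; nlinarith
    have ih := ih hk'
    set s := Finset.Ico a N with hsd
    set G := (Q p h s)^[k] g with hG
    set F := (Q p h s)^[k] f with hF
    set H := (Q p h s)^[k] (fun ω => g ω * f ω) with hH
    simp only [Function.iterate_succ_apply']
    rw [← hG, ← hF, ← hH]
    have hW : W (2 * Real.exp (r : ℝ) * Real.exp (Real.exp 1 * T)) G := by
      intro x ω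
      refine ((W_of_dep hg (r := r) (fun x hx => hx.2) hgb).Qi h0 h1 hh hs k x ω).trans ?_
      gcongr
    have hGb : ∀ ω, |G ω| ≤ 1 := Qi_abs_le h0 h1 hh hs k hgb
    have hFb : ∀ ω, |F ω| ≤ 1 := Qi_abs_le h0 h1 hh hs k hfb
    have hFd : Dep l N F := hf.Qiter k
    have b1 := Q_prod_bd h0 h1 hW hGb hFb hal hlN hFd hh ω
    have b2 := Qi_abs_le h0 h1 hh hs 1 (f := fun ω => H ω - G ω * F ω) ih ω
    simp only [Function.iterate_one] at b2
    rw [Q_sub] at b2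
    calc _ ≤ _ := abs_sub_le _ (Q p h s (fun ω => G ω * F ω) ω) _
      _ ≤ _ := add_le_add b2 b1
      _ = _ := by push_cast; ring

/-- Decorrelation of well separated observables. -/
lemma decor {g f : Config → ℝ} {a r l b : ℤ}
    (hg : Dep a r g) (hf : Dep l b f) (hal : a ≤ l) (hrb : r ≤ b)
    (hgb : ∀ ω, |g ω| ≤ 1) (hfb : ∀ ω, |f ω| ≤ 1) {t : ℝ} (ht : 0 ≤ t) (ω : Config) :
    |Pt E t (fun ω => g ω * f ω) ω - Pt E t g ω * Pt E t f ω|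
      ≤ 8 * t * Real.exp (Real.exp 1 * t + r - l) := by
  have h0 := p0' E
  have h1 := p1' E
  apply le_of_forall_pos_le_add
  intro ε hε
  obtain ⟨N, hN, hlN, hbN⟩ := ((approx E a b ht (show 0 < ε / 4 by positivity)).and
    ((eventually_ge_atTop l).and (eventually_ge_atTop b))).exists
  have l2 : Tendsto (fun m : ℕ => 4 * t ^ 2 * ((Finset.Ico a N).card : ℝ) ^ 2 / (m : ℝ)) atTop (𝓝 0) :=
    tendsto_const_div_atTop_nhds_zero_nat _
  obtain ⟨m, hm, hm1, hm2, hm3⟩ := (hN.and ((step_small t (Finset.Ico a N)).and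
    ((l2.eventually_lt_const (show (0:ℝ) < ε / 4 by positivity)).and (eventually_gt_atTop 0)))).exists
  have hm0' : (0 : ℝ) < m := by exact_mod_cast hm3
  have hmt : (m : ℝ) * (t / m) = t := by field_simp
  have hgfb : ∀ ω, |g ω * f ω| ≤ 1 := fun ω => by
    rw [abs_mul]; exact mul_le_one₀ (hgb ω) (abs_nonneg _) (hfb ω)
  have hfd' := hf.mono hal (le_refl b)
  have hgd' := hg.mono (le_refl a) hrb
  have hgf : Dep a b (fun ω => g ω * f ω) := fun ω ω' H => by
    simp only; rw [hgd' _ _ H, hfd' _ _ H]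
  have a1 := hm _ hgf hgfb ω
  have a2 := hm _ hgd' hgb ω
  have a3 := hm _ hfd' hfb ω
  have a4 := decor_discrete h0 h1 hg (hf.mono le_rfl hbN) hal hlN hgb hfb (h := t / m)
    (by positivity) hm1 (T := t) m hmt.le ω
  set s := Finset.Ico a N
  set A := (Q E.p (t / m) s)^[m] (fun ω => g ω * f ω) ω
  set B := (Q E.p (t / m) s)^[m] g ω
  set C := (Q E.p (t / m) s)^[m] f ω with hCd
  have hC1 : |C| ≤ 1 := Qi_abs_le h0 h1 (by positivity) hm1 m hfb ω
  have hP1 : |Pt E t g ω| ≤ 1 := Pt_abs_le t hgb ω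
  have a5 : |Pt E t g ω * Pt E t f ω - B * C| ≤ ε / 4 + ε / 4 := by
    have : Pt E t g ω * Pt E t f ω - B * C
      = Pt E t g ω * (Pt E t f ω - C) + (Pt E t g ω - B) * C := by ring
    rw [this]
    refine (abs_add_le _ _).trans (add_le_add ?_ ?_)
    · rw [abs_mul]; nlinarith [abs_nonneg (Pt E t f ω - C)]
    · rw [abs_mul]; nlinarith [abs_nonneg (Pt E t g ω - B)]
  have a6 : (m : ℝ) * ((t / m) * (8 * Real.exp (r : ℝ) * Real.exp (Real.exp 1 * t) * Real.exp (-(l : ℝ)))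
        + 4 * (t / m) ^ 2 * (s.card : ℝ) ^ 2)
      = 8 * t * Real.exp (Real.exp 1 * t + r - l) + 4 * t ^ 2 * (s.card : ℝ) ^ 2 / (m : ℝ) := by
    rw [sub_eq_add_neg, Real.exp_add, Real.exp_add]
    field_simp
  rw [a6] at a4
  have a7 : Pt E t (fun ω => g ω * f ω) ω - Pt E t g ω * Pt E t f ω
    = (Pt E t (fun ω => g ω * f ω) ω - A) + (A - B * C) - (Pt E t g ω * Pt E t f ω - B * C) := by
    ring
  rw [a7]
  have := abs_sub ((Pt E t (fun ω => g ω * f ω) ω - A) + (A - B * C)) (Pt E t g ω * Pt E t f ω - B * C)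
  have := abs_add_le (Pt E t (fun ω => g ω * f ω) ω - A) (A - B * C)
  linarith

end
end EA

namespace EA
section
variable {E : EastProcess}

instance : IsProbabilityMeasure E.μ := E.μprob

lemma Dep.muInt {a b : ℤ} {f : Config → ℝ} (hf : Dep a b f) : Integrable f E.μ :=
  hf.bm.integrable _

open Classical in
/-- Indicator of a cylinder set. -/
def cylI (S : Finset ℤ) (σ : Config) (ω : Config) : ℝ := if ∀ x ∈ S, ω x = σ x then 1 else 0

/-- Configuration with ones exactly on `A`. -/
def cfg (A : Finset ℤ) : Config := fun x => decide (x ∈ A)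

lemma cylI_int (S : Finset ℤ) (σ : Config) :
    ∫ ω, cylI S σ ω ∂E.μ = ∏ x ∈ S, (if σ x then E.p else 1 - E.p) := by
  have hm : MeasurableSet {ω : Config | ∀ x ∈ S, ω x = σ x} := by
    have : {ω : Config | ∀ x ∈ S, ω x = σ x} = ⋂ x ∈ S, {ω : Config | ω x = σ x} := by
      ext; simp
    rw [this]
    exact S.measurableSet_biInter fun x _ => measurableSet_eq_fun (measurable_pi_apply x) measurable_const
  have : cylI S σ = Set.indicator {ω : Config | ∀ x ∈ S, ω x = σ x} (fun _ => (1 : ℝ)) := by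
    funext ω
    unfold cylI
    by_cases h : ∀ x ∈ S, ω x = σ x
    · rw [if_pos h, Set.indicator_of_mem (by exact h)]
    · rw [if_neg h, Set.indicator_of_notMem (by exact h)]
  rw [this, integral_indicator hm]
  simp only [integral_const, smul_eq_mul, mul_one, measureReal_restrict_apply_univ]
  rw [measureReal_def, E.μprod, ENNReal.toReal_prod]
  apply Finset.prod_congr rfl
  intro x _
  rw [ENNReal.toReal_ofReal]
  split_ifs
  · exact p0' E
  · linarith [p1' E]

lemma cylI_dep (S : Finset ℤ) (σ : Config) : DependsOnF (cylI S σ) ↑S := by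
  intro ω ω' H
  have : (∀ x ∈ S, ω x = σ x) ↔ (∀ x ∈ S, ω' x = σ x) :=
    forall₂_congr fun x hx => by rw [H x hx]
  classical
  unfold cylI
  simp only [this]

lemma cyl_expand {S : Finset ℤ} {ψ : Config → ℝ} (hψ : DependsOnF ψ ↑S) (ω : Config) :
    ψ ω = ∑ A ∈ S.powerset, ψ (cfg A) * cylI S (cfg A) ω := by
  classical
  rw [Finset.sum_eq_single (S.filter fun x => ω x = true)]
  · have h1 : ∀ x ∈ S, ω x = cfg (S.filter fun x => ω x = true) x := by
      intro x hx
      cases h : ω x <;> simp [cfg, h, hx]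
    rw [cylI, if_pos h1, mul_one]
    exact hψ _ _ h1
  · intro A hA hne
    rw [cylI, if_neg, mul_zero]
    intro H
    apply hne
    ext x
    simp only [Finset.mem_powerset] at hA
    simp only [Finset.mem_filter]
    constructor
    · intro hx
      refine ⟨hA hx, ?_⟩
      rw [H x (hA hx)]; simp [cfg, hx]
    · rintro ⟨hx, h2⟩
      rw [H x hx] at h2
      simpa [cfg] using h2
  · intro h; simp at h

lemma Ex_cylI {p : ℝ} {S : Finset ℤ} {x : ℤ} (hx : x ∈ S) (σ ω : Config) :
    Ex p x (cylI S σ) ω = (if σ x then p else 1 - p) * cylI (S.erase x) σ ω := by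
  classical
  have h : ∀ b, (∀ y ∈ S, Function.update ω x b y = σ y) ↔
      (b = σ x ∧ ∀ y ∈ S.erase x, ω y = σ y) := by
    intro b
    constructor
    · intro H
      refine ⟨by simpa using H x hx, fun y hy => ?_⟩
      have := H y (Finset.mem_of_mem_erase hy)
      rwa [Function.update_of_ne (Finset.ne_of_mem_erase hy)] at this
    · rintro ⟨H1, H2⟩ y hy
      by_cases hyx : y = x
      · subst hyx; simpa using H1
      · rw [Function.update_of_ne hyx]; exact H2 y (Finset.mem_erase.2 ⟨hyx, hy⟩)
  unfold Ex cylI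
  simp only [h]
  cases hσ : σ x <;> simp

/-- Invariance of `μ` under resampling one site. -/
lemma mu_Ex {a b : ℤ} {ψ : Config → ℝ} (hψ : Dep a b ψ) (x : ℤ) :
    ∫ ω, Ex E.p x ψ ω ∂E.μ = ∫ ω, ψ ω ∂E.μ := by
  classical
  set S : Finset ℤ := insert x (Finset.Icc a b) with hS
  have hψS : DependsOnF ψ ↑S := DependsOnF.mono' hψ (by simp [hS])
  have hx : x ∈ S := by simp [hS]
  have hcylint : ∀ (T : Finset ℤ) (σ : Config), Integrable (cylI T σ) E.μ := fun T σ =>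
    (bm_of_continuous (cyl_continuous ⟨T, cylI_dep T σ⟩)).integrable _
  have e1 : ∀ ω, Ex E.p x ψ ω = ∑ A ∈ S.powerset, ψ (cfg A) *
      ((if cfg A x then E.p else 1 - E.p) * cylI (S.erase x) (cfg A) ω) := by
    intro ω
    simp only [← Ex_cylI hx]
    rw [Ex, cyl_expand hψS (Function.update ω x true), cyl_expand hψS (Function.update ω x false),
      Finset.mul_sum, Finset.mul_sum, ← Finset.sum_add_distrib]
    apply Finset.sum_congr rfl
    intro A _; rw [Ex]; ring
  simp_rw [e1]
  rw [integral_finsetSum _ fun A _ => ((hcylint _ _).const_mul _).const_mul _]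
  have e2 : ∫ ω, ψ ω ∂E.μ = ∫ ω, ∑ A ∈ S.powerset, ψ (cfg A) * cylI S (cfg A) ω ∂E.μ := by
    congr 1; funext ω; exact cyl_expand hψS ω
  rw [e2, integral_finsetSum _ fun A _ => (hcylint _ _).const_mul _]
  apply Finset.sum_congr rfl
  intro A _
  rw [integral_const_mul, integral_const_mul, integral_const_mul, cylI_int, cylI_int]
  rw [Finset.mul_prod_erase S (fun x => if cfg A x then E.p else 1 - E.p) hx]

/-- Indicator that the site `k` is empty (`b = false`) or occupied. -/
def at0 (k : ℤ) (b : Bool) (ω : Config) : ℝ := if ω k = b then 1 else 0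

lemma at0_dep (k : ℤ) (b : Bool) : Dep k k (at0 k b) := by
  intro ω ω' H
  unfold at0
  rw [H k (by simp)]

lemma Dep.mul {a b a' b' : ℤ} {f g : Config → ℝ} (hf : Dep a b f) (hg : Dep a' b' g) :
    Dep (min a a') (max b b') (fun ω => f ω * g ω) := by
  intro ω ω' H
  have h1 := hf.mono (min_le_left a a') (le_max_left b b') _ _ H
  have h2 := hg.mono (min_le_right a a') (le_max_right b b') _ _ H
  simp only [h1, h2]

lemma dep_Ex' {p : ℝ} {a b x : ℤ} {f : Config → ℝ} (hf : Dep a b f) : Dep a b (Ex p x f) :=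
  DependsOnF.mono' (dep_Ex hf) (by simp)

lemma dep_K' {p : ℝ} {a b x : ℤ} {f : Config → ℝ} (hf : Dep a b f) : Dep a (b + 1) (K p x f) := by
  by_cases h : a ≤ x ∧ x ≤ b
  · exact dep_K (hf.mono le_rfl (by omega)) (by simp only [Set.mem_Icc]; omega)
  · intro ω ω' H
    have : x ∉ Set.Icc a b := by simpa [Set.mem_Icc] using h
    rw [K_of_not_mem hf this, K_of_not_mem hf this]
    exact hf.mono le_rfl (by omega) _ _ H

lemma Ex_at0_mul {p : ℝ} {x k : ℤ} (hk : k ≠ x) (c : Bool) (f : Config → ℝ) (ω : Config) :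
    Ex p x (fun ω => at0 k c ω * f ω) ω = at0 k c ω * Ex p x f ω := by
  simp only [Ex, at0, Function.update_of_ne hk]; ring

lemma K_eq_at0 {p : ℝ} (x : ℤ) (f : Config → ℝ) (ω : Config) :
    K p x f ω = Ex p x (fun ω => at0 (x + 1) false ω * f ω) ω + at0 (x + 1) true ω * f ω := by
  rw [Ex_at0_mul (by omega), K]
  unfold at0
  cases h : ω (x + 1) <;> simp

lemma mu_K {a b : ℤ} {ψ : Config → ℝ} (hψ : Dep a b ψ) (x : ℤ) :
    ∫ ω, K E.p x ψ ω ∂E.μ = ∫ ω, ψ ω ∂E.μ := by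
  simp_rw [K_eq_at0]
  have h0 := (at0_dep (x + 1) false).mul hψ
  have h1 := (at0_dep (x + 1) true).mul hψ
  rw [integral_add (dep_Ex' h0).muInt h1.muInt, mu_Ex h0, ← integral_add h0.muInt h1.muInt]
  congr 1
  funext ω
  unfold at0
  cases h : ω (x + 1) <;> simp

lemma mu_at0 {a b : ℤ} {ψ : Config → ℝ} (hψ : Dep a b ψ) {k : ℤ} (hk : k < a ∨ b < k) :
    ∫ ω, at0 k false ω * ψ ω ∂E.μ = (1 - E.p) * ∫ ω, ψ ω ∂E.μ := by
  rw [← mu_Ex ((at0_dep k false).mul hψ) k, ← integral_const_mul]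
  congr 1
  funext ω
  have hu : ∀ b', ψ (Function.update ω k b') = ψ ω := by
    intro b'
    apply hψ
    intro y hy
    simp only [Set.mem_Icc] at hy
    have : y ≠ k := by omega
    simp [this]
  simp [Ex, at0, hu]

/-- Poincaré inequality. -/
lemma poincare (hgap : 0 < gap E) {a b : ℤ} {φ : Config → ℝ} (hφ : Dep a b φ)
    (hmean : ∫ ζ, φ ζ ∂E.μ = 0) :
    gap E * ∫ ζ, φ ζ ^ 2 ∂E.μ ≤ -∫ ζ, φ ζ * eastGen E.p φ ζ ∂E.μ := by
  have hbdd : BddBelow (gapSet E) := by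
    by_contra h
    have : gap E = 0 := Real.sInf_of_not_bddBelow h
    linarith
  have hL2 : MemLp φ 2 E.μ := by
    obtain ⟨hm, C, hC⟩ := hφ.bm
    exact MemLp.of_bound hm.aestronglyMeasurable C (ae_of_all _ hC)
  have hvar : variance φ E.μ = ∫ ζ, φ ζ ^ 2 ∂E.μ := by
    rw [variance_eq_sub hL2, hmean]; simp
  have hφ2 : Dep a b (fun ζ => φ ζ ^ 2) := fun ω ω' H => by simp only [hφ _ _ H]
  by_cases hv : 0 < variance φ E.μ
  · have h1 : gap E ≤ (-∫ ω, φ ω * eastGen E.p φ ω ∂E.μ) / variance φ E.μ :=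
      csInf_le hbdd ⟨φ, hφ.cyl, hv, rfl⟩
    rw [le_div_iff₀ hv] at h1
    rwa [← hvar]
  · have hv0 : ∫ ζ, φ ζ ^ 2 ∂E.μ = 0 := by
      rw [← hvar]; exact le_antisymm (not_lt.1 hv) (variance_nonneg _ _)
    rw [hv0, mul_zero]
    have e : ∀ ζ, φ ζ * eastGen E.p φ ζ = ∑ x ∈ Finset.Icc a b, (φ ζ * K E.p x φ ζ - φ ζ ^ 2) := by
      intro ζ
      rw [eastGen_eq (s := Finset.Icc a b) hφ (by simp), Finset.mul_sum]
      apply Finset.sum_congr rfl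
      intro x _; ring
    have hd : ∀ x, Dep (min a a) (max b (b + 1)) (fun ζ => φ ζ * K E.p x φ ζ) := fun x =>
      hφ.mul (dep_K' hφ)
    have hi : ∀ x, Integrable (fun ζ => φ ζ * K E.p x φ ζ - φ ζ ^ 2) E.μ :=
      fun x => (hd x).muInt.sub hφ2.muInt
    simp_rw [e]
    rw [integral_finsetSum _ fun x _ => hi x, neg_nonneg]
    apply Finset.sum_nonpos
    intro x _
    rw [integral_sub (hd x).muInt hφ2.muInt, hv0, sub_zero]
    have h2 : ∫ ζ, φ ζ * K E.p x φ ζ ∂E.μ ≤ ∫ ζ, (1 / 2) * (φ ζ ^ 2 + K E.p x (fun ω => φ ω ^ 2) ζ) ∂E.μ := by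
      apply integral_mono (hd x).muInt
      · exact (hφ2.muInt.add (dep_K' hφ2).muInt).const_mul _
      · intro ζ
        have := K_sq_le (p0' E) (p1' E) x φ ζ
        simp only
        nlinarith [sq_nonneg (φ ζ - K E.p x φ ζ)]
    rw [integral_const_mul, integral_add hφ2.muInt (dep_K' hφ2).muInt, mu_K hφ2, hv0] at h2
    simpa using h2

/-! ### Marked configurations -/

/-- `ζ` on `[l,k)`, a zero at `k`, and `ω` elsewhere. -/
def mix (l k : ℤ) (ζ ω : Config) : Config := fun y =>
  if l ≤ y ∧ y < k then ζ y else if y = k then false else ω y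

/-- Average of `w` over `[l,k)` with a mark at `k`. -/
def B (E : EastProcess) (l k : ℤ) (w : Config → ℝ) (ω : Config) : ℝ := ∫ ζ, w (mix l k ζ ω) ∂E.μ

lemma mix_dep (l k : ℤ) (w : Config → ℝ) (ω : Config) : Dep l (k - 1) (fun ζ => w (mix l k ζ ω)) := by
  intro ζ ζ' H
  have : mix l k ζ ω = mix l k ζ' ω := by
    funext y
    unfold mix
    by_cases h : l ≤ y ∧ y < k
    · rw [if_pos h, if_pos h]; exact H y ⟨h.1, by omega⟩
    · rw [if_neg h, if_neg h]
  simp only [this]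

lemma mix_int (l k : ℤ) (w : Config → ℝ) (ω : Config) :
    Integrable (fun ζ => w (mix l k ζ ω)) E.μ := (mix_dep l k w ω).muInt

lemma B_mono (l k : ℤ) {w w' : Config → ℝ} (h : ∀ ω, w ω ≤ w' ω) (ω : Config) :
    B E l k w ω ≤ B E l k w' ω :=
  integral_mono (mix_int l k w ω) (mix_int l k w' ω) fun ζ => h _

lemma B_const (l k : ℤ) (c : ℝ) (ω : Config) : B E l k (fun _ => c) ω = c := by simp [B]

lemma B_add (l k : ℤ) (w w' : Config → ℝ) (ω : Config) :
    B E l k (fun ω => w ω + w' ω) ω = B E l k w ω + B E l k w' ω :=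
  integral_add (mix_int l k w ω) (mix_int l k w' ω)

lemma B_sub (l k : ℤ) (w w' : Config → ℝ) (ω : Config) :
    B E l k (fun ω => w ω - w' ω) ω = B E l k w ω - B E l k w' ω :=
  integral_sub (mix_int l k w ω) (mix_int l k w' ω)

lemma B_smul (l k : ℤ) (c : ℝ) (w : Config → ℝ) (ω : Config) :
    B E l k (fun ω => c * w ω) ω = c * B E l k w ω := integral_const_mul _ _

lemma B_sum (l k : ℤ) (s : Finset ℤ) (w : ℤ → Config → ℝ) (ω : Config) :
    B E l k (fun ω => ∑ x ∈ s, w x ω) ω = ∑ x ∈ s, B E l k (w x) ω :=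
  integral_finsetSum _ fun x _ => mix_int l k (w x) ω

lemma mix_update_lt {l k x : ℤ} (h1 : l ≤ x) (h2 : x < k) (ζ ω : Config) (b : Bool) :
    Function.update (mix l k ζ ω) x b = mix l k (Function.update ζ x b) ω := by
  funext y
  by_cases hy : y = x
  · subst hy; simp [mix, h1, h2]
  · simp [mix, hy]

lemma mix_update_gt {l k x : ℤ} (h2 : k < x) (ζ ω : Config) (b : Bool) :
    Function.update (mix l k ζ ω) x b = mix l k ζ (Function.update ω x b) := by
  funext y
  by_cases hy : y = x
  · subst hy
    have h3 : ¬ (l ≤ y ∧ y < k) := by omega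
    have h4 : y ≠ k := by omega
    simp [mix, h4]; omega
  · simp [mix, hy]

lemma mix_update_eq {l k : ℤ} (h1 : l ≤ k) {ω : Config} (hω : ω (k + 1) = false) (ζ : Config)
    (b : Bool) :
    Function.update (mix l k ζ ω) k b = mix l (k + 1) (Function.update ζ k b) ω := by
  funext y
  by_cases hy : y = k
  · subst hy; simp [mix, h1]
  · by_cases hy2 : y = k + 1
    · subst hy2
      simp [mix, hω]
    · simp only [mix, Function.update_of_ne hy, hy, hy2, if_false]
      have : (l ≤ y ∧ y < k) ↔ (l ≤ y ∧ y < k + 1) := by omega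
      simp [this]

lemma Ex_mix {p : ℝ} {l k x : ℤ} (h1 : l ≤ x) (h2 : x < k) (w : Config → ℝ) (ζ ω : Config) :
    Ex p x w (mix l k ζ ω) = Ex p x (fun ζ => w (mix l k ζ ω)) ζ := by
  simp only [Ex, mix_update_lt h1 h2]

lemma K_mix {p : ℝ} {l k x : ℤ} (h1 : l ≤ x) (h2 : x + 1 < k) (w : Config → ℝ) (ζ ω : Config) :
    K p x w (mix l k ζ ω) = K p x (fun ζ => w (mix l k ζ ω)) ζ := by
  simp only [K, Ex_mix h1 (show x < k by omega)]
  have : mix l k ζ ω (x + 1) = ζ (x + 1) := by simp [mix, h2]; omega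
  rw [this]

lemma K_mix_last {p : ℝ} {l k x : ℤ} (h1 : l ≤ x) (h2 : x + 1 = k) (w : Config → ℝ) (ζ ω : Config) :
    K p x w (mix l k ζ ω) = Ex p x (fun ζ => w (mix l k ζ ω)) ζ := by
  simp only [K, Ex_mix h1 (show x < k by omega)]
  have : mix l k ζ ω (x + 1) = false := by simp [mix, h2]
  rw [this]; simp

lemma B_K_lt {l k x : ℤ} (h1 : l ≤ x) (h2 : x < k) (w : Config → ℝ) (ω : Config) :
    B E l k (K E.p x w) ω = B E l k w ω := by
  unfold B
  by_cases h : x + 1 < k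
  · simp_rw [K_mix h1 h]; exact mu_K (mix_dep l k w ω) x
  · simp_rw [K_mix_last h1 (show x + 1 = k by omega)]; exact mu_Ex (mix_dep l k w ω) x

lemma B_K_eq {l k : ℤ} (h1 : l ≤ k) (w : Config → ℝ) (ω : Config) :
    B E l k (K E.p k w) ω = if ω (k + 1) = false then B E l (k + 1) w ω else B E l k w ω := by
  have hm : ∀ ζ, mix l k ζ ω (k + 1) = ω (k + 1) := by intro ζ; simp [mix]
  by_cases h : ω (k + 1) = false
  · rw [if_pos h]
    unfold B
    rw [← mu_Ex (mix_dep l (k + 1) w ω) k]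
    congr 1
    funext ζ
    rw [K, hm, if_pos h, Ex, mix_update_eq h1 h, mix_update_eq h1 h]; rfl
  · rw [if_neg h]
    unfold B
    congr 1
    funext ζ
    rw [K, hm, if_neg h]

lemma B_K_gt {l k x : ℤ} (hx : k < x) (w : Config → ℝ) (ω : Config) :
    B E l k (K E.p x w) ω = K E.p x (B E l k w) ω := by
  have hm : ∀ ζ, mix l k ζ ω (x + 1) = ω (x + 1) := by
    intro ζ
    have h3 : ¬ (l ≤ x + 1 ∧ x + 1 < k) := by omega
    have h4 : x + 1 ≠ k := by omega
    simp only [mix, h3, h4, if_false]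
  by_cases h : ω (x + 1) = false
  · rw [K, if_pos h, Ex]
    unfold B
    rw [← integral_const_mul, ← integral_const_mul, ← integral_add]
    · congr 1
      funext ζ
      rw [K, hm, if_pos h, Ex, mix_update_gt hx, mix_update_gt hx]
    · exact (mix_int _ _ _ _).const_mul _
    · exact (mix_int _ _ _ _).const_mul _
  · rw [K, if_neg h]
    unfold B
    congr 1
    funext ζ
    rw [K, hm, if_neg h]

/-- The dynamics to the right of the mark preserves uniform bounds. -/
lemma B_K_le {l k N x : ℤ} (hl : l ≤ k) {w : Config → ℝ} {S : ℝ}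
    (hS : ∀ k' ω, k ≤ k' → k' ≤ N → B E l k' w ω ≤ S) (hkN : k ≤ N) (h1 : l ≤ x) (h2 : x < N)
    (ω : Config) : B E l k (K E.p x w) ω ≤ S := by
  rcases lt_trichotomy x k with h | h | h
  · rw [B_K_lt h1 h]; exact hS k ω le_rfl hkN
  · subst h
    rw [B_K_eq hl]
    split_ifs
    · exact hS _ _ (by omega) (by omega)
    · exact hS _ _ le_rfl hkN
  · rw [B_K_gt h]
    have := K_mono (p0' E) (p1' E) x (f := B E l k w) (g := fun _ => S)
      (fun ω => hS k ω le_rfl hkN) ω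
    rwa [K_const] at this

lemma B_Q_le {l N : ℤ} (hl : l ≤ 0) {w : Config → ℝ} {S h : ℝ} (hh : 0 ≤ h)
    (hs : h * (Finset.Ico l N).card ≤ 1)
    (hS : ∀ k ω, 0 ≤ k → k ≤ N → B E l k w ω ≤ S) (k : ℤ) (ω : Config) (hk : 0 ≤ k) (hkN : k ≤ N) :
    B E l k (Q E.p h (Finset.Ico l N) w) ω ≤ S := by
  have e : Q E.p h (Finset.Ico l N) w = fun ω => (1 - h * (Finset.Ico l N).card) * w ω
      + h * ∑ x ∈ Finset.Ico l N, K E.p x w ω := funext (Q_eq _ _)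
  rw [e, B_add, B_smul, B_smul, B_sum]
  have h1 : ∑ x ∈ Finset.Ico l N, B E l k (K E.p x w) ω ≤ ∑ x ∈ Finset.Ico l N, S := by
    apply Finset.sum_le_sum
    intro x hx
    simp only [Finset.mem_Ico] at hx
    exact B_K_le (by omega) (fun k' ω h h' => hS k' ω (by omega) h') hkN hx.1 hx.2 ω
  rw [Finset.sum_const, nsmul_eq_mul] at h1
  have h2 := mul_le_mul_of_nonneg_left h1 hh
  have h3 := mul_le_mul_of_nonneg_left (hS k ω hk hkN) (sub_nonneg.2 hs)
  linarith

lemma B_Qi_le {l N : ℤ} (hl : l ≤ 0) {w : Config → ℝ} {S h : ℝ} (hh : 0 ≤ h)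
    (hs : h * (Finset.Ico l N).card ≤ 1)
    (hS : ∀ k ω, 0 ≤ k → k ≤ N → B E l k w ω ≤ S) (m : ℕ) (k : ℤ) (ω : Config) (hk : 0 ≤ k)
    (hkN : k ≤ N) : B E l k ((Q E.p h (Finset.Ico l N))^[m] w) ω ≤ S := by
  induction m generalizing k ω with
  | zero => exact hS k ω hk hkN
  | succ m ih =>
    rw [Function.iterate_succ_apply']
    exact B_Q_le hl hh hs (fun k ω h h' => ih k ω h h') k ω hk hkN

/-- Dissipation to the left of the mark. -/
lemma B_dissip (hgap : 0 < gap E) {l k : ℤ} (hl : l ≤ k) {u : Config → ℝ} {ω : Config}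
    (hu : B E l k u ω = 0) :
    ∑ x ∈ Finset.Ico l k, B E l k (fun ω => u ω * (K E.p x u ω - u ω)) ω
      ≤ -(gap E * B E l k (fun ω => u ω ^ 2) ω) := by
  set φ : Config → ℝ := fun ζ => u (mix l k ζ ω) with hφ
  have hd : Dep l (k - 1) φ := mix_dep l k u ω
  have hp := poincare hgap hd hu
  have hφ2 : Dep l (k - 1) (fun ζ => φ ζ ^ 2) := fun ω ω' H => by simp only [hd _ _ H]
  have hi : ∀ x, Integrable (fun ζ => φ ζ * (K E.p x φ ζ - φ ζ)) E.μ := by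
    intro x
    have h1 : Dep l k (fun ζ => φ ζ * (K E.p x φ ζ - φ ζ)) := fun ω ω' H => by
      simp only
      have h2 := (dep_K' (p := E.p) (x := x) hd).mono (le_refl l) (show k - 1 + 1 ≤ k by omega) _ _ H
      have h3 := hd.mono (le_refl l) (show k - 1 ≤ k by omega) _ _ H
      rw [h2, h3]
    exact h1.muInt
  have hle : ∀ x ∈ Finset.Ico l k, B E l k (fun ω => u ω * (K E.p x u ω - u ω)) ω
      ≤ ∫ ζ, φ ζ * (K E.p x φ ζ - φ ζ) ∂E.μ := by
    intro x hx
    simp only [Finset.mem_Ico] at hx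
    unfold B
    by_cases h : x + 1 < k
    · simp_rw [K_mix hx.1 h]; exact le_rfl
    · have hk : x + 1 = k := by omega
      simp_rw [K_mix_last hx.1 hk]
      change ∫ ζ, φ ζ * (Ex E.p x φ ζ - φ ζ) ∂E.μ ≤ _
      have hEd := dep_Ex' (p := E.p) (x := x) hd
      have hEd2 := dep_Ex' (p := E.p) (x := x) hφ2
      have hi2 : Integrable (fun ζ => φ ζ * (Ex E.p x φ ζ - φ ζ)) E.μ := by
        have h1 : Dep l (k - 1) (fun ζ => φ ζ * (Ex E.p x φ ζ - φ ζ)) := fun ω ω' H => by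
          simp only; rw [hEd _ _ H, hd _ _ H]
        exact h1.muInt
      rw [← sub_nonneg, ← integral_sub (hi x) hi2]
      have hge : ∀ ζ, (1 / 2) * (at0 k true ζ * φ ζ ^ 2 - Ex E.p x (fun ζ => at0 k true ζ * φ ζ ^ 2) ζ)
          ≤ φ ζ * (K E.p x φ ζ - φ ζ) - φ ζ * (Ex E.p x φ ζ - φ ζ) := by
        intro ζ
        rw [Ex_at0_mul (by omega)]
        rw [K, hk]
        unfold at0
        cases hz : ζ k
        · simp
        · simp only [if_true, one_mul]
          have hE : Ex E.p x φ ζ ^ 2 ≤ Ex E.p x (fun ζ => φ ζ ^ 2) ζ := by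
            simp only [Ex]
            set a := φ (Function.update ζ x true)
            set b := φ (Function.update ζ x false)
            nlinarith [mul_nonneg (mul_nonneg (p0' E) (sub_nonneg.2 (p1' E))) (sq_nonneg (a - b))]
          simp only [Bool.true_eq_false, if_false]
          nlinarith [sq_nonneg (φ ζ - Ex E.p x φ ζ)]
      have hat := (at0_dep k true).mul hφ2
      have hge2 := integral_mono (μ := E.μ)
        ((hat.muInt.sub (dep_Ex' (p := E.p) (x := x) hat).muInt).const_mul (1 / 2))
        ((hi x).sub hi2) hge
      refine le_trans ?_ hge2
      have h5 := mu_Ex (E := E) hat x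
      simp only [Pi.sub_apply]
      rw [integral_const_mul, integral_sub hat.muInt (dep_Ex' (p := E.p) (x := x) hat).muInt, h5]
      simp
  refine (Finset.sum_le_sum hle).trans ?_
  rw [← integral_finsetSum _ fun x _ => hi x]
  have e : ∀ ζ, ∑ x ∈ Finset.Ico l k, φ ζ * (K E.p x φ ζ - φ ζ) = φ ζ * eastGen E.p φ ζ := by
    intro ζ
    rw [eastGen_eq (s := Finset.Ico l k) hd, Finset.mul_sum]
    intro x hx
    simp only [Set.mem_Icc] at hx
    simp; omega
  simp_rw [e]
  unfold B
  linarith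

lemma B_sq_step (hgap : 0 < gap E) {l N : ℤ} (hl : l ≤ 0) {u : Config → ℝ} (hub : ∀ ω, |u ω| ≤ 1)
    {S h : ℝ} (hh : 0 ≤ h) (hs : h * ((Finset.Ico l N).card + 2 * gap E) ≤ 1)
    (hu : ∀ k ω, 0 ≤ k → k ≤ N → B E l k u ω = 0)
    (hS : ∀ k ω, 0 ≤ k → k ≤ N → B E l k (fun ω => u ω ^ 2) ω ≤ S) (k : ℤ) (ω : Config)
    (hk : 0 ≤ k) (hkN : k ≤ N) :
    B E l k (fun ω => Q E.p h (Finset.Ico l N) u ω ^ 2) ω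
      ≤ (1 - 2 * gap E * h) * S + 4 * h ^ 2 * ((Finset.Ico l N).card : ℝ) ^ 2 := by
  set s := Finset.Ico l N with hsd
  set b := B E l k (fun ω => u ω ^ 2) ω with hb
  have hbS : b ≤ S := hS k ω hk hkN
  have h1 : ∀ ω, Q E.p h s u ω ^ 2 ≤ u ω ^ 2
      + 2 * h * ∑ x ∈ s, u ω * (K E.p x u ω - u ω) + 4 * h ^ 2 * (s.card : ℝ) ^ 2 := by
    intro ω
    have h2 := gs_bd (p0' E) (p1' E) hub s ω
    rw [← Finset.mul_sum, Q]
    set D := ∑ x ∈ s, (K E.p x u ω - u ω)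
    have h3 : D ^ 2 ≤ (2 * s.card) ^ 2 := sq_le_sq' (abs_le.1 h2).1 (abs_le.1 h2).2
    nlinarith [mul_le_mul_of_nonneg_left h3 (sq_nonneg h)]
  refine (B_mono l k h1 ω).trans ?_
  rw [B_add, B_add, B_smul, B_sum, B_const, ← hb]
  have hsplit : ∑ x ∈ s, B E l k (fun ω => u ω * (K E.p x u ω - u ω)) ω
      = ∑ x ∈ Finset.Ico l k, B E l k (fun ω => u ω * (K E.p x u ω - u ω)) ω
        + ∑ x ∈ Finset.Ico k N, B E l k (fun ω => u ω * (K E.p x u ω - u ω)) ω := by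
    rw [← Finset.sum_union]
    · congr 1
      ext x; simp only [hsd, Finset.mem_union, Finset.mem_Ico]; omega
    · rw [Finset.disjoint_left]; intro x; simp only [Finset.mem_Ico]; omega
  have hA := B_dissip hgap (show l ≤ k by omega) (hu k ω hk hkN)
  have hB : ∑ x ∈ Finset.Ico k N, B E l k (fun ω => u ω * (K E.p x u ω - u ω)) ω
      ≤ (Finset.Ico k N).card * ((S - b) / 2) := by
    rw [← nsmul_eq_mul, ← Finset.sum_const]
    apply Finset.sum_le_sum
    intro x hx
    simp only [Finset.mem_Ico] at hx
    have h2 : ∀ ω, u ω * (K E.p x u ω - u ω) ≤ (1 / 2) * (K E.p x (fun ω => u ω ^ 2) ω - u ω ^ 2) := by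
      intro ω
      have := K_sq_le (p0' E) (p1' E) x u ω
      nlinarith [sq_nonneg (u ω - K E.p x u ω)]
    have h3 := B_mono (E := E) l k h2 ω
    rw [B_smul, B_sub] at h3
    have h4 := B_K_le (E := E) (show l ≤ k by omega) (w := fun ω => u ω ^ 2)
      (fun k' ω h h' => hS k' ω (by omega) h') hkN (show l ≤ x by omega) hx.2 ω
    linarith
  rw [hsplit]
  have hcard : ((Finset.Ico k N).card : ℝ) ≤ s.card := by
    exact_mod_cast Finset.card_le_card (fun x => by simp only [hsd, Finset.mem_Ico]; omega)
  set n : ℝ := ((Finset.Ico k N).card : ℝ)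
  have hn0 : (0 : ℝ) ≤ n := by positivity
  have h5 : (1 - 2 * gap E * h - h * n) * b ≤ (1 - 2 * gap E * h - h * n) * S := by
    apply mul_le_mul_of_nonneg_left hbS
    nlinarith
  have h6 := mul_le_mul_of_nonneg_left (add_le_add hA hB) (show 0 ≤ 2 * h by positivity)
  linarith

lemma B_Q_zero {l N : ℤ} (hl : l ≤ 0) {u : Config → ℝ} {h : ℝ}
    (hu : ∀ k ω, 0 ≤ k → k ≤ N → B E l k u ω = 0) (k : ℤ) (ω : Config)
    (hk : 0 ≤ k) (hkN : k ≤ N) : B E l k (Q E.p h (Finset.Ico l N) u) ω = 0 := by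
  have e : Q E.p h (Finset.Ico l N) u = fun ω => (1 - h * (Finset.Ico l N).card) * u ω
      + h * ∑ x ∈ Finset.Ico l N, K E.p x u ω := funext (Q_eq _ _)
  rw [e, B_add, B_smul, B_smul, B_sum, hu k ω hk hkN, Finset.sum_eq_zero]
  · simp
  intro x hx
  simp only [Finset.mem_Ico] at hx
  rcases lt_trichotomy x k with h | h | h
  · rw [B_K_lt hx.1 h]; exact hu k ω hk hkN
  · subst h
    rw [B_K_eq (by omega)]
    split_ifs
    · exact hu _ _ (by omega) (by omega)
    · exact hu _ _ hk hkN
  · rw [B_K_gt h]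
    simp only [K, Ex, hu k _ hk hkN]; simp

lemma B_sq_iter (hgap : 0 < gap E) {l N : ℤ} (hl : l ≤ 0) {f : Config → ℝ} (hfb : ∀ ω, |f ω| ≤ 1)
    {h : ℝ} (hh : 0 ≤ h) (hs : h * ((Finset.Ico l N).card + 2 * gap E) ≤ 1)
    (hf : ∀ k ω, 0 ≤ k → k ≤ N → B E l k f ω = 0) (m : ℕ) :
    (∀ k ω, 0 ≤ k → k ≤ N → B E l k ((Q E.p h (Finset.Ico l N))^[m] f) ω = 0) ∧
    (∀ k ω, 0 ≤ k → k ≤ N → B E l k (fun ω => (Q E.p h (Finset.Ico l N))^[m] f ω ^ 2) ω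
      ≤ (1 - 2 * gap E * h) ^ m + m * (4 * h ^ 2 * ((Finset.Ico l N).card : ℝ) ^ 2)) := by
  have hc0 : (0 : ℝ) ≤ ((Finset.Ico l N).card : ℝ) := by positivity
  have hs1 : h * (Finset.Ico l N).card ≤ 1 := by nlinarith
  have hg1 : 0 ≤ 1 - 2 * gap E * h := by nlinarith
  have hg2 : 1 - 2 * gap E * h ≤ 1 := by nlinarith
  induction m with
  | zero =>
    refine ⟨hf, fun k ω _ _ => ?_⟩
    have := B_mono (E := E) l k (w := fun ω => f ω ^ 2) (w' := fun _ => 1) (fun ω => by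
      have := hfb ω; rw [← sq_abs]; exact pow_le_one₀ (abs_nonneg _) this) ω
    rw [B_const] at this
    simpa using this
  | succ m ih =>
    obtain ⟨i1, i2⟩ := ih
    simp only [Function.iterate_succ_apply']
    refine ⟨fun k ω hk hkN => B_Q_zero hl i1 k ω hk hkN, fun k ω hk hkN => ?_⟩
    refine (B_sq_step hgap hl (Qi_abs_le (p0' E) (p1' E) hh hs1 m hfb) hh hs i1 i2 k ω hk hkN).trans ?_
    set c := 4 * h ^ 2 * ((Finset.Ico l N).card : ℝ) ^ 2
    have hc : 0 ≤ c := by positivity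
    have hm : 0 ≤ (m : ℝ) * c := by positivity
    push_cast
    rw [pow_succ]
    nlinarith

/-- Marked relaxation in `L²`. -/
lemma B_relax (hgap : 0 < gap E) {l b : ℤ} (hl : l ≤ 0) {f : Config → ℝ} (hfb : ∀ ω, |f ω| ≤ 1)
    (hfd : Dep l b f) (hf : ∀ k ω, 0 ≤ k → B E l k f ω = 0) {t : ℝ} (ht : 0 ≤ t) {k : ℤ}
    (hk : 0 ≤ k) (ω : Config) :
    B E l k (fun ω => Pt E t f ω ^ 2) ω ≤ Real.exp (-(gap E * t)) ^ 2 := by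
  apply le_of_forall_pos_le_add
  intro ε hε
  obtain ⟨N, hN, hkN⟩ := ((approx E l b ht (show 0 < ε / 4 by positivity)).and
    (eventually_ge_atTop k)).exists
  have l2 : Tendsto (fun m : ℕ => 4 * t ^ 2 * ((Finset.Ico l N).card : ℝ) ^ 2 / (m : ℝ)) atTop (𝓝 0) :=
    tendsto_const_div_atTop_nhds_zero_nat _
  have l3 : Tendsto (fun m : ℕ => t * ((Finset.Ico l N).card + 2 * gap E) / (m : ℝ)) atTop (𝓝 0) :=
    tendsto_const_div_atTop_nhds_zero_nat _
  obtain ⟨m, hm, hm1, hm2, hm3⟩ := (hN.and ((l3.eventually_lt_const zero_lt_one).and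
    ((l2.eventually_lt_const (show (0:ℝ) < ε / 4 by positivity)).and (eventually_gt_atTop 0)))).exists
  have hm0' : (0 : ℝ) < m := by exact_mod_cast hm3
  have hs : t / m * ((Finset.Ico l N).card + 2 * gap E) ≤ 1 := by
    rw [div_mul_eq_mul_div]; exact hm1.le
  have hs1 : t / m * (Finset.Ico l N).card ≤ 1 := by
    have : 0 ≤ t / m := by positivity
    nlinarith
  have hi := (B_sq_iter hgap hl hfb (show 0 ≤ t / m by positivity) hs
    (fun k ω h _ => hf k ω h) m).2 k ω hk hkN
  set v := (Q E.p (t / m) (Finset.Ico l N))^[m] f with hv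
  have hvb : ∀ ω, |v ω| ≤ 1 := Qi_abs_le (p0' E) (p1' E) (by positivity) hs1 m hfb
  have h1 : ∀ ω, Pt E t f ω ^ 2 ≤ v ω ^ 2 + 2 * (ε / 4) := by
    intro ω
    have a1 := hm f hfd hfb ω
    have a2 := hvb ω
    have a3 : |Pt E t f ω| ≤ 1 := Pt_abs_le t hfb ω
    have e : Pt E t f ω ^ 2 - v ω ^ 2 = (Pt E t f ω - v ω) * (Pt E t f ω + v ω) := by ring
    have a4 : |Pt E t f ω + v ω| ≤ 2 := (abs_add_le _ _).trans (by linarith)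
    have a5 := mul_le_mul a1 a4 (abs_nonneg _) (by positivity)
    rw [← abs_mul, ← e] at a5
    have := le_abs_self (Pt E t f ω ^ 2 - v ω ^ 2)
    linarith
  have h2 := B_mono (E := E) l k h1 ω
  rw [B_add, B_const] at h2
  have hpow : (1 - 2 * gap E * (t / m)) ^ m ≤ Real.exp (-(gap E * t)) ^ 2 := by
    have h3 : 1 - 2 * gap E * (t / m) ≤ Real.exp (-(2 * gap E * (t / m))) := by
      have := Real.add_one_le_exp (-(2 * gap E * (t / m))); linarith
    have h4 : 0 ≤ 1 - 2 * gap E * (t / m) := by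
      have h5 : 0 ≤ t / m * (Finset.Ico l N).card := by positivity
      nlinarith
    refine (pow_le_pow_left₀ h4 h3 m).trans ?_
    rw [← Real.exp_nat_mul, ← Real.exp_nat_mul]
    apply le_of_eq; congr 1; field_simp; push_cast; ring
  have e2 : (m : ℝ) * (4 * (t / m) ^ 2 * ((Finset.Ico l N).card : ℝ) ^ 2)
    = 4 * t ^ 2 * ((Finset.Ico l N).card : ℝ) ^ 2 / (m : ℝ) := by field_simp
  rw [e2] at hi
  linarith

lemma B_relax_abs (hgap : 0 < gap E) {l b : ℤ} (hl : l ≤ 0) {f : Config → ℝ}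
    (hfb : ∀ ω, |f ω| ≤ 1)
    (hfd : Dep l b f) (hf : ∀ k ω, 0 ≤ k → B E l k f ω = 0) {t : ℝ} (ht : 0 ≤ t) {k : ℤ}
    (hk : 0 ≤ k) (ω : Config) :
    B E l k (fun ω => |Pt E t f ω|) ω ≤ Real.exp (-(gap E * t)) := by
  have h := B_relax hgap hl hfb hfd hf ht hk ω
  set c := Real.exp (-(gap E * t))
  have hc : 0 < c := Real.exp_pos _
  have h1 : ∀ ω, |Pt E t f ω| ≤ (1 / (2 * c)) * Pt E t f ω ^ 2 + c / 2 := by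
    intro ω
    rw [← sq_abs]
    set y := |Pt E t f ω|
    have : (1 / (2 * c)) * y ^ 2 + c / 2 - y = (1 / (2 * c)) * (y - c) ^ 2 := by field_simp; ring
    have : 0 ≤ (1 / (2 * c)) * (y - c) ^ 2 := by positivity
    linarith
  have h2 := B_mono (E := E) l k h1 ω
  rw [B_add, B_const, B_smul] at h2
  have h3 := mul_le_mul_of_nonneg_left h (show 0 ≤ 1 / (2 * c) by positivity)
  have : (1 / (2 * c)) * c ^ 2 = c / 2 := by field_simp
  linarith

/-- Uniform bounds on marked averages propagate under the semigroup. -/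
lemma B_Pt_le {l b : ℤ} (hl : l ≤ 0) {w : Config → ℝ} (hwb : ∀ ω, |w ω| ≤ 1) (hwd : Dep l b w)
    {S : ℝ} (hS : ∀ k ω, 0 ≤ k → B E l k w ω ≤ S) {t : ℝ} (ht : 0 ≤ t) {k : ℤ}
    (hk : 0 ≤ k) (ω : Config) : B E l k (Pt E t w) ω ≤ S := by
  apply le_of_forall_pos_le_add
  intro ε hε
  obtain ⟨N, hN, hkN⟩ := ((approx E l b ht hε).and (eventually_ge_atTop k)).exists
  obtain ⟨m, hm, hs⟩ := (hN.and (step_small t (Finset.Ico l N))).exists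
  have hi := B_Qi_le (E := E) hl (show 0 ≤ t / m by positivity) hs (fun k ω h _ => hS k ω h) m k ω
    hk hkN
  have h2 := B_mono (E := E) l k (w := Pt E t w)
    (w' := fun ω => (Q E.p (t / m) (Finset.Ico l N))^[m] w ω + ε)
    (fun ω => by have := (abs_le.1 (hm w hwd hwb ω)).2; linarith) ω
  rw [B_add, B_const] at h2
  linarith

/-- Pointwise comparison with the marked average. -/
lemma B_point {n : ℕ} {w : Config → ℝ} (hw : ∀ ω, 0 ≤ w ω) {ω : Config}
    (h0 : ω 0 = false) (h1 : ∀ x, x < 0 → ω x = true) :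
    E.p ^ n * w ω ≤ B E (-(n : ℤ)) 0 w ω := by
  set σ : Config := fun _ => true
  set S := Finset.Ico (-(n : ℤ)) 0
  have hcard : S.card = n := by simp [S]
  have hi := cylI_int (E := E) S σ
  simp only [σ, if_true, Finset.prod_const, hcard] at hi
  rw [← hi, ← integral_mul_const]
  apply integral_mono
  · exact ((bm_of_continuous (cyl_continuous ⟨S, cylI_dep S σ⟩)).integrable _).mul_const _
  · exact mix_int _ _ _ _
  · intro ζ
    simp only
    by_cases h : ∀ x ∈ S, ζ x = σ x
    · have : mix (-(n : ℤ)) 0 ζ ω = ω := by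
        funext y
        unfold mix
        split_ifs with h2 h3
        · rw [h y (by simp [S]; omega), h1 y h2.2]
        · rw [h3, h0]
        · rfl
      rw [this]
      unfold cylI
      rw [if_pos h, one_mul]
    · have : cylI S σ ζ = 0 := by unfold cylI; rw [if_neg h]
      rw [this, zero_mul]; exact hw _

end
end EA

namespace EA
section
variable {E : EastProcess}

/-- Configurations with front at `y`. -/
def Fr (y : ℤ) : Set Config := {ω | ω y = false ∧ ∀ x, x < y → ω x = true}

lemma front_eq {ω : Config} {y : ℤ} (h : ω ∈ Fr y) : front ω = y := by
  have : IsLeast {x : ℤ | ω x = false} y := by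
    refine ⟨h.1, fun x hx => ?_⟩
    by_contra hc
    have := h.2 x (not_le.1 hc)
    simp_all
  exact this.csInf_eq

lemma mem_LO_iff {ω : Config} : ω ∈ LO ↔ ∃ y, ω ∈ Fr y := by
  constructor
  · rintro ⟨⟨y, hy⟩, ⟨x, hx⟩⟩
    obtain ⟨lb, h1, h2⟩ := Int.exists_least_of_bdd (P := fun z => ω z = false)
      ⟨y, fun z hz => by
        by_contra hc
        have := hy z (not_le.1 hc)
        simp_all⟩ ⟨x, hx⟩
    refine ⟨lb, h1, fun z hz => ?_⟩
    by_contra hc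
    have := h2 z (by simpa using hc)
    omega
  · rintro ⟨y, hy⟩
    exact ⟨⟨y, hy.2⟩, ⟨y, hy.1⟩⟩

lemma Fr_LO {ω : Config} {y : ℤ} (h : ω ∈ Fr y) : ω ∈ LO := mem_LO_iff.2 ⟨y, h⟩

lemma LO0_eq : LO₀ = Fr 0 := by
  ext ω
  constructor
  · rintro ⟨h1, h2⟩
    obtain ⟨y, hy⟩ := mem_LO_iff.1 h1
    have := front_eq hy
    have h3 : y = 0 := by omega
    exact h3 ▸ hy
  · intro h
    exact ⟨Fr_LO h, front_eq h⟩

lemma shift_Fr {ω : Config} {y k : ℤ} : shift y ω ∈ Fr k ↔ ω ∈ Fr (k + y) := by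
  constructor
  · rintro ⟨h1, h2⟩
    refine ⟨h1, fun x hx => ?_⟩
    have := h2 (x - y) (by omega)
    simpa [shift] using this
  · rintro ⟨h1, h2⟩
    exact ⟨h1, fun x hx => h2 _ (by omega)⟩

lemma theta_eq {ω : Config} {y : ℤ} (h : ω ∈ Fr y) : θL 0 ω = shift y ω := by
  funext x
  unfold θL shift
  rw [front_eq h]
  split_ifs with h1 h2
  · exact (h.2 _ (by omega)).symm
  · rw [h2, zero_add]; exact h.1.symm
  · congr 1; ring

lemma theta_Fr {ω : Config} (h : ω ∈ LO) : θL 0 ω ∈ Fr 0 := by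
  obtain ⟨y, hy⟩ := mem_LO_iff.1 h
  rw [theta_eq hy, shift_Fr]; simpa using hy

lemma shift_shift (a b : ℤ) (ω : Config) : shift a (shift b ω) = shift (a + b) ω := by
  funext x
  simp only [shift]
  congr 1; ring

lemma shift_zero (ω : Config) : shift 0 ω = ω := by
  funext x; simp [shift]

lemma theta_shift {ω : Config} (h : ω ∈ LO) (y : ℤ) : θL 0 (shift y ω) = θL 0 ω := by
  obtain ⟨z, hz⟩ := mem_LO_iff.1 h
  have : shift y ω ∈ Fr (z - y) := by rw [shift_Fr]; simpa using hz
  rw [theta_eq hz, theta_eq this, shift_shift]; congr 1; ring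

lemma measurableSet_at (x : ℤ) (b : Bool) : MeasurableSet {ω : Config | ω x = b} :=
  measurableSet_eq_fun (measurable_pi_apply x) measurable_const

lemma measurableSet_Fr (y : ℤ) : MeasurableSet (Fr y) := by
  have : Fr y = {ω : Config | ω y = false} ∩ ⋂ x : ℤ, ⋂ _ : x < y, {ω : Config | ω x = true} := by
    ext ω; simp [Fr]
  rw [this]
  exact (measurableSet_at y false).inter
    (MeasurableSet.iInter fun x => MeasurableSet.iInter fun _ => measurableSet_at x true)

lemma LO_eq : LO = ⋃ y, Fr y := by
  ext ω; rw [mem_LO_iff]; simp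

lemma measurableSet_LO : MeasurableSet LO := by
  rw [LO_eq]; exact MeasurableSet.iUnion measurableSet_Fr

lemma measurable_front : Measurable front := by
  have key2 : ∀ ω : Config, ω ∉ LO → front ω = 0 := by
    intro ω hω
    unfold front
    by_cases h : ∃ x, ω x = false
    · apply Int.csInf_of_not_bddBelow
      rintro ⟨y, hy⟩
      apply hω
      refine ⟨⟨y, fun x hx => ?_⟩, h⟩
      by_contra hc
      have := hy (show x ∈ {x : ℤ | ω x = false} by simpa using hc)
      omega
    · have : {x : ℤ | ω x = false} = ∅ := by
        ext x
        exact ⟨fun hx => (h ⟨x, hx⟩).elim, fun hx => hx.elim⟩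
      rw [this]; exact Int.csInf_empty
  apply measurable_to_countable'
  intro y
  have : front ⁻¹' {y} = Fr y ∪ (LOᶜ ∩ {_ω : Config | y = 0}) := by
    ext ω
    simp only [Set.mem_preimage, Set.mem_singleton_iff, Set.mem_union, Set.mem_inter_iff,
      Set.mem_compl_iff, Set.mem_setOf_eq]
    constructor
    · intro h
      by_cases hL : ω ∈ LO
      · left
        obtain ⟨z, hz⟩ := mem_LO_iff.1 hL
        have := front_eq hz
        have h3 : z = y := by omega
        exact h3 ▸ hz
      · right
        exact ⟨hL, by rw [← h]; exact key2 ω hL⟩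
    · rintro (h | ⟨h1, h2⟩)
      · exact front_eq h
      · rw [key2 ω h1, h2]
  rw [this]
  exact (measurableSet_Fr y).union (measurableSet_LO.compl.inter (MeasurableSet.const _))

lemma measurable_theta : Measurable (θL 0) := by
  apply measurable_pi_lambda
  intro x
  unfold θL
  by_cases h1 : x < 0
  · simp only [h1, if_true]; exact measurable_const
  · by_cases h2 : x = 0
    · simp only [h1, h2, if_true]; exact measurable_const
    · simp only [h1, h2, if_false]
      have e : (fun ω : Config => ω (front ω + 0 + x)) = (fun q : ℤ × Config => q.2 q.1) ∘ (fun ω => (front ω + 0 + x, ω)) := rfl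
      rw [e]
      apply Measurable.comp
      · exact measurable_from_prod_countable_right fun z => measurable_pi_apply z
      · exact ((measurable_front.add_const 0).add_const x).prodMk measurable_id

lemma ae_LO {ω : Config} (h : ω ∈ LO) {t : ℝ} (ht : 0 ≤ t) : ∀ᵐ η ∂(E.P t ω), η ∈ LO := by
  have := E.loStable t ht ω h
  rw [← prob_compl_eq_zero_iff measurableSet_LO] at this
  exact this

/-- `F` seen from the front. -/
def phi (F : Config → ℝ) (ω : Config) : ℝ := F (θL 0 ω)

lemma BM.phi {F : Config → ℝ} (hF : BM F) : BM (phi F) := by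
  obtain ⟨h1, C, h2⟩ := hF
  exact ⟨h1.comp measurable_theta, C, fun ω => h2 _⟩

lemma Pt_congr_ae {f g : Config → ℝ} {t : ℝ} {ω : Config} (h : ∀ᵐ η ∂(E.P t ω), f η = g η) :
    Pt E t f ω = Pt E t g ω := integral_congr_ae h

lemma Pt_phi_shift {F : Config → ℝ} (hF : BM F) {t : ℝ} (ht : 0 ≤ t) {ω : Config} (hω : ω ∈ LO)
    (y : ℤ) : Pt E t (phi F) (shift y ω) = Pt E t (phi F) ω := by
  rw [Pt_shift hF.phi ht]
  apply Pt_congr_ae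
  filter_upwards [ae_LO hω ht] with η hη
  unfold phi
  rw [theta_shift hη]

lemma Pt_phi_theta {F : Config → ℝ} (hF : BM F) {t : ℝ} (ht : 0 ≤ t) {ω : Config} (hω : ω ∈ LO) :
    Pt E t (phi F) (θL 0 ω) = Pt E t (phi F) ω := by
  obtain ⟨y, hy⟩ := mem_LO_iff.1 hω
  rw [theta_eq hy, Pt_phi_shift hF ht hω]

/-- Indicator of `Fr y`. -/
def frI (y : ℤ) (ω : Config) : ℝ := (Fr y).indicator (fun _ => (1 : ℝ)) ω

lemma frI_bm (y : ℤ) : BM (frI y) := bm_ind (measurableSet_Fr y)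
lemma frI_of {y : ℤ} {ω : Config} (h : ω ∈ Fr y) : frI y ω = 1 := Set.indicator_of_mem h _
lemma frI_not {y : ℤ} {ω : Config} (h : ω ∉ Fr y) : frI y ω = 0 := Set.indicator_of_notMem h _
lemma frI_ne {y z : ℤ} {ω : Config} (h : ω ∈ Fr z) (hn : z ≠ y) : frI y ω = 0 := by
  apply frI_not
  intro h'
  have h1 := front_eq h
  have h2 := front_eq h'
  omega
lemma frI_nonneg (y : ℤ) (ω : Config) : 0 ≤ frI y ω := by
  by_cases h : ω ∈ Fr y
  · rw [frI_of h]; norm_num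
  · rw [frI_not h]
lemma frI_le_one (y : ℤ) (ω : Config) : frI y ω ≤ 1 := by
  by_cases h : ω ∈ Fr y
  · rw [frI_of h]
  · rw [frI_not h]; norm_num
lemma frI_abs (y : ℤ) (ω : Config) : |frI y ω| ≤ 1 := by
  rw [abs_of_nonneg (frI_nonneg y ω)]; exact frI_le_one y ω

lemma zi_of {b y : ℤ} {ω : Config} (h : ω y = false) (hy : y ≤ b) : zi b ω = 1 := by
  unfold zi
  rw [if_pos ⟨y, hy, h⟩]
lemma zi_nonneg (b : ℤ) (ω : Config) : 0 ≤ zi b ω := by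
  unfold zi; split_ifs <;> norm_num
lemma zi_le_one (b : ℤ) (ω : Config) : zi b ω ≤ 1 := by
  unfold zi; split_ifs <;> norm_num
lemma zi_Fr {b y : ℤ} {ω : Config} (h : ω ∈ Fr y) (hb : b < y) : zi b ω = 0 := by
  unfold zi
  rw [if_neg]
  rintro ⟨x, h1, h2⟩
  have := h.2 x (by omega)
  simp_all
lemma frI_le_zi {y b : ℤ} (h : y ≤ b) (ω : Config) : frI y ω ≤ zi b ω := by
  by_cases hω : ω ∈ Fr y
  · rw [frI_of hω, zi_of hω.1 h]
  · rw [frI_not hω]; exact zi_nonneg _ _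

lemma zi_shift (b y : ℤ) (ω : Config) : zi b (shift y ω) = zi (b + y) ω := by
  have : (∃ x, x ≤ b ∧ shift y ω x = false) ↔ (∃ x, x ≤ b + y ∧ ω x = false) := by
    constructor
    · rintro ⟨x, h1, h2⟩; exact ⟨x + y, by omega, h2⟩
    · rintro ⟨x, h1, h2⟩; exact ⟨x - y, by omega, by simpa [shift] using h2⟩
  unfold zi
  classical
  simp only [this]

/-- Finite speed from an arbitrary front position. -/
lemma speed' {ω : Config} {y : ℤ} (hω : ω ∈ Fr y) (j : ℕ) {t : ℝ} (ht : 0 ≤ t) :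
    Pt E t (zi (y - j)) ω ≤ t ^ j / (j.factorial : ℝ) := by
  have h1 : shift y ω ∈ Fr 0 := by rw [shift_Fr]; simpa using hω
  have h2 := speed (E := E) h1.2 j ht
  rw [Pt_shift (zi_bm _) ht] at h2
  simp only [zi_shift] at h2
  rwa [show -(j : ℤ) + y = y - j by ring] at h2

/-- Entrance comparison: the front cannot jump over a site. -/
lemma lemmaH {G : Config → ℝ} (hG : BM G) (hGb : ∀ ω, |G ω| ≤ 1) {z : ℤ} {ε : ℝ} (hε : 0 ≤ ε)
    (h1 : ∀ t, 0 ≤ t → ∀ σ ∈ Fr (z - 1), |Pt E t G σ| ≤ ε)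
    (h2 : ∀ y, z ≤ y → ∀ σ ∈ Fr y, G σ = 0) {t : ℝ} (ht : 0 ≤ t) {y : ℤ} (hy : z ≤ y)
    {ω : Config} (hω : ω ∈ Fr y) : |Pt E t G ω| ≤ ε := by
  have main : ∀ h : ℝ, 0 ≤ h → ∀ k : ℕ, ∀ y, z ≤ y → ∀ ω ∈ Fr y,
      |Pt E (k * h) G ω| ≤ ε + k * (h ^ 2 / 2) := by
    intro h hh k
    induction k with
    | zero =>
      intro y hy ω hω
      simp only [Nat.cast_zero, zero_mul, add_zero]
      rw [Pt_zero G hG, h2 y hy ω hω]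
      simpa using hε
    | succ k ih =>
      intro y hy ω hω
      have e : ((k + 1 : ℕ) : ℝ) * h = h + k * h := by push_cast; ring
      rw [e, Pt_semi hG (by positivity) hh]
      refine (Pt_abs h ω).trans ?_
      have hz2 := speed' (E := E) hω 2 hh
      have b1 : Pt E h (fun η => |Pt E (k * h) G η|) ω
          ≤ Pt E h (fun η => (ε + k * (h ^ 2 / 2)) + zi (y - (2 : ℕ)) η) ω := by
        apply Pt_mono_ae ((hG.Pt _).abs) ((bm_const _).add (zi_bm _))
        filter_upwards [ae_LO (E := E) (Fr_LO hω) hh] with η hη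
        obtain ⟨w, hw⟩ := mem_LO_iff.1 hη
        have hk0 : (0:ℝ) ≤ k * (h ^ 2 / 2) := by positivity
        have hz0 := zi_nonneg (y - (2 : ℕ)) η
        rcases lt_trichotomy w (z - 1) with hc | hc | hc
        · rw [zi_of hw.1 (by push_cast; omega)]
          have := Pt_abs_le (E := E) (k * h) hGb η
          linarith
        · have := h1 (k * h) (by positivity) η (hc ▸ hw)
          exact (this.trans (le_add_of_nonneg_right hk0)).trans (le_add_of_nonneg_right hz0)
        · have := ih w (by omega) η hw
          exact this.trans (le_add_of_nonneg_right hz0)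
      rw [Pt_add (bm_const _) (zi_bm _), Pt_const] at b1
      have : ((2 : ℕ).factorial : ℝ) = 2 := by norm_num [Nat.factorial]
      rw [this] at hz2
      push_cast at b1 hz2 ⊢
      linarith
  have lim : Tendsto (fun n : ℕ => ε + t ^ 2 / 2 / n) atTop (𝓝 (ε + 0)) :=
    tendsto_const_nhds.add (tendsto_const_div_atTop_nhds_zero_nat _)
  rw [add_zero] at lim
  refine ge_of_tendsto lim ?_
  filter_upwards [eventually_gt_atTop 0] with n hn
  have hn' : (0 : ℝ) < n := by exact_mod_cast hn
  have := main (t / n) (by positivity) n y hy ω hω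
  rw [show (n : ℝ) * (t / n) = t by field_simp] at this
  calc _ ≤ _ := this
    _ = _ := by field_simp

end
end EA

namespace EA
section
variable {E : EastProcess}

lemma zf_mix (j k : ℕ) {k' : ℤ} (hk : 0 ≤ k') (ζ ω : Config) :
    1 - zf (-((j + k : ℕ) : ℤ)) (-((j : ℤ) + 1)) (mix (-((j + k : ℕ) : ℤ)) k' ζ ω)
      = cylI (Finset.Icc (-((j + k : ℕ) : ℤ)) (-((j : ℤ) + 1))) (fun _ => true) ζ := by
  have hm : ∀ x, -((j + k : ℕ) : ℤ) ≤ x → x ≤ -((j : ℤ) + 1) →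
      mix (-((j + k : ℕ) : ℤ)) k' ζ ω x = ζ x := by
    intro x h1 h2
    unfold mix
    rw [if_pos ⟨h1, by omega⟩]
  unfold zf cylI
  by_cases h : ∃ x, -((j + k : ℕ) : ℤ) ≤ x ∧ x ≤ -((j : ℤ) + 1) ∧
      mix (-((j + k : ℕ) : ℤ)) k' ζ ω x = false
  · rw [if_pos h, if_neg, sub_self]
    intro hc
    obtain ⟨x, h1, h2, h3⟩ := h
    have := hc x (Finset.mem_Icc.2 ⟨h1, h2⟩)
    rw [hm x h1 h2] at h3
    simp_all
  · rw [if_neg h, if_pos, sub_zero]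
    intro x hx
    obtain ⟨h1, h2⟩ := Finset.mem_Icc.1 hx
    by_contra hc
    exact h ⟨x, h1, h2, by rw [hm x h1 h2]; simpa using hc⟩

lemma R1 (hgap : 0 < gap E) (j k : ℕ) {ω : Config} (hω : ω ∈ Fr 0) {T A : ℝ} (hT : 0 ≤ T)
    (hA : 0 ≤ A) (h : Real.exp (-(gap E * T)) ^ 2 ≤ E.p ^ (j + k) * A ^ 2) :
    Pt E T (fun η => 1 - zi (-((j : ℤ) + 1)) η) ω ≤ E.p ^ k + A := by
  set l : ℤ := -((j + k : ℕ) : ℤ) with hl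
  set r : ℤ := -((j : ℤ) + 1) with hr
  set f : Config → ℝ := fun η => (1 - zf l r η) - E.p ^ k with hf
  have hpk0 : 0 ≤ E.p ^ k := pow_nonneg (p0' E) k
  have hpk1 : E.p ^ k ≤ 1 := pow_le_one₀ (p0' E) (p1' E)
  have hfd : Dep l r f := fun ω ω' H => by
    simp only [hf, zf_dep l r ω ω' H]
  have hfb : ∀ ω, |f ω| ≤ 1 := fun ω => by
    have h0 := zf_nonneg l r ω
    have h1 := zf_le_one l r ω
    rw [abs_le]; constructor <;> simp only [hf] <;> linarith
  have hB : ∀ k' ω, 0 ≤ k' → B E l k' f ω = 0 := by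
    intro k' ω hk'
    have : B E l k' f ω = ∫ ζ, (cylI (Finset.Icc l r) (fun _ => true) ζ - E.p ^ k) ∂E.μ := by
      unfold B
      congr 1; funext ζ
      rw [← zf_mix j k hk' ζ ω]
    rw [this, integral_sub ?_ (integrable_const _), cylI_int]
    · simp only [if_true, Finset.prod_const, Int.card_Icc, integral_const]
      have : (r + 1 - l).toNat = k := by omega
      rw [this]; simp
    · apply Dep.muInt (a := l) (b := r)
      have := cylI_dep (Finset.Icc l r) (fun _ => true)
      rwa [Finset.coe_Icc] at this
  have h1 := B_relax hgap (by omega : l ≤ 0) hfb hfd hB hT le_rfl ω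
  have h2 := B_point (E := E) (n := j + k) (w := fun ω => Pt E T f ω ^ 2) (fun ω => sq_nonneg _)
    hω.1 hω.2
  have h3 : Pt E T f ω ^ 2 ≤ A ^ 2 := by
    have hp : 0 < E.p ^ (j + k) := pow_pos E.hp0 _
    have : E.p ^ (j + k) * Pt E T f ω ^ 2 ≤ E.p ^ (j + k) * A ^ 2 := h2.trans (h1.trans h)
    exact le_of_mul_le_mul_left this hp
  have h4 : Pt E T f ω ≤ A := (abs_le.1 (abs_le_of_sq_le_sq h3 hA)).2
  have h5 : Pt E T (fun η => 1 - zi r η) ω ≤ Pt E T (fun η => f η + E.p ^ k) ω := by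
    apply Pt_mono ((bm_const 1).sub (zi_bm r)) (hfd.bm.add (bm_const _))
    intro η
    simp only [hf]
    have : zf l r η ≤ zi r η := by
      unfold zf zi
      by_cases hx : ∃ x, l ≤ x ∧ x ≤ r ∧ η x = false
      · rw [if_pos hx, if_pos]
        obtain ⟨x, _, h2, h3⟩ := hx
        exact ⟨x, h2, h3⟩
      · rw [if_neg hx]; exact zi_nonneg _ _
    linarith
  rw [Pt_add hfd.bm (bm_const _), Pt_const] at h5
  linarith

lemma R2 (hgap : 0 < gap E) {b : ℤ} {f : Config → ℝ} (hfd : Dep (-1) b f) (hfb : ∀ ω, |f ω| ≤ 1)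
    (hE : ∀ ω, Ex E.p (-1) f ω = 0) {s u : ℝ} (hs : 0 ≤ s) (hu : 0 ≤ u) {ω : Config}
    (hω : ω ∈ Fr 0) :
    Pt E s (fun η => |Pt E u f η|) ω ≤ E.p⁻¹ * Real.exp (-(gap E * u)) := by
  have hB : ∀ k' ω, 0 ≤ k' → B E (-1) k' f ω = 0 := by
    intro k' ω hk'
    unfold B
    rw [← mu_Ex (mix_dep (-1) k' f ω) (-1)]
    have : ∀ ζ, Ex E.p (-1) (fun ζ => f (mix (-1) k' ζ ω)) ζ = 0 := fun ζ => by
      rw [← Ex_mix le_rfl (by omega) f ζ ω, hE]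
    simp [this]
  have key : ∀ ε > 0, E.p * Pt E s (fun η => |Pt E u f η|) ω ≤ Real.exp (-(gap E * u)) + 2 * ε := by
    intro ε hε
    obtain ⟨N, ⟨hN, hbN⟩, hN0⟩ := (((approx E (-1) b hu hε).and
      (eventually_ge_atTop b)).and (eventually_ge_atTop (0:ℤ))).exists
    obtain ⟨m, hm, hm2⟩ := (hN.and (step_small u (Finset.Ico (-1) N))).exists
    have hm := hm f hfd hfb
    set v := (Q E.p (u / m) (Finset.Ico (-1) N))^[m] f with hv
    have hvd : Dep (-1) N v := (hfd.mono le_rfl hbN).Qiter m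
    have hvb : ∀ ω, |v ω| ≤ 1 := Qi_abs_le (p0' E) (p1' E) (by positivity) hm2 m hfb
    have hwd : Dep (-1) N (fun ω => |v ω|) := fun ω ω' H => by simp only [hvd ω ω' H]
    have b1 : ∀ k ω, 0 ≤ k → B E (-1) k (fun ω => |v ω|) ω ≤ Real.exp (-(gap E * u)) + ε := by
      intro k ω hk
      have h1 := B_relax_abs hgap (by norm_num : (-1:ℤ) ≤ 0) hfb hfd hB hu hk ω
      have h2 : B E (-1) k (fun ω => |v ω|) ω ≤ B E (-1) k (fun ω => |Pt E u f ω| + ε) ω := by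
        apply B_mono
        intro ω
        have h3 := hm ω
        have := abs_sub_abs_le_abs_sub (v ω) (Pt E u f ω)
        rw [abs_sub_comm] at this
        linarith
      rw [B_add, B_const] at h2
      linarith
    have b2 := B_Pt_le (E := E) (by norm_num : (-1:ℤ) ≤ 0) (fun ω => by rw [abs_abs]; exact hvb ω) hwd b1 hs
      le_rfl ω
    have b3 := B_point (E := E) (n := 1) (w := Pt E s (fun ω => |v ω|))
      (fun ω => integral_nonneg fun η => abs_nonneg _) hω.1 hω.2
    have b4 : Pt E s (fun η => |Pt E u f η|) ω ≤ Pt E s (fun η => |v η| + ε) ω := by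
      apply Pt_mono (hfd.bm.Pt u).abs (hvd.bm.abs.add (bm_const _))
      intro η
      have h3 := hm η
      have := abs_sub_abs_le_abs_sub (Pt E u f η) (v η)
      linarith
    rw [Pt_add hvd.bm.abs (bm_const _), Pt_const] at b4
    have e1 : (-((1:ℕ):ℤ)) = -1 := by norm_num
    rw [e1, pow_one] at b3
    have := mul_le_mul_of_nonneg_left b4 (p0' E)
    have := p1' E
    nlinarith
  have : E.p * Pt E s (fun η => |Pt E u f η|) ω ≤ Real.exp (-(gap E * u)) := by
    apply le_of_forall_pos_le_add
    intro ε hε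
    have := key (ε / 2) (by positivity)
    linarith
  rw [inv_mul_eq_div, le_div_iff₀ E.hp0, mul_comm]
  exact this

lemma frI_tendsto (y : ℤ) (ω : Config) :
    Tendsto (fun n : ℕ => cylI (Finset.Icc (-(n : ℤ)) y) (fun x => decide (x ≠ y)) ω) atTop
      (𝓝 (frI y ω)) := by
  apply tendsto_const_nhds.congr'
  by_cases h : ω ∈ Fr y
  · rw [frI_of h]
    filter_upwards with n
    unfold cylI
    rw [if_pos]
    intro x hx
    rcases (Finset.mem_Icc.1 hx).2.lt_or_eq with h1 | h1
    · rw [h.2 x h1]; simp [h1.ne]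
    · rw [h1, h.1]; simp
  · rw [frI_not h]
    have : ∃ x, x ≤ y ∧ ω x ≠ decide (x ≠ y) := by
      by_contra hc
      push Not at hc
      apply h
      refine ⟨by simpa using hc y le_rfl, fun x hx => ?_⟩
      rw [hc x hx.le]; simp [hx.ne]
    obtain ⟨x, h1, h2⟩ := this
    filter_upwards [eventually_ge_atTop (-x).toNat] with n hn
    unfold cylI
    rw [if_neg]
    intro hc
    exact h2 (hc x (Finset.mem_Icc.2 ⟨by omega, h1⟩))

lemma cylI_abs (S : Finset ℤ) (σ ω : Config) : |cylI S σ ω| ≤ 1 := by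
  unfold cylI; split_ifs <;> simp

lemma decor_fr {b : ℤ} (L : ℕ) {f : Config → ℝ} (hfd : Dep (-1) b f) (hfb : ∀ ω, |f ω| ≤ 1)
    {u : ℝ} (hu : 0 ≤ u) (η : Config) :
    |Pt E u (fun ω => frI (-(L : ℤ) - 2) ω * f ω) η|
      ≤ |Pt E u f η| + 8 * u * Real.exp (Real.exp 1 * u - (L + 1)) := by
  set g : ℕ → Config → ℝ := fun n =>
    cylI (Finset.Icc (-(n : ℤ)) (-(L : ℤ) - 2)) (fun x => decide (x ≠ -(L : ℤ) - 2)) with hg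
  have hgd : ∀ n : ℕ, Dep (-(n : ℤ)) (-(L : ℤ) - 2) (g n) := by
    intro n
    have := cylI_dep (Finset.Icc (-(n : ℤ)) (-(L : ℤ) - 2)) (fun x => decide (x ≠ -(L : ℤ) - 2))
    rwa [Finset.coe_Icc] at this
  have hgb : ∀ n ω, |g n ω| ≤ 1 := fun n ω => cylI_abs _ _ _
  have lim : Tendsto (fun n => Pt E u (fun ω => g n ω * f ω) η) atTop
      (𝓝 (Pt E u (fun ω => frI (-(L : ℤ) - 2) ω * f ω) η)) := by
    apply Pt_tendsto (C := 1)
    · intro n; exact ((hgd n).bm.mul hfd.bm).1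
    · intro n ω
      rw [abs_mul]
      exact mul_le_one₀ (hgb n ω) (abs_nonneg _) (hfb ω)
    · intro ω
      exact (frI_tendsto _ ω).mul_const _
  apply le_of_tendsto lim.abs
  filter_upwards [eventually_ge_atTop 1] with n hn
  have h1 := decor (E := E) (hgd n) (hfd.mono le_rfl (le_max_left b 0)) (by omega)
    (by have := le_max_right b 0; omega) (hgb n) hfb hu η
  have h2 : |Pt E u (g n) η * Pt E u f η| ≤ |Pt E u f η| := by
    rw [abs_mul]
    exact mul_le_of_le_one_left (abs_nonneg _) (Pt_abs_le u (hgb n) η)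
  have h3 := abs_sub_abs_le_abs_sub (Pt E u (fun ω => g n ω * f ω) η) (Pt E u (g n) η * Pt E u f η)
  have e : Real.exp 1 * u + ((-(L : ℤ) - 2 : ℤ) : ℝ) - ((-1 : ℤ) : ℝ) = Real.exp 1 * u - (L + 1) := by
    push_cast; ring
  rw [e] at h1
  linarith

lemma inner (hgap : 0 < gap E) {b : ℤ} (L : ℕ) {f : Config → ℝ} (hfd : Dep (-1) b f)
    (hfb : ∀ ω, |f ω| ≤ 1) (hE : ∀ ω, Ex E.p (-1) f ω = 0) {t u : ℝ} (ht : 0 ≤ t) (hu : 0 ≤ u)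
    {ω : Config} (hω : ω ∈ Fr 0) :
    |Pt E t (fun ω => frI (-(L : ℤ) - 2) ω * f ω) ω|
      ≤ 8 * u * Real.exp (Real.exp 1 * u - (L + 1)) + E.p⁻¹ * Real.exp (-(gap E * u))
        + u ^ (L + 2) / ((L + 2).factorial : ℝ) := by
  have hbm : BM (fun ω => frI (-(L : ℤ) - 2) ω * f ω) := (frI_bm _).mul hfd.bm
  have hp := E.hp0
  rcases le_total u t with h | h
  · have e : t = (t - u) + u := by ring
    rw [e, Pt_semi hbm hu (by linarith)]
    refine (Pt_abs _ _).trans ?_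
    have h1 : Pt E (t - u) (fun η => |Pt E u (fun ω => frI (-(L : ℤ) - 2) ω * f ω) η|) ω
        ≤ Pt E (t - u) (fun η => |Pt E u f η| + 8 * u * Real.exp (Real.exp 1 * u - (L + 1))) ω :=
      Pt_mono (hbm.Pt u).abs ((hfd.bm.Pt u).abs.add (bm_const _)) _ (decor_fr L hfd hfb hu) ω
    rw [Pt_add (hfd.bm.Pt u).abs (bm_const _), Pt_const] at h1
    have h2 := R2 hgap hfd hfb hE (sub_nonneg.2 h) hu hω
    have h3 : 0 ≤ u ^ (L + 2) / ((L + 2).factorial : ℝ) := by positivity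
    linarith
  · refine (Pt_abs _ _).trans ?_
    have h1 : Pt E t (fun η => |frI (-(L : ℤ) - 2) η * f η|) ω ≤ Pt E t (zi (0 - (L + 2 : ℕ))) ω := by
      apply Pt_mono hbm.abs (zi_bm _)
      intro η
      rw [abs_mul, abs_of_nonneg (frI_nonneg _ _)]
      refine (mul_le_of_le_one_right (frI_nonneg _ _) (hfb η)).trans (frI_le_zi ?_ η)
      push_cast; omega
    have h2 := speed' (E := E) hω (L + 2) ht
    have h3 : t ^ (L + 2) / ((L + 2).factorial : ℝ) ≤ u ^ (L + 2) / ((L + 2).factorial : ℝ) := by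
      gcongr
    have h4 : 0 ≤ 8 * u * Real.exp (Real.exp 1 * u - (L + 1)) + E.p⁻¹ * Real.exp (-(gap E * u)) := by
      positivity
    have := (h1.trans h2).trans h3
    linarith

/-- Rate used for the inner bound. -/
def rr (E : EastProcess) : ℝ := max (max (Real.exp (-(1/2))) (Real.exp (-(gap E / 8)))) E.p

lemma rr_lt (hgap : 0 < gap E) : rr E < 1 := by
  unfold rr
  refine max_lt (max_lt ?_ ?_) E.hp1 <;> rw [Real.exp_lt_one_iff] <;> linarith
lemma rr_pos : 0 < rr E := lt_of_lt_of_le E.hp0 (le_max_right _ _)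

lemma inner' (hgap : 0 < gap E) {b : ℤ} (L : ℕ) {f : Config → ℝ} (hfd : Dep (-1) b f)
    (hfb : ∀ ω, |f ω| ≤ 1) (hE : ∀ ω, Ex E.p (-1) f ω = 0) {t : ℝ} (ht : 0 ≤ t)
    {ω : Config} (hω : ω ∈ Fr 0) :
    |Pt E t (fun ω => frI (-(L : ℤ) - 2) ω * f ω) ω| ≤ (L + E.p⁻¹ + 1) * rr E ^ L := by
  have h := inner hgap L hfd hfb hE ht (u := L / 8) (by positivity) hω
  refine h.trans ?_
  have he := Real.exp_one_lt_d9
  have t0 : Real.exp (-(1/2)) ^ L ≤ rr E ^ L := by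
    gcongr; exact (le_max_left _ _).trans (le_max_left _ _)
  have t1 : 8 * ((L : ℝ) / 8) * Real.exp (Real.exp 1 * (L / 8) - (L + 1)) ≤ L * rr E ^ L := by
    have : Real.exp (Real.exp 1 * (L / 8) - (L + 1)) ≤ Real.exp (-(1/2)) ^ L := by
      rw [← Real.exp_nat_mul]
      apply Real.exp_le_exp.2
      have : (0 : ℝ) ≤ L := by positivity
      nlinarith
    have e : 8 * ((L : ℝ) / 8) = L := by ring
    rw [e]
    exact mul_le_mul_of_nonneg_left (this.trans t0) (by positivity)
  have t2 : E.p⁻¹ * Real.exp (-(gap E * (L / 8))) ≤ E.p⁻¹ * rr E ^ L := by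
    have : Real.exp (-(gap E * (L / 8))) = Real.exp (-(gap E / 8)) ^ L := by
      rw [← Real.exp_nat_mul]; congr 1; ring
    rw [this]
    have := E.hp0
    gcongr
    exact (le_max_right _ _).trans (le_max_left _ _)
  have t3 : ((L : ℝ) / 8) ^ (L + 2) / ((L + 2).factorial : ℝ) ≤ 1 * rr E ^ L := by
    have h1 := Real.pow_div_factorial_le_exp (L : ℝ) (by positivity) (L + 2)
    have h2 : ((L : ℝ) / 8) ^ (L + 2) / ((L + 2).factorial : ℝ)
        = (L : ℝ) ^ (L + 2) / ((L + 2).factorial : ℝ) / 8 ^ (L + 2) := by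
      rw [div_pow]; field_simp
    rw [h2, one_mul]
    refine le_trans ?_ t0
    rw [div_le_iff₀ (by positivity)]
    refine h1.trans ?_
    have h3 : Real.exp (L : ℝ) = Real.exp 1 ^ L := by rw [← Real.exp_nat_mul, mul_one]
    rw [h3, pow_add, ← mul_assoc, ← mul_pow]
    have h4 : Real.exp 1 ≤ Real.exp (-(1/2)) * 8 := by
      have h5 : Real.exp (-(1/2)) ≥ Real.exp (-1) := Real.exp_le_exp.2 (by norm_num)
      have h6 : Real.exp (-1) * Real.exp 1 = 1 := by rw [← Real.exp_add]; simp
      have h7 := Real.exp_pos 1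
      have h8 := Real.exp_pos (-1)
      nlinarith
    have h5 : Real.exp 1 ^ L ≤ (Real.exp (-(1/2)) * 8) ^ L := by gcongr
    have h6 : (0:ℝ) ≤ (Real.exp (-(1/2)) * 8) ^ L := by positivity
    nlinarith
  linarith

end
end EA

namespace EA
section
variable {E : EastProcess}

lemma frI_shift (k y : ℤ) (ω : Config) : frI k (shift y ω) = frI (k + y) ω := by
  by_cases h : ω ∈ Fr (k + y)
  · rw [frI_of h, frI_of (shift_Fr.2 h)]
  · rw [frI_not h, frI_not (fun h' => h (shift_Fr.1 h'))]

lemma shift_update (s a : ℤ) (ω : Config) (c : Bool) :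
    shift s (Function.update ω a c) = Function.update (shift s ω) (a - s) c := by
  funext x
  simp only [shift, Function.update_apply]
  have : x + s = a ↔ x = a - s := by omega
  simp only [this]

lemma Dep.shift {a b : ℤ} {F : Config → ℝ} (hF : Dep a b F) (s : ℤ) :
    Dep (a + s) (b + s) (fun η => F (shift s η)) := by
  intro ω ω' H
  apply hF
  intro x hx
  exact H (x + s) ⟨by have := hx.1; omega, by have := hx.2; omega⟩

lemma stepG (hgap : 0 < gap E) {b : ℤ} (L : ℕ) {F : Config → ℝ} (hF : Dep (L + 1) b F)
    (hFb : ∀ ω, |F ω| ≤ 1) (hE : ∀ ω, Ex E.p (L + 1) F ω = 0) {y : ℤ} (hy : y ≤ -(L : ℤ) - 3)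
    {t : ℝ} (ht : 0 ≤ t) {ω : Config} (hω : ω ∈ Fr 0) :
    |Pt E t (fun η => frI y η * F (shift y η)) ω| ≤ (L + E.p⁻¹ + 1) * rr E ^ L := by
  set f : Config → ℝ := fun η => F (shift (-(L : ℤ) - 2) η) with hf
  have hfd : Dep (-1) (b + (-(L : ℤ) - 2)) f := by
    have := hF.shift (-(L : ℤ) - 2)
    rwa [show (L : ℤ) + 1 + (-(L : ℤ) - 2) = -1 by ring] at this
  have hfb : ∀ ω, |f ω| ≤ 1 := fun ω => hFb _
  have hfE : ∀ ω, Ex E.p (-1) f ω = 0 := by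
    intro ω
    have := hE (shift (-(L : ℤ) - 2) ω)
    rw [← this]
    unfold Ex
    simp only [hf, shift_update]
    rw [show (-1 : ℤ) - (-(L : ℤ) - 2) = L + 1 by ring]
  have hbm' : BM (fun η => F (shift y η)) := (hF.shift y).bm
  have hbm : BM (fun η => frI y η * F (shift y η)) := (frI_bm _).mul hbm'
  have hp := E.hp0
  have hr := rr_pos (E := E)
  apply lemmaH (z := y + L + 3) hbm ?_ (by positivity) ?_ ?_ ht (y := 0) (by omega) hω
  · intro ω
    rw [abs_mul]
    exact mul_le_one₀ (frI_abs _ _) (abs_nonneg _) (hFb _)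
  · intro t ht σ hσ
    have h1 : shift (y + L + 3 - 1) σ ∈ Fr 0 := by rw [shift_Fr]; simpa using hσ
    have h2 := inner' hgap L hfd hfb hfE ht h1
    rw [Pt_shift ((frI_bm _).mul hfd.bm) ht] at h2
    simp only [hf, frI_shift, shift_shift] at h2
    rwa [show -(L : ℤ) - 2 + (y + L + 3 - 1) = y by ring] at h2
  · intro w hw σ hσ
    rw [frI_ne hσ (by omega), zero_mul]

lemma exists_C (hgap : 0 < gap E) : ∃ C : ℕ, 1 ≤ C ∧ Real.exp (-(gap E * C)) ≤ E.p ^ 2 := by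
  have : Tendsto (fun C : ℕ => Real.exp (-(gap E * C))) atTop (𝓝 0) := by
    apply Real.tendsto_exp_neg_atTop_nhds_zero.comp
    exact tendsto_natCast_atTop_atTop.const_mul_atTop hgap
  have hp : 0 < E.p ^ 2 := pow_pos E.hp0 2
  obtain ⟨C, h1, h2⟩ := ((this.eventually_lt_const hp).and (eventually_ge_atTop 1)).exists
  exact ⟨C, h2, h1.le⟩

lemma A1_core (hgap : 0 < gap E) {C : ℕ} (hC1 : 1 ≤ C) (hC : Real.exp (-(gap E * C)) ≤ E.p ^ 2)
    {b : ℤ} (L : ℕ) {F : Config → ℝ} (hF : Dep (L + 1) b F)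
    (hFb : ∀ ω, |F ω| ≤ 1) (hE : ∀ ω, Ex E.p (L + 1) F ω = 0) {ω : Config} (hω : ω ∈ Fr 0) :
    |Pt E ((C * (L + 3) : ℕ) : ℝ) (phi F) ω|
      ≤ (4 * C * (L + 3)) * ((L + E.p⁻¹ + 1) * rr E ^ L) + 3 * rr E ^ L := by
  set T : ℝ := ((C * (L + 3) : ℕ) : ℝ) with hT
  have hT0 : 0 ≤ T := by positivity
  set j : ℕ := 4 * (C * (L + 3)) with hj
  set I : Finset ℤ := Finset.Icc (-(j : ℤ) + 1) (-(L : ℤ) - 3) with hI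
  have hjT : (j : ℝ) = 4 * T := by rw [hj, hT]; push_cast; ring
  have hG : ∀ y, BM (fun η => frI y η * F (shift y η)) := fun y => (frI_bm _).mul (hF.shift y).bm
  have hp := E.hp0
  have hr := rr_pos (E := E)
  -- decomposition
  have h1 : |Pt E T (phi F) ω| ≤ |Pt E T (fun η => ∑ y ∈ I, frI y η * F (shift y η)) ω|
      + (Pt E T (zi (-(j : ℤ))) ω + Pt E T (fun η => 1 - zi (-(((L + 2 : ℕ) : ℤ) + 1)) η) ω) := by
    have hb1 : BM (phi F) := hF.bm.phi
    have hb2 : BM (fun η => ∑ y ∈ I, frI y η * F (shift y η)) := BM.sum I fun y _ => hG y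
    rw [← Pt_add (zi_bm _) ((bm_const 1).sub (zi_bm _))]
    have h2 : |Pt E T (phi F) ω - Pt E T (fun η => ∑ y ∈ I, frI y η * F (shift y η)) ω|
        ≤ Pt E T (fun η => zi (-(j : ℤ)) η + (1 - zi (-(((L + 2 : ℕ) : ℤ) + 1)) η)) ω := by
      rw [← Pt_sub hb1 hb2]
      refine (Pt_abs _ _).trans ?_
      apply Pt_mono_ae (hb1.sub hb2).abs ((zi_bm _).add ((bm_const 1).sub (zi_bm _)))
      filter_upwards [ae_LO (Fr_LO hω) hT0] with η hη
      obtain ⟨w, hw⟩ := mem_LO_iff.1 hη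
      have hz1 := zi_nonneg (-(j : ℤ)) η
      have hz2 : 0 ≤ 1 - zi (-(((L + 2 : ℕ) : ℤ) + 1)) η := sub_nonneg.2 (zi_le_one _ _)
      have hphi : phi F η = F (shift w η) := by unfold phi; rw [theta_eq hw]
      by_cases hwI : w ∈ I
      · rw [Finset.sum_eq_single w (fun y _ hy => by rw [frI_ne hw (Ne.symm hy), zero_mul])
          (fun h => absurd hwI h), frI_of hw, one_mul, hphi, sub_self, abs_zero]
        exact add_nonneg hz1 hz2
      · rw [Finset.sum_eq_zero (fun y hy => by
          rw [frI_ne hw (fun h => hwI (h ▸ hy)), zero_mul]), sub_zero, hphi]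
        refine (hFb _).trans ?_
        rw [hI, Finset.mem_Icc, not_and_or] at hwI
        rcases hwI with h | h
        · rw [zi_of hw.1 (by omega)]; exact le_add_of_nonneg_right hz2
        · rw [zi_Fr (b := -(((L + 2 : ℕ) : ℤ) + 1)) hw (by push_cast; omega), sub_zero]; exact le_add_of_nonneg_left hz1
    have := abs_sub_abs_le_abs_sub (Pt E T (phi F) ω)
      (Pt E T (fun η => ∑ y ∈ I, frI y η * F (shift y η)) ω)
    linarith
  have h2 : |Pt E T (fun η => ∑ y ∈ I, frI y η * F (shift y η)) ω|
      ≤ (4 * C * (L + 3)) * ((L + E.p⁻¹ + 1) * rr E ^ L) := by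
    rw [Pt_sum I fun y _ => hG y]
    refine (Finset.abs_sum_le_sum_abs _ _).trans ?_
    have : ∑ y ∈ I, |Pt E T (fun η => frI y η * F (shift y η)) ω|
        ≤ ∑ y ∈ I, (L + E.p⁻¹ + 1) * rr E ^ L := by
      apply Finset.sum_le_sum
      intro y hy
      exact stepG hgap L hF hFb hE (Finset.mem_Icc.1 hy).2 hT0 hω
    refine this.trans ?_
    rw [Finset.sum_const, nsmul_eq_mul]
    apply mul_le_mul_of_nonneg_right _ (by positivity)
    have : I.card ≤ j := by rw [hI, Int.card_Icc]; omega
    calc (I.card : ℝ) ≤ j := by exact_mod_cast this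
      _ = _ := by rw [hj]; push_cast; ring
  have hLT : (L : ℝ) ≤ T := by
    rw [hT]; exact_mod_cast (by nlinarith : L ≤ C * (L + 3))
  have h3 : Pt E T (zi (-(j : ℤ))) ω ≤ rr E ^ L := by
    refine (speed hω.2 j hT0).trans ?_
    have e1 := Real.pow_div_factorial_le_exp (Real.exp 1 * T) (by positivity) j
    rw [mul_pow, ← Real.exp_nat_mul, mul_one] at e1
    have e2 : T ^ j / (j.factorial : ℝ)
        = Real.exp (-(j : ℝ)) * (Real.exp j * T ^ j / (j.factorial : ℝ)) := by
      rw [Real.exp_neg]; field_simp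
    rw [e2]
    have e3 : Real.exp (-(j : ℝ)) * (Real.exp j * T ^ j / (j.factorial : ℝ))
        ≤ Real.exp (-(j : ℝ)) * Real.exp (Real.exp 1 * T) := by gcongr
    refine e3.trans ?_
    rw [← Real.exp_add]
    have e4 : Real.exp (-(1/2)) ^ L ≤ rr E ^ L := by
      gcongr; exact (le_max_left _ _).trans (le_max_left _ _)
    refine le_trans ?_ e4
    rw [← Real.exp_nat_mul]
    apply Real.exp_le_exp.2
    have := Real.exp_one_lt_d9
    rw [hjT]
    nlinarith
  have hpr : E.p ^ (L + 1) ≤ rr E ^ L := by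
    calc E.p ^ (L + 1) ≤ E.p ^ L := pow_le_pow_of_le_one hp.le (p1' E) (by omega)
      _ ≤ rr E ^ L := by gcongr; exact le_max_right _ _
  have h4 : Pt E T (fun η => 1 - zi (-(((L + 2 : ℕ) : ℤ) + 1)) η) ω ≤ 2 * rr E ^ L := by
    have := R1 hgap (L + 2) (L + 1) hω hT0 (A := E.p ^ (L + 1)) (by positivity) ?_
    · linarith
    · have e1 : Real.exp (-(gap E * T)) = Real.exp (-(gap E * C)) ^ (L + 3) := by
        rw [← Real.exp_nat_mul]; congr 1; rw [hT]; push_cast; ring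
      rw [e1]
      calc (Real.exp (-(gap E * C)) ^ (L + 3)) ^ 2 ≤ ((E.p ^ 2) ^ (L + 3)) ^ 2 := by gcongr
        _ = E.p ^ (4 * L + 12) := by ring
        _ ≤ E.p ^ (4 * L + 5) := pow_le_pow_of_le_one hp.le (p1' E) (by omega)
        _ = _ := by ring
  linarith

lemma A1 (hgap : 0 < gap E) : ∃ e : ℕ → ℝ, Summable e ∧ (∀ L, 0 ≤ e L) ∧ ∀ L : ℕ, ∃ T0 : ℝ, 0 ≤ T0 ∧
    ∀ (b : ℤ) (F : Config → ℝ), Dep (L + 1) b F → (∀ ω, |F ω| ≤ 1) →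
      (∀ ω, Ex E.p (L + 1) F ω = 0) → ∀ t, T0 ≤ t → ∀ ω ∈ Fr 0, |Pt E t (phi F) ω| ≤ e L := by
  obtain ⟨C, hC1, hC⟩ := exists_C hgap
  have hp := E.hp0
  have hr := rr_pos (E := E)
  refine ⟨fun L => (4 * C * (L + 3)) * ((L + E.p⁻¹ + 1) * rr E ^ L) + 3 * rr E ^ L, ?_,
    fun L => by positivity, fun L => ⟨((C * (L + 3) : ℕ) : ℝ), by positivity, ?_⟩⟩
  · have hn : ‖rr E‖ < 1 := by
      rw [Real.norm_eq_abs, abs_of_pos hr]; exact rr_lt hgap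
    have s0 := summable_pow_mul_geometric_of_norm_lt_one 0 hn
    have s1 := summable_pow_mul_geometric_of_norm_lt_one 1 hn
    have s2 := summable_pow_mul_geometric_of_norm_lt_one 2 hn
    have := ((s2.mul_left (4 * (C : ℝ))).add (s1.mul_left (4 * (C : ℝ) * (E.p⁻¹ + 4)))).add
      (s0.mul_left (12 * (C : ℝ) * (E.p⁻¹ + 1) + 3))
    refine this.congr fun L => ?_
    ring
  · intro b F hF hFb hE t ht ω hω
    set T : ℝ := ((C * (L + 3) : ℕ) : ℝ) with hT
    have hT0 : 0 ≤ T := by positivity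
    have e : t = (t - T) + T := by ring
    rw [e, Pt_semi hF.bm.phi hT0 (by linarith)]
    apply Pt_abs_le_ae
    filter_upwards [ae_LO (Fr_LO hω) (sub_nonneg.2 ht)] with η hη
    rw [← Pt_phi_theta hF.bm hT0 hη]
    exact A1_core hgap hC1 hC L hF hFb hE (theta_Fr hη)

lemma Ex_abs_le {p : ℝ} (h0 : 0 ≤ p) (h1 : p ≤ 1) (x : ℤ) {f : Config → ℝ} {C : ℝ}
    (hf : ∀ ω, |f ω| ≤ C) (ω : Config) : |Ex p x f ω| ≤ C := by
  unfold Ex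
  have a := abs_le.1 (hf (Function.update ω x true))
  have b := abs_le.1 (hf (Function.update ω x false))
  rw [abs_le]; constructor <;> nlinarith

lemma tele {e : ℕ → ℝ} (he : ∀ L : ℕ, ∃ T0 : ℝ, 0 ≤ T0 ∧
    ∀ (b : ℤ) (F : Config → ℝ), Dep (L + 1) b F → (∀ ω, |F ω| ≤ 1) →
      (∀ ω, Ex E.p (L + 1) F ω = 0) → ∀ t, T0 ≤ t → ∀ ω ∈ Fr 0, |Pt E t (phi F) ω| ≤ e L) (n : ℕ) :
    ∀ L : ℕ, ∃ T0 : ℝ, 0 ≤ T0 ∧ ∀ F, Dep (L + 1) (L + n) F → (∀ ω, |F ω| ≤ 1) → ∀ t, T0 ≤ t →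
      ∀ ω ∈ Fr 0, |Pt E t (phi F) ω - ∫ ζ, F ζ ∂E.μ| ≤ 2 * ∑ i ∈ Finset.range n, e (L + i) := by
  induction n with
  | zero =>
    intro L
    refine ⟨0, le_rfl, fun F hF _ t _ ω _ => ?_⟩
    have hc : ∀ η, F η = F ω := by
      intro η
      apply hF
      intro x hx
      have h1 := hx.1
      have h2 := hx.2
      push_cast at h2
      omega
    have : F = fun _ => F ω := funext hc
    have h2 : phi F = fun _ => F ω := funext fun η => hc _
    rw [h2, Pt_const]
    simp only [hc]
    simp
  | succ n ih =>
    intro L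
    obtain ⟨T1, hT1, h1⟩ := he L
    obtain ⟨T2, hT2, h2⟩ := ih (L + 1)
    refine ⟨max T1 T2, le_max_of_le_left hT1, fun F hF hFb t ht ω hω => ?_⟩
    set F' := Ex E.p (L + 1) F with hF'
    have hd : Dep ((L + 1 : ℕ) + 1) ((L + 1 : ℕ) + n) F' := by
      apply DependsOnF.mono' (dep_Ex hF)
      rintro x ⟨⟨hx1, hx2⟩, hx3⟩
      simp only [Set.mem_singleton_iff] at hx3
      push_cast at hx1 hx2 ⊢
      constructor <;> omega
    have hb : ∀ ω, |F' ω| ≤ 1 := Ex_abs_le (p0' E) (p1' E) _ hFb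
    have k1 := h2 F' hd hb t ((le_max_right _ _).trans ht) ω hω
    set D : Config → ℝ := fun ω => (1 / 2) * (F ω - F' ω) with hD
    have hFd' : Dep (L + 1) (L + (n + 1 : ℕ)) F' := dep_Ex' hF
    have hDd : Dep (L + 1) (L + (n + 1 : ℕ)) D := fun ω ω' H => by
      simp only [hD, hF ω ω' H, hFd' ω ω' H]
    have hDb : ∀ ω, |D ω| ≤ 1 := by
      intro ω
      have a := abs_le.1 (hFb ω)
      have b := abs_le.1 (hb ω)
      rw [abs_le]; constructor <;> simp only [hD] <;> linarith
    have hDE : ∀ ω, Ex E.p (L + 1) D ω = 0 := by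
      intro ω
      simp only [hD, hF', Ex, Function.update_idem]
      ring
    have k2 := h1 _ D hDd hDb hDE t ((le_max_left _ _).trans ht) ω hω
    have k3 : Pt E t (phi F) ω = 2 * Pt E t (phi D) ω + Pt E t (phi F') ω := by
      rw [← Pt_smul, ← Pt_add (hDd.bm.phi.smul 2) hd.bm.phi]
      congr 1
      funext η
      simp only [phi, hD]; ring
    have k4 : ∫ ζ, F' ζ ∂E.μ = ∫ ζ, F ζ ∂E.μ := mu_Ex hF _
    rw [k3, ← k4, Finset.sum_range_succ']
    have k5 : ∑ i ∈ Finset.range n, e (L + (i + 1)) = ∑ i ∈ Finset.range n, e (L + 1 + i) :=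
      Finset.sum_congr rfl fun i _ => by congr 1; ring
    rw [k5, add_zero]
    have a := abs_le.1 k1
    have b := abs_le.1 k2
    rw [abs_le]; constructor <;> linarith

/-- Local convergence far behind the front. -/
lemma far (hgap : 0 < gap E) {ε : ℝ} (hε : 0 < ε) : ∃ L0 : ℕ, 1 ≤ L0 ∧ ∀ M : ℤ, ∃ T0 : ℝ, 0 ≤ T0 ∧
    ∀ F, Dep (L0 + 1) M F → (∀ ω, |F ω| ≤ 1) → ∀ t, T0 ≤ t →
      ∀ ω ∈ Fr 0, |Pt E t (phi F) ω - ∫ ζ, F ζ ∂E.μ| ≤ ε := by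
  obtain ⟨e, hs, h0, he⟩ := A1 hgap
  have hlim := (tendsto_sum_nat_add e)
  obtain ⟨L0, h1, h2⟩ := ((hlim.eventually_lt_const (half_pos hε)).and (eventually_ge_atTop 1)).exists
  refine ⟨L0, h2, fun M => ?_⟩
  obtain ⟨T0, hT0, h3⟩ := tele he M.toNat L0
  refine ⟨T0, hT0, fun F hF hFb t ht ω hω => ?_⟩
  refine (h3 F (hF.mono le_rfl (by omega)) hFb t ht ω hω).trans ?_
  have h4 : ∑ i ∈ Finset.range M.toNat, e (L0 + i) ≤ ∑' k, e (k + L0) := by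
    have hs' : Summable fun k => e (k + L0) := (summable_nat_add_iff L0).2 hs
    refine le_trans (le_of_eq ?_) (hs'.sum_le_tsum (Finset.range M.toNat) fun i _ => h0 _)
    exact Finset.sum_congr rfl fun i _ => by rw [add_comm]
  linarith

end
end EA

namespace EA
section
variable {E : EastProcess}

/-- Indicator: ones on `[-n,-1]`, zero at the origin, zeros on `[i,L+1]`. -/
def chi (L n : ℕ) (i : ℤ) (ω : Config) : ℝ :=
  cylI (Finset.Icc (-(n : ℤ)) 0) (fun x => decide (x ≠ 0)) ω *
    cylI (Finset.Icc i (L + 1)) (fun _ => false) ω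

/-- The limit of `chi` as `n → ∞`. -/
def XI (L : ℕ) (i : ℤ) (ω : Config) : ℝ :=
  frI 0 ω * cylI (Finset.Icc i (L + 1)) (fun _ => false) ω

/-- The event behind `chi`. -/
def chiP (L n : ℕ) (i : ℤ) (ω : Config) : Prop :=
  (∀ x, -(n : ℤ) ≤ x → x < 0 → ω x = true) ∧ ω 0 = false ∧ ∀ x, i ≤ x → x ≤ L + 1 → ω x = false

lemma chi_of {L n : ℕ} {i : ℤ} {ω : Config} (h : chiP L n i ω) : chi L n i ω = 1 := by
  obtain ⟨h1, h2, h3⟩ := h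
  unfold chi cylI
  rw [if_pos, if_pos, one_mul]
  · intro x hx
    exact h3 x (Finset.mem_Icc.1 hx).1 (Finset.mem_Icc.1 hx).2
  · intro x hx
    obtain ⟨a, b⟩ := Finset.mem_Icc.1 hx
    rcases b.lt_or_eq with b | b
    · rw [h1 x a b]; simp [b.ne]
    · rw [b, h2]; simp

lemma chi_not {L n : ℕ} {i : ℤ} {ω : Config} (h : ¬ chiP L n i ω) : chi L n i ω = 0 := by
  unfold chi cylI
  by_contra hc
  apply h
  split_ifs at hc with h1 h2 <;> simp at hc
  refine ⟨fun x a b => ?_, ?_, fun x a b => h2 x (Finset.mem_Icc.2 ⟨a, b⟩)⟩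
  · have := h1 x (Finset.mem_Icc.2 ⟨a, b.le⟩)
    rw [this]; simp [b.ne]
  · have := h1 0 (Finset.mem_Icc.2 ⟨by omega, le_rfl⟩)
    simpa using this

lemma chi_nonneg (L n : ℕ) (i : ℤ) (ω : Config) : 0 ≤ chi L n i ω := by
  by_cases h : chiP L n i ω
  · rw [chi_of h]; norm_num
  · rw [chi_not h]
lemma chi_le_one (L n : ℕ) (i : ℤ) (ω : Config) : chi L n i ω ≤ 1 := by
  by_cases h : chiP L n i ω
  · rw [chi_of h]
  · rw [chi_not h]; norm_num

lemma chi_dep (L n : ℕ) {i : ℤ} (hi : 0 ≤ i) : Dep (-(n : ℤ)) (L + 1) (chi L n i) := by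
  intro ω ω' H
  have : chiP L n i ω ↔ chiP L n i ω' := by
    unfold chiP
    constructor
    · rintro ⟨h1, h2, h3⟩
      refine ⟨fun x a b => ?_, ?_, fun x a b => ?_⟩
      · rw [← H x ⟨a, by omega⟩]; exact h1 x a b
      · rw [← H 0 ⟨by omega, by omega⟩]; exact h2
      · rw [← H x ⟨by omega, b⟩]; exact h3 x a b
    · rintro ⟨h1, h2, h3⟩
      refine ⟨fun x a b => ?_, ?_, fun x a b => ?_⟩
      · rw [H x ⟨a, by omega⟩]; exact h1 x a b
      · rw [H 0 ⟨by omega, by omega⟩]; exact h2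
      · rw [H x ⟨by omega, b⟩]; exact h3 x a b
  by_cases h : chiP L n i ω
  · rw [chi_of h, chi_of (this.1 h)]
  · rw [chi_not h, chi_not (fun h' => h (this.2 h'))]

lemma chi_tendsto (L : ℕ) (i : ℤ) (ω : Config) :
    Tendsto (fun n : ℕ => chi L n i ω) atTop (𝓝 (XI L i ω)) :=
  (frI_tendsto 0 ω).mul_const _

/-- The rate of leaving. -/
lemma gamma_bd {p : ℝ} (h0 : 0 ≤ p) (h1 : p ≤ 1) (L n : ℕ) {i N : ℤ} (hi : 1 ≤ i)
    (hi2 : i ≤ L + 1) (hN : (L : ℤ) + 2 ≤ N) {g : ℝ} (hg0 : 0 ≤ g) (hg : g ≤ 1 - p)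
    (hgi : i ≤ L ∨ g = 0) (ω : Config) :
    -(L + 4) * chi L n i ω + g * chi L n (i + 1) ω
      ≤ ∑ x ∈ (Finset.Ico (-(n : ℤ)) N).filter (fun x : ℤ => x < (L : ℤ) + 2),
          (K p x (chi L n i) ω - chi L n i ω) := by
  have hK0 : ∀ x, 0 ≤ K p x (chi L n i) ω := by
    intro x
    have := K_mono (p := p) h0 h1 x (f := fun _ => 0) (chi_nonneg L n i) ω
    rwa [K_const] at this
  have hc1 := chi_nonneg L n (i + 1) ω
  have hc2 := chi_le_one L n (i + 1) ω
  by_cases h : chiP L n i ω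
  · rw [chi_of h]
    have hsub : Finset.Icc (-1 : ℤ) (L + 1) ⊆ Finset.Icc (-1 : ℤ) (L + 1) := subset_rfl
    have e1 : ∀ x ∈ (Finset.Ico (-(n : ℤ)) N).filter (fun x : ℤ => x < (L : ℤ) + 2),
        (if x ∈ Finset.Icc (-1 : ℤ) (L + 1) then (-1 : ℝ) else 0) ≤ K p x (chi L n i) ω - 1 := by
      intro x hx
      rw [Finset.mem_filter, Finset.mem_Ico] at hx
      split_ifs with hm
      · linarith [hK0 x]
      · rw [Finset.mem_Icc] at hm
        have : ω (x + 1) = true := h.1 (x + 1) (by omega) (by omega)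
        unfold K
        rw [if_neg (by rw [this]; simp), chi_of h]; norm_num
    refine le_trans ?_ (Finset.sum_le_sum e1)
    rw [← Finset.sum_filter, Finset.sum_const, nsmul_eq_mul]
    set S := ((Finset.Ico (-(n : ℤ)) N).filter (fun x : ℤ => x < (L : ℤ) + 2)).filter
      (fun x => x ∈ Finset.Icc (-1 : ℤ) (L + 1)) with hS
    have hcard : S.card ≤ L + 3 := by
      have : S ⊆ Finset.Icc (-1 : ℤ) (L + 1) := by
        intro x hx
        rw [hS, Finset.mem_filter] at hx
        exact hx.2
      have := Finset.card_le_card this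
      rw [Int.card_Icc] at this
      omega
    have : (S.card : ℝ) ≤ L + 3 := by exact_mod_cast hcard
    nlinarith
  · rw [chi_not h]
    simp only [sub_zero, mul_zero, zero_add]
    by_cases h2 : chiP L n (i + 1) ω
    · rcases hgi with hgi | hgi
      · rw [chi_of h2, mul_one]
        have hw : K p i (chi L n i) ω ≥ 1 - p := by
          unfold K
          rw [if_pos (h2.2.2 (i + 1) le_rfl (by omega))]
          unfold Ex
          have : chiP L n i (Function.update ω i false) := by
            refine ⟨fun x a b => ?_, ?_, fun x a b => ?_⟩
            · rw [Function.update_of_ne (by omega)]; exact h2.1 x a b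
            · rw [Function.update_of_ne (by omega)]; exact h2.2.1
            · by_cases hx : x = i
              · rw [hx, Function.update_self]
              · rw [Function.update_of_ne hx]; exact h2.2.2 x (by omega) b
          rw [chi_of this]
          have := chi_nonneg L n i (Function.update ω i true)
          nlinarith
        refine hg.trans (hw.le.trans ?_)
        refine Finset.single_le_sum (f := fun x => K p x (chi L n i) ω) (fun x _ => hK0 x) ?_
        rw [Finset.mem_filter, Finset.mem_Ico]; omega
      · rw [hgi, zero_mul]; exact Finset.sum_nonneg fun x _ => hK0 x
    · rw [chi_not h2, mul_zero]; exact Finset.sum_nonneg fun x _ => hK0 x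

lemma chi_step {p : ℝ} (h0 : 0 ≤ p) (h1 : p ≤ 1) (L n : ℕ) {i N : ℤ} (hi : 1 ≤ i)
    (hi2 : i ≤ L + 1) (hN : (L : ℤ) + 2 ≤ N) {g : ℝ} (hg0 : 0 ≤ g) (hg : g ≤ 1 - p)
    (hgi : i ≤ L ∨ g = 0) {v : Config → ℝ} (hv : Dep (L + 2) N v) (hv0 : ∀ ω, 0 ≤ v ω)
    (hv1 : ∀ ω, v ω ≤ 1) {h : ℝ} (hh : 0 ≤ h) (ω : Config) :
    (1 - h * (L + 4)) * (chi L n i ω * Q p h (Finset.Ico (-(n : ℤ)) N) v ω)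
      + h * g * (chi L n (i + 1) ω * Q p h (Finset.Ico (-(n : ℤ)) N) v ω)
      - h ^ 2 * (2 * (L + 5) * (Finset.Ico (-(n : ℤ)) N).card)
      ≤ Q p h (Finset.Ico (-(n : ℤ)) N) (fun ω => chi L n i ω * v ω) ω := by
  set s := Finset.Ico (-(n : ℤ)) N with hs
  set c := chi L n i with hc
  have hcd : Dep (-(n : ℤ)) (L + 1) c := chi_dep L n (by omega)
  -- exact product formula
  have e1 : ∀ x : ℤ, x < L + 2 → K p x (fun ω => c ω * v ω) ω - c ω * v ω
      = c ω * (K p x v ω - v ω) + v ω * (K p x c ω - c ω) := by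
    intro x hx
    have hu : ∀ b, v (Function.update ω x b) = v ω := by
      intro b
      apply hv
      intro y hy
      rw [Function.update_of_ne (by have := hy.1; omega)]
    unfold K Ex
    simp only [hu]
    split_ifs <;> ring
  have e2 : ∀ x : ℤ, ¬ x < L + 2 → K p x (fun ω => c ω * v ω) ω - c ω * v ω
      = c ω * (K p x v ω - v ω) := by
    intro x hx
    have hu : ∀ b, c (Function.update ω x b) = c ω := by
      intro b
      apply hcd
      intro y hy
      rw [Function.update_of_ne (by have := hy.2; omega)]
    unfold K Ex
    simp only [hu]
    split_ifs <;> ring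
  have e3 : ∑ x ∈ s, (K p x (fun ω => c ω * v ω) ω - c ω * v ω)
      = c ω * ∑ x ∈ s, (K p x v ω - v ω)
        + v ω * ∑ x ∈ s.filter (fun x : ℤ => x < (L : ℤ) + 2), (K p x c ω - c ω) := by
    rw [Finset.sum_filter, Finset.mul_sum, Finset.mul_sum, ← Finset.sum_add_distrib]
    apply Finset.sum_congr rfl
    intro x _
    split_ifs with hx
    · exact e1 x hx
    · rw [e2 x hx]; ring
  have e4 := gamma_bd h0 h1 L n hi hi2 hN hg0 hg hgi ω
  rw [← hs, ← hc] at e4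
  have hvb : ∀ ω, |v ω| ≤ 1 := fun ω => by rw [abs_of_nonneg (hv0 ω)]; exact hv1 ω
  have e5 := gs_bd h0 h1 hvb s ω
  set Γ := ∑ x ∈ s.filter (fun x : ℤ => x < (L : ℤ) + 2), (K p x c ω - c ω) with hΓ
  set d := ∑ x ∈ s, (K p x v ω - v ω) with hd
  have e6 : Q p h s v ω = v ω + h * d := rfl
  have e7 : Q p h s (fun ω => c ω * v ω) ω = c ω * v ω + h * (c ω * d + v ω * Γ) := by
    unfold Q; rw [e3]
  rw [e6, e7]
  have a1 := mul_le_mul_of_nonneg_left e4 (mul_nonneg hh (hv0 ω))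
  set c' := chi L n (i + 1) ω with hc'
  have b0 : 0 ≤ c ω := chi_nonneg _ _ _ _
  have b1 : c ω ≤ 1 := chi_le_one _ _ _ _
  have b2 : 0 ≤ c' := chi_nonneg _ _ _ _
  have b3 : c' ≤ 1 := chi_le_one _ _ _ _
  have hcoef : |(-(L + 4) * c ω + g * c')| ≤ L + 5 := by
    have : (0:ℝ) ≤ L := by positivity
    rw [abs_le]; constructor <;> nlinarith
  have a2 : (-(L + 4) * c ω + g * c') * d ≤ 2 * (L + 5) * s.card := by
    calc (-(L + 4) * c ω + g * c') * d ≤ |(-(L + 4) * c ω + g * c') * d| := le_abs_self _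
      _ = |(-(L + 4) * c ω + g * c')| * |d| := abs_mul _ _
      _ ≤ (L + 5) * (2 * s.card) := by gcongr
      _ = _ := by ring
  have a3 := mul_le_mul_of_nonneg_left a2 (sq_nonneg h)
  have : (1 - h * (L + 4)) * (c ω * (v ω + h * d)) + h * g * (c' * (v ω + h * d))
      = c ω * (v ω + h * d) + h * v ω * (-(L + 4) * c ω + g * c')
        + h ^ 2 * ((-(L + 4) * c ω + g * c') * d) := by ring
  nlinarith

lemma chi_iter {p : ℝ} (h0 : 0 ≤ p) (h1 : p ≤ 1) (L n : ℕ) {i N : ℤ} (hi : 1 ≤ i)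
    (hi2 : i ≤ L) (hN : (L : ℤ) + 2 ≤ N) {v : Config → ℝ} (hv : Dep (L + 2) N v)
    (hv0 : ∀ ω, 0 ≤ v ω)
    (hv1 : ∀ ω, v ω ≤ 1) {h : ℝ} (hh : 0 ≤ h) (hR : h * (L + 4) ≤ 1)
    (hs : h * (Finset.Ico (-(n : ℤ)) N).card ≤ 1) (k : ℕ) (hk : k * h ≤ 1) (ω : Config) :
    (1 - h * (L + 4)) ^ k * (chi L n i ω * (Q p h (Finset.Ico (-(n : ℤ)) N))^[k] v ω)
      + k * h * (1 - p) * (1 - h * (L + 4)) ^ k *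
          (chi L n (i + 1) ω * (Q p h (Finset.Ico (-(n : ℤ)) N))^[k] v ω)
      - k * (2 * (h ^ 2 * (2 * (L + 5) * (Finset.Ico (-(n : ℤ)) N).card)))
      ≤ (Q p h (Finset.Ico (-(n : ℤ)) N))^[k] (fun ω => chi L n i ω * v ω) ω := by
  set s := Finset.Ico (-(n : ℤ)) N with hs'
  set C := h ^ 2 * (2 * (L + 5) * (s.card : ℝ)) with hC
  have hC0 : 0 ≤ C := by positivity
  set ρ := 1 - h * (L + 4) with hρ
  have hρ0 : 0 ≤ ρ := by rw [hρ]; linarith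
  have hρ1 : ρ ≤ 1 := by rw [hρ]; have : 0 ≤ h * (L + 4) := by positivity
                         linarith
  induction k generalizing ω with
  | zero => simp
  | succ k ih =>
    have hk' : k * h ≤ 1 := by push_cast at hk; nlinarith
    have ih' := fun ω => ih hk' ω
    have m0 : ∀ ω, 0 ≤ (Q p h s)^[k] v ω := fun ω => by
      have := Qi_mono h0 h1 hh hs k (f := fun _ => 0) (g := v) hv0 ω
      rwa [Qi_const] at this
    have m1 : ∀ ω, (Q p h s)^[k] v ω ≤ 1 := fun ω => by
      have := Qi_mono h0 h1 hh hs k (g := fun _ => 1) (f := v) hv1 ω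
      rwa [Qi_const] at this
    have hvd : Dep (L + 2) N ((Q p h s)^[k] v) := hv.Qiter k
    have s1 := chi_step h0 h1 L n hi (by omega) hN (g := 1 - p) (by linarith) le_rfl (Or.inl hi2)
      hvd m0 m1 hh ω
    have s2 := chi_step h0 h1 L n (i := i + 1) (by omega) (by omega) hN (g := 0) le_rfl (by linarith)
      (Or.inr rfl) hvd m0 m1 hh ω
    rw [← hs', ← hC, ← hρ] at s1 s2
    have mono := Q_mono h0 h1 hh hs ih' ω
    rw [Q_sub, Q_add, Q_smul, Q_smul, Q_const] at mono
    rw [Function.iterate_succ_apply', Function.iterate_succ_apply']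
    set A := Q p h s (fun ω => chi L n i ω * (Q p h s)^[k] v ω) ω
    set A' := Q p h s (fun ω => chi L n (i + 1) ω * (Q p h s)^[k] v ω) ω
    set V := Q p h s ((Q p h s)^[k] v) ω
    have hV : 0 ≤ V := by
      have := Q_mono h0 h1 hh hs (f := fun _ => 0) m0 ω
      rwa [Q_const] at this
    refine le_trans ?_ mono
    have hρk0 : 0 ≤ ρ ^ k := pow_nonneg hρ0 k
    have hρk1 : ρ ^ k ≤ 1 := pow_le_one₀ hρ0 hρ1
    have hb0 : 0 ≤ k * h * (1 - p) * ρ ^ k := by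
      have : 0 ≤ 1 - p := by linarith
      positivity
    have hb1 : k * h * (1 - p) * ρ ^ k ≤ 1 := by
      have : (k * h) * ((1 - p) * ρ ^ k) ≤ 1 * 1 := by
        apply mul_le_mul hk' _ _ zero_le_one
        · nlinarith
        · have : 0 ≤ 1 - p := by linarith
          positivity
      linarith
    have t1 := mul_le_mul_of_nonneg_left s1 hρk0
    have t2 := mul_le_mul_of_nonneg_left s2 hb0
    have t3 : ρ ^ k * C ≤ C := mul_le_of_le_one_left hC0 hρk1
    have t4 : k * h * (1 - p) * ρ ^ k * C ≤ C := mul_le_of_le_one_left hC0 hb1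
    have hx := chi_nonneg L n (i + 1) ω
    have t5 : ρ ^ (k + 1) ≤ ρ ^ k := pow_le_pow_of_le_one hρ0 hρ1 (by omega)
    have t6 : h * (1 - p) * (chi L n (i + 1) ω * V) * ρ ^ (k + 1)
        ≤ h * (1 - p) * (chi L n (i + 1) ω * V) * ρ ^ k := by
      apply mul_le_mul_of_nonneg_left t5
      have : 0 ≤ 1 - p := by linarith
      positivity
    push_cast
    rw [pow_succ] at t6 ⊢
    nlinarith

end
end EA

namespace EA
section
variable {E : EastProcess}

/-- The minorization constant. -/
def c1 (E : EastProcess) (L : ℕ) : ℝ := (1 - E.p) * Real.exp (-((L : ℝ) + 4))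

lemma c1_pos (L : ℕ) : 0 < c1 E L :=
  mul_pos (by linarith [E.hp1]) (Real.exp_pos _)

lemma chi_Pt (L n : ℕ) {i b : ℤ} (hi : 1 ≤ i) (hi2 : i ≤ L) {v : Config → ℝ} (hv : Dep (L + 2) b v)
    (hv0 : ∀ ω, 0 ≤ v ω) (hv1 : ∀ ω, v ω ≤ 1) (ω : Config) :
    c1 E L * (chi L n (i + 1) ω * Pt E 1 v ω) ≤ Pt E 1 (fun ω => chi L n i ω * v ω) ω := by
  have h0 := p0' E
  have h1 := p1' E
  apply le_of_forall_pos_le_add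
  intro ε' hε'
  set ε := ε' / 4 with hεd
  have hε : 0 < ε := by positivity
  set b' := max b (L + 2) with hb'
  obtain ⟨N, hN, hNb⟩ := ((approx E (-(n : ℤ)) b' zero_le_one hε).and (eventually_ge_atTop b')).exists
  set s := Finset.Ico (-(n : ℤ)) N with hs
  have l1 : Tendsto (fun m : ℕ => (1 + (-((L : ℝ) + 4)) / (m : ℝ)) ^ m) atTop
      (𝓝 (Real.exp (-((L : ℝ) + 4)))) := Real.tendsto_one_add_div_pow_exp _
  have l2 : Tendsto (fun m : ℕ => ((L : ℝ) + 4) / (m : ℝ)) atTop (𝓝 0) :=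
    tendsto_const_div_atTop_nhds_zero_nat _
  have l3 : Tendsto (fun m : ℕ => (2 * (2 * ((L : ℝ) + 5) * s.card)) / (m : ℝ)) atTop (𝓝 0) :=
    tendsto_const_div_atTop_nhds_zero_nat _
  obtain ⟨m, hm1, hm2, hm3, hm4, hm5, hm6⟩ := (hN.and ((step_small 1 s).and
    ((l1.eventually_const_lt (sub_lt_self _ hε)).and
    ((l2.eventually_lt_const zero_lt_one).and ((l3.eventually_lt_const hε).and
      (eventually_ge_atTop 1)))))).exists
  have hm0 : (0 : ℝ) < m := by exact_mod_cast hm6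
  have hbb : b ≤ b' := le_max_left _ _
  have hLb : (L : ℤ) + 2 ≤ b' := le_max_right _ _
  have hcd : Dep (-(n : ℤ)) b' (chi L n i) := (chi_dep L n (by omega)).mono le_rfl (by omega)
  have hvd : Dep (-(n : ℤ)) b' v := hv.mono (by omega) hbb
  have hcv : Dep (-(n : ℤ)) b' (fun ω => chi L n i ω * v ω) := by
    have := hcd.mul hvd
    simpa using this
  have a1 := hm1 _ hcv (fun ω => by
    rw [abs_of_nonneg (mul_nonneg (chi_nonneg _ _ _ _) (hv0 ω))]
    exact mul_le_one₀ (chi_le_one _ _ _ _) (hv0 ω) (hv1 ω)) ω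
  have a2 := hm1 _ hvd (fun ω => by rw [abs_of_nonneg (hv0 ω)]; exact hv1 ω) ω
  have hh : (0 : ℝ) ≤ 1 / m := by positivity
  have a3 := chi_iter (p := E.p) h0 h1 L n hi hi2 (N := N) (by omega) (hv.mono le_rfl (by omega))
    hv0 hv1 hh (by rw [one_div_mul_eq_div]; exact hm4.le) hm2 m
    (by rw [mul_one_div_cancel hm0.ne']) ω
  rw [← hs] at a3
  have V0 : 0 ≤ (Q E.p (1 / m) s)^[m] v ω := by
    have := Qi_mono h0 h1 hh hm2 m (f := fun _ => 0) (g := v) hv0 ω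
    rwa [Qi_const] at this
  have V1 : (Q E.p (1 / m) s)^[m] v ω ≤ 1 := by
    have := Qi_mono h0 h1 hh hm2 m (g := fun _ => 1) (f := v) hv1 ω
    rwa [Qi_const] at this
  set V := (Q E.p (1 / m) s)^[m] v ω
  set A := (Q E.p (1 / m) s)^[m] (fun ω => chi L n i ω * v ω) ω
  have e1 : (m : ℝ) * (2 * ((1 / m) ^ 2 * (2 * (L + 5) * (s.card : ℝ)))) ≤ ε := by
    refine le_trans (le_of_eq ?_) hm5.le
    field_simp
  have e2 : (1 + (-((L : ℝ) + 4)) / (m : ℝ)) = 1 - 1 / m * (L + 4) := by ring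
  rw [e2] at hm3
  rw [mul_one_div_cancel hm0.ne', one_mul] at a3
  set ρ := (1 - 1 / (m : ℝ) * (L + 4)) ^ m
  have hρ : 0 ≤ ρ := by
    apply pow_nonneg
    have : 1 / (m : ℝ) * (L + 4) ≤ 1 := by rw [one_div_mul_eq_div]; exact hm4.le
    linarith
  rw [abs_le] at a1 a2
  have b0 := chi_nonneg L n i ω
  have b2 := chi_nonneg L n (i + 1) ω
  have b3 := chi_le_one L n (i + 1) ω
  have f1 : 0 ≤ ρ * (chi L n i ω * V) := by positivity
  set x := chi L n (i + 1) ω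
  set e := Real.exp (-((L : ℝ) + 4)) with he
  have he0 : 0 ≤ e := (Real.exp_pos _).le
  have he1 : e ≤ 1 := Real.exp_le_one_iff.2 (by have : (0:ℝ) ≤ L := by positivity
                                                linarith)
  have hq0 : 0 ≤ 1 - E.p := by linarith
  have f2 : (1 - E.p) * (e - ε) * (x * V) ≤ (1 - E.p) * ρ * (x * V) := by
    gcongr
  have f3 : (1 - E.p) * ε * (x * V) ≤ ε := by
    have : x * V ≤ 1 := mul_le_one₀ b3 V0 V1
    have h2 : (1 - E.p) * (x * V) ≤ 1 := mul_le_one₀ (by linarith) (by positivity) this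
    nlinarith
  have f4 : (1 - E.p) * e * (x * Pt E 1 v ω) ≤ (1 - E.p) * e * (x * (V + ε)) := by
    gcongr; linarith
  have f5 : (1 - E.p) * e * x * ε ≤ ε := by
    have h2 : (1 - E.p) * e * x ≤ 1 := mul_le_one₀ (mul_le_one₀ (by linarith) he0 he1) b2 b3
    nlinarith
  unfold c1
  rw [← he]
  have : ε' = 4 * ε := by rw [hεd]; ring
  rw [this]
  linarith

lemma XI_bm (L : ℕ) (i : ℤ) : BM (XI L i) := by
  refine (frI_bm 0).mul ?_
  refine Dep.bm (a := i) (b := L + 1) ?_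
  have := cylI_dep (Finset.Icc i (L + 1)) (fun _ => false)
  simpa [Dep] using this

lemma XI_Pt0 (L : ℕ) {i b : ℤ} (hi : 1 ≤ i) (hi2 : i ≤ L) {v : Config → ℝ} (hv : Dep (L + 2) b v)
    (hv0 : ∀ ω, 0 ≤ v ω) (hv1 : ∀ ω, v ω ≤ 1) (ω : Config) :
    c1 E L * (XI L (i + 1) ω * Pt E 1 v ω) ≤ Pt E 1 (fun ω => XI L i ω * v ω) ω := by
  have l1 : Tendsto (fun n : ℕ => Pt E 1 (fun ω => chi L n i ω * v ω) ω) atTop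
      (𝓝 (Pt E 1 (fun ω => XI L i ω * v ω) ω)) := by
    apply Pt_tendsto (C := 1)
    · intro n
      exact ((chi_dep L n (by omega)).bm.mul hv.bm).1
    · intro n ω
      rw [abs_of_nonneg (mul_nonneg (chi_nonneg _ _ _ _) (hv0 ω))]
      exact mul_le_one₀ (chi_le_one _ _ _ _) (hv0 ω) (hv1 ω)
    · intro ω
      exact (chi_tendsto L i ω).mul_const _
  have l2 : Tendsto (fun n : ℕ => c1 E L * (chi L n (i + 1) ω * Pt E 1 v ω)) atTop
      (𝓝 (c1 E L * (XI L (i + 1) ω * Pt E 1 v ω))) :=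
    ((chi_tendsto L (i + 1) ω).mul_const _).const_mul _
  exact le_of_tendsto_of_tendsto' l2 l1 (fun n => chi_Pt L n hi hi2 hv hv0 hv1 ω)

/-- Uniform limits of cylinder functions looking at sites `≥ a`. -/
def Far (a : ℤ) (v : Config → ℝ) : Prop := BM v ∧
  ∀ ε : ℝ, 0 < ε → ∃ (b : ℤ) (w : Config → ℝ), Dep a b w ∧ (∀ ω, 0 ≤ w ω) ∧ (∀ ω, w ω ≤ 1) ∧
    ∀ ω, |v ω - w ω| ≤ ε

lemma Far.Pt {a : ℤ} {v : Config → ℝ} (hv : Far a v) {t : ℝ} (ht : 0 ≤ t) : Far a (EA.Pt E t v) := by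
  refine ⟨hv.1.Pt t, fun ε hε => ?_⟩
  obtain ⟨b, w, hw, w0, w1, hvw⟩ := hv.2 (ε / 2) (half_pos hε)
  obtain ⟨N, hN, hNb⟩ := ((approx E a b ht (half_pos hε)).and (eventually_ge_atTop b)).exists
  obtain ⟨m, hm, hm2⟩ := (hN.and (step_small t (Finset.Ico a N))).exists
  have hh : 0 ≤ t / m := by positivity
  refine ⟨N, (Q E.p (t / m) (Finset.Ico a N))^[m] w, (hw.mono le_rfl hNb).Qiter m, ?_, ?_, ?_⟩
  · intro ω
    have := Qi_mono (p0' E) (p1' E) hh hm2 m (f := fun _ => 0) (g := w) w0 ω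
    rwa [Qi_const] at this
  · intro ω
    have := Qi_mono (p0' E) (p1' E) hh hm2 m (g := fun _ => 1) (f := w) w1 ω
    rwa [Qi_const] at this
  · intro ω
    have a1 := hm w hw (fun ω => by rw [abs_of_nonneg (w0 ω)]; exact w1 ω) ω
    have a2 : |EA.Pt E t (fun η => v η - w η) ω| ≤ ε / 2 := Pt_abs_le t hvw ω
    rw [Pt_sub hv.1 hw.bm] at a2
    have := abs_sub_le (EA.Pt E t v ω) (EA.Pt E t w ω)
      ((Q E.p (t / m) (Finset.Ico a N))^[m] w ω)
    linarith

lemma XI_nonneg (L : ℕ) (i : ℤ) (ω : Config) : 0 ≤ XI L i ω :=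
  ge_of_tendsto' (chi_tendsto L i ω) (fun n => chi_nonneg L n i ω)
lemma XI_le_one (L : ℕ) (i : ℤ) (ω : Config) : XI L i ω ≤ 1 :=
  le_of_tendsto' (chi_tendsto L i ω) (fun n => chi_le_one L n i ω)

lemma XI_Pt (L : ℕ) {i : ℤ} (hi : 1 ≤ i) (hi2 : i ≤ L) {v : Config → ℝ} (hv : Far (L + 2) v)
    (ω : Config) :
    c1 E L * (XI L (i + 1) ω * Pt E 1 v ω) ≤ Pt E 1 (fun ω => XI L i ω * v ω) ω := by
  apply le_of_forall_pos_le_add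
  intro ε' hε'
  have hc := (c1_pos (E := E) L).le
  set ε := ε' / (c1 E L + 1) with hε
  have hε0 : 0 < ε := by positivity
  obtain ⟨b, w, hw, w0, w1, hvw⟩ := hv.2 ε hε0
  have a1 := XI_Pt0 (E := E) L hi hi2 hw w0 w1 ω
  have a2 : |EA.Pt E 1 (fun η => v η - w η) ω| ≤ ε := Pt_abs_le 1 hvw ω
  rw [Pt_sub hv.1 hw.bm, abs_le] at a2
  have a3 : |EA.Pt E 1 (fun η => XI L i η * v η - XI L i η * w η) ω| ≤ ε := by
    refine Pt_abs_le 1 (fun η => ?_) ω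
    rw [← mul_sub, abs_mul, abs_of_nonneg (XI_nonneg L i η)]
    have := mul_le_mul (XI_le_one L i η) (hvw η) (abs_nonneg _) zero_le_one
    linarith
  rw [Pt_sub ((XI_bm L i).mul hv.1) ((XI_bm L i).mul hw.bm), abs_le] at a3
  have x0 := XI_nonneg L (i + 1) ω
  have x1 := XI_le_one L (i + 1) ω
  have a4 : c1 E L * (XI L (i + 1) ω * Pt E 1 v ω)
      ≤ c1 E L * (XI L (i + 1) ω * (Pt E 1 w ω + ε)) := by
    gcongr; linarith
  have a5 : c1 E L * (XI L (i + 1) ω * ε) ≤ c1 E L * ε := by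
    gcongr; nlinarith
  have : ε' = c1 E L * ε + ε := by rw [hε]; field_simp
  rw [this]
  nlinarith

lemma XI_iter (L : ℕ) (k : ℕ) : ∀ {i : ℤ} {v : Config → ℝ}, 1 ≤ i → i + k ≤ L + 1 → Far (L + 2) v →
    ∀ ω, c1 E L ^ k * (XI L (i + k) ω * Pt E k v ω) ≤ Pt E k (fun ω => XI L i ω * v ω) ω := by
  induction k with
  | zero =>
    intro i v hi hi2 hv ω
    have e0 : ((0 : ℕ) : ℝ) = 0 := Nat.cast_zero
    rw [e0, Pt_zero _ hv.1, Pt_zero _ ((XI_bm L i).mul hv.1)]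
    simp
  | succ k ih =>
    intro i v hi hi2 hv ω
    have hc := (c1_pos (E := E) L).le
    have e1 : ((k + 1 : ℕ) : ℝ) = (k : ℝ) + 1 := by push_cast; ring
    have hb := (XI_bm L i).mul hv.1
    rw [e1, Pt_semi hb zero_le_one (by positivity), Pt_semi hv.1 zero_le_one (by positivity)]
    have m1 := Pt_mono (E := E) (((XI_bm L (i + 1)).mul (hv.1.Pt (E := E) 1)).smul (c1 E L)) (hb.Pt 1) k
      (fun η => XI_Pt L hi (by push_cast at hi2; omega) hv η) ω
    rw [Pt_smul] at m1
    have m2 := ih (i := i + 1) (by omega) (by push_cast at hi2; omega) (hv.Pt (E := E) zero_le_one) ω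
    have e2 : i + ((k + 1 : ℕ) : ℤ) = i + 1 + k := by push_cast; ring
    rw [e2, pow_succ]
    have := mul_le_mul_of_nonneg_left m2 hc
    linarith

/-- Fill the sites up to `L+1` with zeros. -/
def hat (L : ℕ) (F : Config → ℝ) (ω : Config) : ℝ :=
  F (fun x => if x ≤ L + 1 then false else ω x)

lemma hat_dep (L : ℕ) {F : Config → ℝ} {M : ℤ} (hF : Dep 1 M F) : Dep (L + 2) M (hat L F) := by
  intro ω ω' H
  apply hF
  intro x hx
  split_ifs with h
  · rfl
  · exact H x ⟨by omega, hx.2⟩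

lemma minor (L : ℕ) {F : Config → ℝ} {M : ℤ} (hF : Dep 1 M F) (F0 : ∀ ω, 0 ≤ F ω)
    (F1 : ∀ ω, F ω ≤ 1) {η : Config} (hη : η ∈ Fr 0) :
    c1 E L ^ L * (at0 (L + 1) false η * Pt E L (hat L F) η) ≤ Pt E L (phi F) η := by
  have hh := hat_dep L hF
  have hfar : Far (L + 2) (hat L F) := ⟨hh.bm, fun ε hε => ⟨M, hat L F, hh, fun ω => F0 _,
    fun ω => F1 _, fun ω => by simp [hε.le]⟩⟩
  have a1 := XI_iter (E := E) L L (i := 1) le_rfl (by omega) hfar η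
  have e1 : XI L (1 + L) η = at0 (L + 1) false η := by
    unfold XI
    rw [frI_of hη, one_mul]
    unfold cylI at0
    have : (∀ x ∈ Finset.Icc (1 + (L : ℤ)) (L + 1), η x = false) ↔ η (L + 1) = false := by
      constructor
      · intro h; exact h _ (Finset.mem_Icc.2 ⟨by omega, le_rfl⟩)
      · intro h x hx
        rw [Finset.mem_Icc] at hx
        have : x = L + 1 := by omega
        rw [this]; exact h
    classical
    simp only [this]
  rw [e1] at a1
  refine a1.trans (Pt_mono ((XI_bm L 1).mul hh.bm) hF.bm.phi _ (fun ω => ?_) _)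
  by_cases hω : ω ∈ Fr 0 ∧ ∀ x ∈ Finset.Icc (1 : ℤ) (L + 1), ω x = false
  · have e2 : phi F ω = hat L F ω := by
      unfold phi hat
      rw [theta_eq hω.1, shift_zero]
      apply hF
      intro x hx
      split_ifs with h
      · exact hω.2 x (Finset.mem_Icc.2 ⟨hx.1, h⟩)
      · rfl
    rw [e2]
    have := XI_le_one L 1 ω
    have := F0 (fun x => if x ≤ L + 1 then false else ω x)
    have h3 : 0 ≤ hat L F ω := this
    nlinarith
  · have : XI L 1 ω = 0 := by
      unfold XI
      by_cases h : ω ∈ Fr 0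
      · have h2 : ¬ ∀ x ∈ Finset.Icc (1 : ℤ) (L + 1), ω x = false := fun h2 => hω ⟨h, h2⟩
        unfold cylI
        rw [if_neg h2, mul_zero]
      · rw [frI_not h, zero_mul]
    rw [this, zero_mul]
    exact F0 _

/-- Doeblin-type contraction. -/
lemma doeblin (hgap : 0 < gap E) : ∃ c : ℝ, 0 < c ∧ c ≤ 1 ∧ ∀ M : ℤ, ∃ T0 : ℝ, 0 ≤ T0 ∧ ∀ T, T0 ≤ T →
    ∀ F, Dep 1 M F → (∀ ω, 0 ≤ F ω) → (∀ ω, F ω ≤ 1) → ∀ ω ∈ Fr 0, ∀ σ ∈ Fr 0,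
      Pt E T (phi F) ω - Pt E T (phi F) σ ≤ 1 - c := by
  have hp0 := E.hp0
  have hp1 := E.hp1
  set q := 1 - E.p with hq
  have hq0 : 0 < q := by rw [hq]; linarith
  have hq1 : q < 1 := by rw [hq]; linarith
  obtain ⟨L, hL, hfar⟩ := far hgap (ε := q / 8) (by positivity)
  set c0 := c1 E L ^ L with hc0
  have hc0p : 0 < c0 := pow_pos (c1_pos L) L
  have hc0l : c0 ≤ 1 := by
    apply pow_le_one₀ (c1_pos L).le
    unfold c1
    refine mul_le_one₀ (by linarith) (Real.exp_pos _).le (Real.exp_le_one_iff.2 ?_)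
    have : (0:ℝ) ≤ L := by positivity
    linarith
  refine ⟨c0 * (q / 2), by positivity, by nlinarith, fun M => ?_⟩
  have hL0 : (0 : ℝ) ≤ L := by positivity
  obtain ⟨N, hN, hNb⟩ := ((approx E ((L : ℤ) + 2) M hL0 (ε := q / 8) (by positivity)).and
    (eventually_ge_atTop (max M (L + 1)))).exists
  obtain ⟨m, hm, hm2⟩ := (hN.and (step_small L (Finset.Ico ((L : ℤ) + 2) N))).exists
  have hNM : M ≤ N := (le_max_left _ _).trans hNb
  have hNL : (L : ℤ) + 1 ≤ N := (le_max_right _ _).trans hNb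
  set s := Finset.Ico ((L : ℤ) + 2) N with hs
  have hh : (0 : ℝ) ≤ L / m := by positivity
  obtain ⟨T0, hT0, hT⟩ := hfar N
  refine ⟨T0 + L, by positivity, fun T hTT => ?_⟩
  -- one-sided bound
  have key : ∀ F, Dep 1 M F → (∀ ω, 0 ≤ F ω) → (∀ ω, F ω ≤ 1) → ∀ ω ∈ Fr 0,
      c0 * ((∫ η, at0 (L + 1) false η * (Q E.p (L / m) s)^[m] (hat L F) η ∂E.μ) - q / 4)
        ≤ Pt E T (phi F) ω := by
    intro F hF F0 F1 ω hω
    have hd := hat_dep L hF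
    set H := fun η => at0 (L + 1) false η * (Q E.p (L / m) s)^[m] (hat L F) η with hH
    have hHd : Dep (L + 1) N H := by
      have := (at0_dep (L + 1) false).mul ((hd.mono le_rfl hNM).Qiter (p := E.p) (h := L / m)
        (l := (L : ℤ) + 2) m)
      exact this.mono (by simp) (by simp [hNL])
    have hv0 : ∀ η, 0 ≤ (Q E.p (L / m) s)^[m] (hat L F) η := by
      intro ω
      have := Qi_mono (p0' E) (p1' E) hh hm2 m (f := fun _ => 0) (g := hat L F) (fun _ => F0 _) ω
      rwa [Qi_const] at this
    have hv1 : ∀ η, (Q E.p (L / m) s)^[m] (hat L F) η ≤ 1 := by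
      intro ω
      have := Qi_mono (p0' E) (p1' E) hh hm2 m (g := fun _ => 1) (f := hat L F) (fun _ => F1 _) ω
      rwa [Qi_const] at this
    have at0n : ∀ η, 0 ≤ at0 (L + 1) false η := by
      intro η; unfold at0; split_ifs <;> norm_num
    have at1n : ∀ η, at0 (L + 1) false η ≤ 1 := by
      intro η; unfold at0; split_ifs <;> norm_num
    have hfa := hT H hHd (fun η => by
      rw [abs_of_nonneg (mul_nonneg (at0n η) (hv0 η))]
      exact mul_le_one₀ (at1n η) (hv0 η) (hv1 η)) (T - L) (by linarith) ω hω
    have eT : T = (T - L) + L := by ring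
    rw [eT, Pt_semi hF.bm.phi hL0 (by linarith)]
    have hmono : Pt E (T - L) (fun η => c0 * (phi H η - q / 8)) ω
        ≤ Pt E (T - L) (Pt E L (phi F)) ω := by
      apply Pt_mono_ae
      · exact (hHd.bm.phi.sub (bm_const _)).smul _
      · exact hF.bm.phi.Pt _
      filter_upwards [ae_LO (E := E) (Fr_LO hω) (t := T - L) (by linarith)] with η hη
      rw [← Pt_phi_theta hF.bm hL0 hη]
      have hθ := theta_Fr hη
      refine le_trans ?_ (minor L hF F0 F1 hθ)
      rw [← hc0]
      apply mul_le_mul_of_nonneg_left _ hc0p.le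
      have a := hm (hat L F) hd (fun ω => by
        unfold hat; rw [abs_of_nonneg (F0 _)]; exact F1 _) (θL 0 η)
      rw [abs_le] at a
      have b0 := at0n (θL 0 η)
      have b1 := at1n (θL 0 η)
      have : phi H η = at0 (L + 1) false (θL 0 η) * (Q E.p (L / m) s)^[m] (hat L F) (θL 0 η) := rfl
      rw [this]
      nlinarith
    rw [Pt_smul, Pt_sub hHd.bm.phi (bm_const _), Pt_const] at hmono
    refine le_trans ?_ hmono
    apply mul_le_mul_of_nonneg_left _ hc0p.le
    rw [abs_le] at hfa
    linarith
  intro F hF F0 F1 ω hω σ hσ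
  have hF' : Dep 1 M (fun ω => 1 - F ω) := by
    intro a b H
    beta_reduce
    rw [hF a b H]
  have k1 := key F hF F0 F1 σ hσ
  have k2 := key _ hF' (fun ω => by linarith [F1 ω]) (fun ω => by linarith [F0 ω]) ω hω
  have e1 : Pt E T (phi fun ω => 1 - F ω) ω = 1 - Pt E T (phi F) ω := by
    have := Pt_sub (E := E) (bm_const 1) hF.bm.phi T ω
    rw [Pt_const] at this
    exact this
  rw [e1] at k2
  have e2 : ∀ η, (Q E.p (L / m) s)^[m] (hat L fun ω => 1 - F ω) η
      = 1 - (Q E.p (L / m) s)^[m] (hat L F) η := by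
    intro η
    have := Qi_sub (p := E.p) (h := L / m) (s := s) m (fun _ => 1) (hat L F) η
    rw [Qi_const] at this
    exact this
  have e3 : ∫ η, at0 (L + 1) false η * (Q E.p (L / m) s)^[m] (hat L fun ω => 1 - F ω) η ∂E.μ
      = q - ∫ η, at0 (L + 1) false η * (Q E.p (L / m) s)^[m] (hat L F) η ∂E.μ := by
    simp only [e2]
    have h1 : ∫ η, at0 (L + 1) false η * (1 : ℝ) ∂E.μ = q := by
      have := mu_at0 (E := E) (a := L + 2) (b := L + 2) (k := L + 1) (ψ := fun _ => 1)
        (fun _ _ _ => rfl) (Or.inl (by omega))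
      rw [this]; simp [hq]
    simp only [mul_sub]
    have hd1 := (at0_dep (L + 1) false).mul (((hat_dep L hF).mono le_rfl hNM).Qiter (p := E.p)
      (h := L / m) (l := (L : ℤ) + 2) m)
    have hd0 : Integrable (fun η => at0 (L + 1) false η * (1 : ℝ)) E.μ := by
      simp only [mul_one]; exact (at0_dep (L + 1) false).muInt
    rw [integral_sub hd0 hd1.muInt, h1]
  rw [e3] at k2
  nlinarith

end
end EA

namespace EA
section
variable {E : EastProcess}

/-- Truncated configuration. -/
def trunc (j : ℕ) (M : ℤ) (η : Config) : Config := fun x =>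
  if x < -(j : ℤ) then true else if x ≤ M then η x else false

lemma trunc_dep (j : ℕ) (M : ℤ) (F : Config → ℝ) :
    Dep (-(j : ℤ)) M (fun η => phi F (trunc j M η)) := by
  intro ω ω' H
  have : trunc j M ω = trunc j M ω' := by
    funext x
    unfold trunc
    split_ifs with h1 h2
    · rfl
    · exact H x ⟨by omega, h2⟩
    · rfl
  beta_reduce
  rw [this]

lemma trunc_eq {j : ℕ} {M : ℤ} (hM : 0 ≤ M) {F : Config → ℝ} (hF : Dep 1 M F) {η : Config} {y : ℤ}
    (hη : η ∈ Fr y) (h1 : -(j : ℤ) ≤ y) (h2 : y ≤ 0) : phi F (trunc j M η) = phi F η := by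
  have hτ : trunc j M η ∈ Fr y := by
    constructor
    · unfold trunc
      rw [if_neg (by omega), if_pos (by omega)]; exact hη.1
    · intro x hx
      unfold trunc
      split_ifs with h3 h4
      · rfl
      · exact hη.2 x hx
      · omega
  unfold phi
  rw [theta_eq hτ, theta_eq hη]
  apply hF
  intro x hx
  have := hx.1
  have := hx.2
  unfold shift trunc
  rw [if_neg (by omega), if_pos (by omega)]

/-- Put a front at the origin. -/
def std (ω : Config) : Config := fun x => if x < 0 then true else if x = 0 then false else ω x

lemma std_Fr (ω : Config) : std ω ∈ Fr 0 := by
  constructor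
  · simp [std]
  · intro x hx; simp [std, hx]

lemma std_of {ω : Config} (h : ω ∈ Fr 0) : std ω = ω := by
  funext x
  unfold std
  split_ifs with h1 h2
  · exact (h.2 x h1).symm
  · rw [h2]; exact h.1.symm
  · rfl

lemma std_dep {a b : ℤ} {G : Config → ℝ} (hG : Dep a b G) : Dep 1 b (fun ω => G (std ω)) := by
  intro ω ω' H
  apply hG
  intro x hx
  unfold std
  split_ifs with h1 h2
  · rfl
  · rfl
  · exact H x ⟨by omega, hx.2⟩

lemma localize (hgap : 0 < gap E) {δ : ℝ} (hδ : 0 < δ) : ∃ T1 : ℝ, 0 ≤ T1 ∧ ∀ T, T1 ≤ T → ∀ M : ℤ,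
    ∃ M' : ℤ, ∀ F, Dep 1 M F → (∀ ω, 0 ≤ F ω) → (∀ ω, F ω ≤ 1) →
      ∃ G, Dep 1 M' G ∧ (∀ ω, 0 ≤ G ω) ∧ (∀ ω, G ω ≤ 1) ∧
        ∀ ω ∈ Fr 0, |Pt E T (phi F) ω - G ω| ≤ δ := by
  have hp0 := E.hp0
  obtain ⟨k, hk⟩ := exists_pow_lt_of_lt_one (show 0 < δ / 6 by positivity) E.hp1
  have l1 : Tendsto (fun T : ℝ => Real.exp (-(gap E * T)) ^ 2) atTop (𝓝 0) := by
    have : Tendsto (fun T : ℝ => Real.exp (-(gap E * T))) atTop (𝓝 0) :=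
      Real.tendsto_exp_neg_atTop_nhds_zero.comp (tendsto_id.const_mul_atTop hgap)
    simpa using this.pow 2
  obtain ⟨T1, hT1⟩ := eventually_atTop.1 (l1.eventually_lt_const
    (show 0 < E.p ^ (0 + k) * (δ / 6) ^ 2 by positivity))
  refine ⟨max T1 0, le_max_right _ _, fun T hT M0 => ?_⟩
  have hT0 : 0 ≤ T := (le_max_right _ _).trans hT
  set M := max M0 0 with hM
  have hM0 : 0 ≤ M := le_max_right _ _
  obtain ⟨j, hj⟩ := ((FloorSemiring.tendsto_pow_div_factorial_atTop T).eventually_lt_const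
    (show 0 < δ / 3 by positivity)).exists
  obtain ⟨N, hN, hNb⟩ := ((approx E (-(j : ℤ)) M hT0 (ε := δ / 3) (by positivity)).and
    (eventually_ge_atTop M)).exists
  obtain ⟨m, hm, hm2⟩ := (hN.and (step_small T (Finset.Ico (-(j : ℤ)) N))).exists
  have hh : 0 ≤ T / m := by positivity
  set s := Finset.Ico (-(j : ℤ)) N with hs
  refine ⟨N, fun F hF0 F0 F1 => ?_⟩
  have hF : Dep 1 M F := hF0.mono le_rfl (le_max_left _ _)
  set f := fun η => phi F (trunc j M η) with hf
  have hfd : Dep (-(j : ℤ)) M f := trunc_dep j M F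
  have f0 : ∀ ω, 0 ≤ f ω := fun ω => F0 _
  have f1 : ∀ ω, f ω ≤ 1 := fun ω => F1 _
  refine ⟨fun ω => (Q E.p (T / m) s)^[m] f (std ω), std_dep ((hfd.mono le_rfl hNb).Qiter m), ?_, ?_, ?_⟩
  · intro ω
    have := Qi_mono (p0' E) (p1' E) hh hm2 m (f := fun _ => 0) (g := f) f0 (std ω)
    rwa [Qi_const] at this
  · intro ω
    have := Qi_mono (p0' E) (p1' E) hh hm2 m (g := fun _ => 1) (f := f) f1 (std ω)
    rwa [Qi_const] at this
  intro ω hω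
  beta_reduce
  rw [std_of hω]
  have a1 := hm f hfd (fun ω => by rw [abs_of_nonneg (f0 ω)]; exact f1 ω) ω
  have a2 := R1 hgap 0 k hω hT0 (A := δ / 6) (by positivity)
    (hT1 T ((le_max_left _ _).trans hT)).le
  have a3 := speed' (E := E) hω j hT0
  have a4 : |Pt E T (fun η => phi F η - f η) ω|
      ≤ Pt E T (fun η => (1 - zi (-(((0 : ℕ) : ℤ) + 1)) η) + zi (0 - (j : ℤ)) η) ω := by
    refine (Pt_abs T ω).trans ?_
    apply Pt_mono_ae (hF.bm.phi.sub hfd.bm).abs (((bm_const 1).sub (zi_bm _)).add (zi_bm _))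
    filter_upwards [ae_LO (E := E) (Fr_LO hω) hT0] with η hη
    obtain ⟨y, hy⟩ := mem_LO_iff.1 hη
    have z0 := zi_nonneg (0 - (j : ℤ)) η
    have z1 := zi_le_one (-(((0 : ℕ) : ℤ) + 1)) η
    have hb : |phi F η - f η| ≤ 1 := by
      have := F0 (θL 0 η)
      have := F1 (θL 0 η)
      have := f0 η
      have := f1 η
      unfold phi
      rw [abs_le]; constructor <;> linarith
    by_cases c1 : y ≤ 0
    · by_cases c2 : -(j : ℤ) ≤ y
      · have : f η = phi F η := trunc_eq hM0 hF hy c2 c1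
        rw [this, sub_self, abs_zero]
        linarith
      · have : zi (0 - (j : ℤ)) η = 1 := zi_of hy.1 (by omega)
        rw [this]; linarith
    · have : zi (-(((0 : ℕ) : ℤ) + 1)) η = 0 := zi_Fr hy (by simp; omega)
      rw [this]; linarith
  rw [Pt_add ((bm_const 1).sub (zi_bm _)) (zi_bm _), Pt_sub hF.bm.phi hfd.bm] at a4
  have a5 := a4.trans (add_le_add a2 a3)
  have := abs_sub_le (Pt E T (phi F) ω) (Pt E T f ω) ((Q E.p (T / m) s)^[m] f ω)
  linarith

/-- Uniform oscillation bound. -/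
def Good (E : EastProcess) (M : ℤ) (t a : ℝ) : Prop :=
  ∀ F, Dep 1 M F → (∀ ω, 0 ≤ F ω) → (∀ ω, F ω ≤ 1) → ∀ ω ∈ Fr 0, ∀ σ ∈ Fr 0,
    Pt E t (phi F) ω - Pt E t (phi F) σ ≤ a

/-- Eventual uniform oscillation bound. -/
def PrG (E : EastProcess) (a : ℝ) : Prop := ∀ M : ℤ, ∃ T0 : ℝ, 0 ≤ T0 ∧ ∀ t, T0 ≤ t → Good E M t a

lemma PrG.mono {a b : ℝ} (h : PrG E a) (hab : a ≤ b) : PrG E b := fun M => by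
  obtain ⟨T0, h0, h1⟩ := h M
  exact ⟨T0, h0, fun t ht F a1 a2 a3 ω hω σ hσ => (h1 t ht F a1 a2 a3 ω hω σ hσ).trans hab⟩

lemma prg_step (hgap : 0 < gap E) : ∃ c : ℝ, 0 < c ∧ c ≤ 1 ∧ ∀ δ, 0 < δ → δ ≤ c / 4 → ∀ a, 0 ≤ a →
    PrG E a → PrG E ((1 - c / 2) * a + 2 * δ) := by
  obtain ⟨c, hc0, hc1, hD⟩ := doeblin hgap
  refine ⟨c, hc0, hc1, fun δ hδ hδc a ha hP M => ?_⟩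
  obtain ⟨TD, hTD, hD⟩ := hD M
  obtain ⟨T1, hT1, hB⟩ := localize hgap hδ
  set T := max TD T1 with hT
  have hT0 : 0 ≤ T := hTD.trans (le_max_left _ _)
  obtain ⟨M', hB⟩ := hB T (le_max_right _ _) M
  obtain ⟨T2, hT2, hP⟩ := hP M'
  refine ⟨T2 + T, by positivity, fun t ht F hF F0 F1 ω hω σ hσ => ?_⟩
  obtain ⟨G, hG, G0, G1, hGF⟩ := hB F hF F0 F1
  set r := 1 - c / 2 with hr
  have hr0 : 0 < r := by rw [hr]; linarith
  have hosc : ∀ ζ ζ', G ζ - G ζ' ≤ r := by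
    intro ζ ζ'
    have e : ∀ ζ, G ζ = G (std ζ) := by
      intro ζ
      apply hG
      intro x hx
      have := hx.1
      unfold std
      rw [if_neg (by omega), if_neg (by omega)]
    rw [e ζ, e ζ']
    have d1 := hD T (le_max_left _ _) F hF F0 F1 _ (std_Fr ζ) _ (std_Fr ζ')
    have d2 := abs_le.1 (hGF _ (std_Fr ζ))
    have d3 := abs_le.1 (hGF _ (std_Fr ζ'))
    rw [hr]; linarith
  set lo := ⨅ ζ, G ζ with hlo
  have hbdd : BddBelow (Set.range G) := ⟨0, by rintro _ ⟨ζ, rfl⟩; exact G0 ζ⟩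
  have lo1 : ∀ ζ, lo ≤ G ζ := fun ζ => ciInf_le hbdd ζ
  have lo2 : ∀ ζ, G ζ - r ≤ lo := fun ζ => le_ciInf fun ζ' => by linarith [hosc ζ ζ']
  have hts : 0 ≤ t - T := by linarith
  have main := hP (t - T) (by linarith) (fun ζ => r⁻¹ * (G ζ - lo))
    (fun a b H => by beta_reduce; rw [hG a b H])
    (fun ζ => mul_nonneg (inv_nonneg.2 hr0.le) (by linarith [lo1 ζ]))
    (fun ζ => by rw [inv_mul_le_iff₀ hr0]; linarith [lo2 ζ]) ω hω σ hσ
  have e1 : ∀ ω, Pt E (t - T) (phi fun ζ => r⁻¹ * (G ζ - lo)) ω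
      = r⁻¹ * (Pt E (t - T) (phi G) ω - lo) := by
    intro ω
    have := Pt_smul (E := E) r⁻¹ (f := fun η => phi G η - lo) (t - T) ω
    rw [Pt_sub hG.bm.phi (bm_const _), Pt_const] at this
    exact this
  rw [e1, e1, ← mul_sub, inv_mul_le_iff₀ hr0] at main
  have e2 : ∀ ω ∈ Fr 0, |Pt E t (phi F) ω - Pt E (t - T) (phi G) ω| ≤ δ := by
    intro ω hω
    have : t = (t - T) + T := by ring
    rw [this, Pt_semi hF.bm.phi hT0 hts, add_sub_cancel_right, ← Pt_sub (hF.bm.phi.Pt T) hG.bm.phi]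
    apply Pt_abs_le_ae
    filter_upwards [ae_LO (E := E) (Fr_LO hω) hts] with η hη
    rw [← Pt_phi_theta hF.bm hT0 hη]
    exact hGF _ (theta_Fr hη)
  have d1 := abs_le.1 (e2 ω hω)
  have d2 := abs_le.1 (e2 σ hσ)
  linarith

lemma prg (hgap : 0 < gap E) {ε : ℝ} (hε : 0 < ε) : PrG E ε := by
  obtain ⟨c, hc0, hc1, hstep⟩ := prg_step hgap
  set δ := min (c / 4) (ε * c / 8) with hδ
  have hδ0 : 0 < δ := by positivity
  have h1 : PrG E 1 := by
    intro M
    refine ⟨0, le_rfl, fun t ht F hF F0 F1 ω hω σ hσ => ?_⟩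
    have a1 := Pt_mono (E := E) hF.bm.phi (bm_const 1) t (fun ω => F1 _) ω
    have a2 := Pt_mono (E := E) (bm_const 0) hF.bm.phi t (fun ω => F0 _) σ
    rw [Pt_const] at a1 a2
    linarith
  have hit : ∀ n : ℕ, PrG E ((1 - c / 2) ^ n + 4 * δ / c) := by
    intro n
    induction n with
    | zero => exact h1.mono (by rw [pow_zero]; have : 0 ≤ 4 * δ / c := by positivity
                                linarith)
    | succ n ih =>
      have hr : 0 ≤ 1 - c / 2 := by linarith
      refine (hstep δ hδ0 (min_le_left _ _) _ (by positivity) ih).mono (le_of_eq ?_)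
      field_simp
      ring
  obtain ⟨n, hn⟩ := exists_pow_lt_of_lt_one (half_pos hε) (show 1 - c / 2 < 1 by linarith)
  refine (hit n).mono ?_
  have : 4 * δ / c ≤ ε / 2 := by
    rw [div_le_iff₀ hc0]
    have := min_le_right (c / 4) (ε * c / 8)
    rw [← hδ] at this
    linarith
  linarith

end
end EA

namespace EA
section

/-- Maximal coupling of two weight vectors. -/
lemma weights {S : Type} [Fintype S] [DecidableEq S] (a b : S → ℝ) (ha : ∀ s, 0 ≤ a s)
    (hb : ∀ s, 0 ≤ b s) (ha1 : ∑ s, a s = 1) (hb1 : ∑ s, b s = 1) :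
    ∃ w : S → S → ℝ, (∀ s s', 0 ≤ w s s') ∧ (∀ s, ∑ s', w s s' = a s) ∧
      (∀ s', ∑ s, w s s' = b s') ∧
      1 - ∑ s ∈ Finset.univ.filter (fun s => b s < a s), (a s - b s) ≤ ∑ s, w s s := by
  set m := fun s => min (a s) (b s) with hm
  set D := 1 - ∑ s, m s with hD
  have hma : ∀ s, 0 ≤ a s - m s := fun s => sub_nonneg.2 (min_le_left _ _)
  have hmb : ∀ s, 0 ≤ b s - m s := fun s => sub_nonneg.2 (min_le_right _ _)
  have hm0 : ∀ s, 0 ≤ m s := fun s => le_min (ha s) (hb s)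
  have Da : ∑ s, (a s - m s) = D := by rw [Finset.sum_sub_distrib, ha1]
  have Db : ∑ s, (b s - m s) = D := by rw [Finset.sum_sub_distrib, hb1]
  have D0 : 0 ≤ D := Da ▸ Finset.sum_nonneg fun s _ => hma s
  have za : D = 0 → ∀ s, a s - m s = 0 := by
    intro h s
    rw [h] at Da
    exact (Finset.sum_eq_zero_iff_of_nonneg (fun s _ => hma s)).1 Da s (Finset.mem_univ s)
  have zb : D = 0 → ∀ s, b s - m s = 0 := by
    intro h s
    rw [h] at Db
    exact (Finset.sum_eq_zero_iff_of_nonneg (fun s _ => hmb s)).1 Db s (Finset.mem_univ s)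
  refine ⟨fun s s' => (if s = s' then m s else 0) + (a s - m s) * (b s' - m s') / D, ?_, ?_, ?_, ?_⟩
  · intro s s'
    have h1 : (0 : ℝ) ≤ if s = s' then m s else 0 := by split_ifs; exacts [hm0 s, le_rfl]
    have h2 := div_nonneg (mul_nonneg (hma s) (hmb s')) D0
    exact add_nonneg h1 h2
  · intro s
    rw [Finset.sum_add_distrib, Finset.sum_ite_eq, if_pos (Finset.mem_univ _), ← Finset.sum_div,
      ← Finset.mul_sum, Db]
    by_cases h : D = 0
    · rw [h, div_zero]; linarith [za h s]
    · rw [mul_div_cancel_right₀ _ h]; ring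
  · intro s
    rw [Finset.sum_add_distrib, Finset.sum_ite_eq', if_pos (Finset.mem_univ _), ← Finset.sum_div,
      ← Finset.sum_mul, Da]
    by_cases h : D = 0
    · rw [h, div_zero]; linarith [zb h s]
    · rw [mul_div_cancel_left₀ _ h]; ring
  · have e1 : ∑ s ∈ Finset.univ.filter (fun s => b s < a s), (a s - b s) = D := by
      rw [← Da, Finset.sum_filter]
      apply Finset.sum_congr rfl
      intro s _
      simp only [hm]
      split_ifs with h
      · rw [min_eq_right h.le]
      · rw [min_eq_left (not_lt.1 h), sub_self]
    have e2 : 1 - D = ∑ s, m s := by rw [hD, sub_sub_cancel]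
    rw [e1, e2]
    apply Finset.sum_le_sum
    intro s _
    beta_reduce
    rw [if_pos rfl]
    have h2 := div_nonneg (mul_nonneg (hma s) (hmb s)) D0
    linarith

/-- Conditioning on the value of `τ`. -/
lemma cond_smul {X S : Type} [MeasurableSpace X] (ρ : Measure X) [IsProbabilityMeasure ρ] (A : Set X)
    (hA : MeasurableSet A) (B : Set X) :
    ENNReal.ofReal (ρ.real A) * (ProbabilityTheory.cond ρ A) B = ρ (A ∩ B) := by
  rw [ofReal_measureReal, cond_apply hA]
  by_cases h : ρ A = 0
  · rw [h, zero_mul, measure_mono_null Set.inter_subset_left h]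
  · rw [← mul_assoc, ENNReal.mul_inv_cancel h (measure_ne_top _ _), one_mul]

lemma sum_fib {X S : Type} [MeasurableSpace X] [Fintype S] [MeasurableSpace S]
    [MeasurableSingletonClass S] (ρ : Measure X) {τ : X → S} (hτ : Measurable τ) (B : Set X)
    (hB : MeasurableSet B) : ∑ s, ρ (τ ⁻¹' {s} ∩ B) = ρ B := by
  have h := sum_measure_preimage_singleton (μ := ρ.restrict B) (Finset.univ : Finset S) (f := τ)
    (fun y _ => hτ (measurableSet_singleton y))
  rw [Finset.coe_univ, Set.preimage_univ, Measure.restrict_apply_univ] at h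
  rw [← h]
  apply Finset.sum_congr rfl
  intro s _
  rw [Measure.restrict_apply (hτ (measurableSet_singleton s))]

lemma coupling {X S : Type} [MeasurableSpace X] [Fintype S] [DecidableEq S] [MeasurableSpace S]
    [MeasurableSingletonClass S] (ρ ρ' : Measure X) [IsProbabilityMeasure ρ]
    [IsProbabilityMeasure ρ'] {τ : X → S} (hτ : Measurable τ) :
    ∃ C : Measure (X × X), IsProbabilityMeasure C ∧ C.map Prod.fst = ρ ∧ C.map Prod.snd = ρ' ∧
      ∀ ε : ℝ, (∀ A : Finset S, ρ.real (τ ⁻¹' A) - ρ'.real (τ ⁻¹' A) ≤ ε) →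
        1 - ε ≤ (C {z | τ z.1 = τ z.2}).toReal := by
  have hs : ∀ s, MeasurableSet (τ ⁻¹' {s}) := fun s => hτ (measurableSet_singleton s)
  set a : S → ℝ := fun s => ρ.real (τ ⁻¹' {s}) with ha
  set b : S → ℝ := fun s => ρ'.real (τ ⁻¹' {s}) with hb
  have sa : ∀ A : Finset S, ∑ s ∈ A, a s = ρ.real (τ ⁻¹' A) := fun A =>
    sum_measureReal_preimage_singleton A (fun y _ => hs y)
  have sb : ∀ A : Finset S, ∑ s ∈ A, b s = ρ'.real (τ ⁻¹' A) := fun A =>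
    sum_measureReal_preimage_singleton A (fun y _ => hs y)
  obtain ⟨w, w0, wa, wb, wd⟩ := weights a b (fun s => measureReal_nonneg)
    (fun s => measureReal_nonneg) (by rw [sa]; simp) (by rw [sb]; simp)
  set α := fun s => ProbabilityTheory.cond ρ (τ ⁻¹' {s}) with hα
  set β := fun s => ProbabilityTheory.cond ρ' (τ ⁻¹' {s}) with hβ
  have pα : ∀ s, a s ≠ 0 → IsProbabilityMeasure (α s) := fun s h =>
    cond_isProbabilityMeasure (fun h0 => h (by simp [ha, Measure.real, h0]))
  have pβ : ∀ s, b s ≠ 0 → IsProbabilityMeasure (β s) := fun s h =>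
    cond_isProbabilityMeasure (fun h0 => h (by simp [hb, Measure.real, h0]))
  have wa0 : ∀ s s', a s = 0 → w s s' = 0 := by
    intro s s' h
    have := wa s
    rw [h] at this
    exact (Finset.sum_eq_zero_iff_of_nonneg (fun s' _ => w0 s s')).1 this s' (Finset.mem_univ _)
  have wb0 : ∀ s s', b s' = 0 → w s s' = 0 := by
    intro s s' h
    have := wb s'
    rw [h] at this
    exact (Finset.sum_eq_zero_iff_of_nonneg (fun s _ => w0 s s')).1 this s (Finset.mem_univ _)
  set C : Measure (X × X) := ∑ s, ∑ s', ENNReal.ofReal (w s s') • (α s).prod (β s') with hC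
  have Capp : ∀ B, C B = ∑ s, ∑ s', ENNReal.ofReal (w s s') * (α s).prod (β s') B := by
    intro B
    simp [hC, Measure.finsetSum_apply, Measure.smul_apply]
  have m1 : C.map Prod.fst = ρ := by
    ext B hB
    rw [Measure.map_apply measurable_fst hB, Capp, ← sum_fib ρ hτ B hB]
    apply Finset.sum_congr rfl
    intro s _
    have : Prod.fst ⁻¹' B = B ×ˢ (Set.univ : Set X) := by ext; simp
    rw [this, ← cond_smul (S := S) ρ (τ ⁻¹' {s}) (hs s) B]
    change _ = ENNReal.ofReal (a s) * α s B
    rw [← wa s, ENNReal.ofReal_sum_of_nonneg (fun s' _ => w0 s s'), Finset.sum_mul]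
    apply Finset.sum_congr rfl
    intro s' _
    by_cases h : b s' = 0
    · rw [wb0 s s' h]; simp
    · have := pβ s' h
      rw [Measure.prod_prod, measure_univ, mul_one]
  have m2 : C.map Prod.snd = ρ' := by
    ext B hB
    rw [Measure.map_apply measurable_snd hB, Capp, ← sum_fib ρ' hτ B hB, Finset.sum_comm]
    apply Finset.sum_congr rfl
    intro s' _
    have : Prod.snd ⁻¹' B = (Set.univ : Set X) ×ˢ B := by ext; simp
    rw [this, ← cond_smul (S := S) ρ' (τ ⁻¹' {s'}) (hs s') B]
    change _ = ENNReal.ofReal (b s') * β s' B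
    rw [← wb s', ENNReal.ofReal_sum_of_nonneg (fun s _ => w0 s s'), Finset.sum_mul]
    apply Finset.sum_congr rfl
    intro s _
    by_cases h : a s = 0
    · rw [wa0 s s' h]; simp
    · have := pα s h
      rw [Measure.prod_prod, measure_univ, one_mul]
  have pC : IsProbabilityMeasure C := by
    constructor
    have := Measure.map_apply (μ := C) measurable_fst (MeasurableSet.univ (α := X))
    rw [m1, measure_univ, Set.preimage_univ] at this
    exact this.symm
  refine ⟨C, pC, m1, m2, fun ε hε => ?_⟩
  have hε' := hε (Finset.univ.filter (fun s => b s < a s))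
  rw [← sa, ← sb, ← Finset.sum_sub_distrib] at hε'
  refine le_trans (by linarith : 1 - ε ≤ ∑ s, w s s) ?_
  rw [← ENNReal.ofReal_le_iff_le_toReal (measure_ne_top _ _), Capp,
    ENNReal.ofReal_sum_of_nonneg (fun s _ => w0 s s)]
  apply Finset.sum_le_sum
  intro s _
  refine le_trans ?_ (Finset.single_le_sum (f := fun s' => ENNReal.ofReal (w s s') *
    (α s).prod (β s') {z | τ z.1 = τ z.2}) (fun _ _ => zero_le) (Finset.mem_univ s))
  by_cases h : w s s = 0
  · simp [h]
  have h1 : a s ≠ 0 := fun h' => h (wa0 s s h')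
  have h2 : b s ≠ 0 := fun h' => h (wb0 s s h')
  have := pβ s h2
  have h3 : (α s).prod (β s) ((τ ⁻¹' {s}) ×ˢ (τ ⁻¹' {s})) = 1 := by
    have e1 : α s (τ ⁻¹' {s}) = 1 :=
      cond_apply_self (fun h0 => h1 (by simp [ha, Measure.real, h0])) (measure_ne_top _ _)
    have e2 : β s (τ ⁻¹' {s}) = 1 :=
      cond_apply_self (fun h0 => h2 (by simp [hb, Measure.real, h0])) (measure_ne_top _ _)
    rw [Measure.prod_prod, e1, e2, one_mul]
  have h4 : (1 : ENNReal) ≤ (α s).prod (β s) {z | τ z.1 = τ z.2} := by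
    rw [← h3]
    apply measure_mono
    rintro ⟨x, y⟩ ⟨hx, hy⟩
    have hx' : τ x = s := hx
    have hy' : τ y = s := hy
    change τ x = τ y
    rw [hx', hy']
  calc ENNReal.ofReal (w s s) = ENNReal.ofReal (w s s) * 1 := (mul_one _).symm
    _ ≤ _ := by gcongr

variable {E : EastProcess}

/-- The window map. -/
def win (L : ℕ) (ω : Config) : (Finset.Icc (1 : ℤ) L) → Bool := fun x => ω x

lemma win_meas (L : ℕ) : Measurable (win L) :=
  measurable_pi_iff.2 fun x => measurable_pi_apply (x : ℤ)

lemma front_coupling (E : EastProcess) (L : ℕ) (t : ℝ) (ω σ : Config) :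
    ∃ C : Measure (Config × Config), IsProbabilityMeasure C ∧
      C.map Prod.fst = Measure.map (θL 0) (E.P t ω) ∧
      C.map Prod.snd = Measure.map (θL 0) (E.P t σ) ∧
      ∀ ε : ℝ, ω ∈ Fr 0 → σ ∈ Fr 0 → Good E L t ε →
        1 - ε ≤ (C {ηξ | ∀ x : ℤ, 1 ≤ x → x ≤ (L : ℤ) → ηξ.1 x = ηξ.2 x}).toReal := by
  have := E.markov t
  have p1 : IsProbabilityMeasure (Measure.map (θL 0) (E.P t ω)) :=
    Measure.isProbabilityMeasure_map measurable_theta.aemeasurable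
  have p2 : IsProbabilityMeasure (Measure.map (θL 0) (E.P t σ)) :=
    Measure.isProbabilityMeasure_map measurable_theta.aemeasurable
  obtain ⟨C, h1, h2, h3, h4⟩ := coupling (Measure.map (θL 0) (E.P t ω))
    (Measure.map (θL 0) (E.P t σ)) (win_meas L)
  refine ⟨C, h1, h2, h3, fun ε hω hσ hG => ?_⟩
  have hset : {ηξ : Config × Config | ∀ x : ℤ, 1 ≤ x → x ≤ (L : ℤ) → ηξ.1 x = ηξ.2 x}
      = {z | win L z.1 = win L z.2} := by
    ext z
    constructor
    · intro h
      funext x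
      have := Finset.mem_Icc.1 x.2
      exact h x this.1 this.2
    · intro h x a b
      exact congrFun h ⟨x, Finset.mem_Icc.2 ⟨a, b⟩⟩
  rw [hset]
  apply h4
  intro A
  have hA : MeasurableSet (win L ⁻¹' (A : Set _)) := win_meas L A.measurableSet
  have hd : Dep 1 L ((win L ⁻¹' (A : Set _)).indicator fun _ => (1 : ℝ)) := by
    intro η η' H
    have : win L η = win L η' := by
      funext x
      have := Finset.mem_Icc.1 x.2
      exact H x ⟨this.1, this.2⟩
    have h5 : (η ∈ win L ⁻¹' (A : Set _)) ↔ (η' ∈ win L ⁻¹' (A : Set _)) := by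
      rw [Set.mem_preimage, Set.mem_preimage, this]
    by_cases h6 : η ∈ win L ⁻¹' (A : Set _)
    · rw [Set.indicator_of_mem h6, Set.indicator_of_mem (h5.1 h6)]
    · rw [Set.indicator_of_notMem h6, Set.indicator_of_notMem (fun h => h6 (h5.2 h))]
  have hI : ∀ ω, Pt E t (phi ((win L ⁻¹' (A : Set _)).indicator fun _ => (1 : ℝ))) ω
      = (Measure.map (θL 0) (E.P t ω)).real (win L ⁻¹' (A : Set _)) := by
    intro ω
    rw [← integral_indicator_one hA, integral_map measurable_theta.aemeasurable
      (measurable_one.indicator hA).aestronglyMeasurable]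
    rfl
  have := hG _ hd (fun η => Set.indicator_nonneg (fun _ _ => zero_le_one) η)
    (fun η => Set.indicator_le_self' (fun _ _ => zero_le_one) η) ω hω σ hσ
  rw [hI, hI] at this
  exact this

end
end EA

theorem coupling_seen_from_front (E : EastProcess) (hgap : 0 < gap E) :
    ∃ L₀ : ℝ → ℕ, (∀ t : ℝ, 1 ≤ L₀ t) ∧ Tendsto L₀ atTop atTop ∧
      ∃ C : ℝ → Config → Config → Measure (Config × Config),
        (∀ t : ℝ, 0 < t → ∀ ω ∈ LO₀, ∀ σ ∈ LO₀,
          IsProbabilityMeasure (C t ω σ) ∧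
          (C t ω σ).map Prod.fst = Measure.map (θL 0) (E.P t ω) ∧
          (C t ω σ).map Prod.snd = Measure.map (θL 0) (E.P t σ)) ∧
        Tendsto (fun t : ℝ =>
            ⨅ ωσ : LO₀ × LO₀,
              ((C t ωσ.1 ωσ.2)
                {ηξ : Config × Config |
                  ∀ x : ℤ, 1 ≤ x → x ≤ (L₀ t : ℤ) → ηξ.1 x = ηξ.2 x}).toReal)
          atTop (𝓝 1) := by
  classical
  have hT : ∀ n : ℕ, ∃ T0 : ℝ, ∀ t, T0 ≤ t → EA.Good E n t (1 / ((n : ℝ) + 1)) := by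
    intro n
    obtain ⟨T0, _, h⟩ := EA.prg hgap (ε := 1 / ((n : ℝ) + 1)) (by positivity) n
    exact ⟨T0, h⟩
  choose T hT using hT
  set g : ℝ → ℕ := fun t => Nat.findGreatest (fun n => T n ≤ t) ⌊t⌋₊ with hg
  have hgt : Tendsto g atTop atTop := by
    rw [tendsto_atTop]
    intro k
    filter_upwards [eventually_ge_atTop (T k), eventually_ge_atTop (k : ℝ)] with t h1 h2
    exact Nat.le_findGreatest (Nat.le_floor h2) h1
  refine ⟨fun t => max 1 (g t), fun t => le_max_left _ _,
    tendsto_atTop_mono (fun t => le_max_right 1 (g t)) hgt, ?_⟩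
  choose C h1 h2 h3 h4 using fun t ω σ => EA.front_coupling E (max 1 (g t)) t ω σ
  refine ⟨C, fun t _ ω _ σ _ => ⟨h1 t ω σ, h2 t ω σ, h3 t ω σ⟩, ?_⟩
  have hne : EA.std (fun _ => true) ∈ LO₀ := by rw [EA.LO0_eq]; exact EA.std_Fr _
  haveI : Nonempty (LO₀ × LO₀) := ⟨⟨⟨_, hne⟩, ⟨_, hne⟩⟩⟩
  have lim : Tendsto (fun t : ℝ => 1 - 1 / ((g t : ℝ) + 1)) atTop (𝓝 1) := by
    have := (tendsto_one_div_add_atTop_nhds_zero_nat (𝕜 := ℝ)).comp hgt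
    simpa using this.const_sub 1
  refine tendsto_of_tendsto_of_tendsto_of_le_of_le' lim tendsto_const_nhds ?_ ?_
  · filter_upwards [hgt.eventually_ge_atTop 1] with t ht
    apply le_ciInf
    rintro ⟨⟨ω, hω⟩, ⟨σ, hσ⟩⟩
    rw [EA.LO0_eq] at hω hσ
    apply h4 t ω σ _ hω hσ
    rw [max_eq_right ht]
    apply hT
    exact Nat.findGreatest_of_ne_zero (P := fun n => T n ≤ t) (n := ⌊t⌋₊) rfl (by omega)
  · filter_upwards with t
    refine (ciInf_le ⟨0, ?_⟩ (⟨⟨_, hne⟩, ⟨_, hne⟩⟩ : LO₀ × LO₀)).trans ?_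
    · rintro _ ⟨z, rfl⟩
      exact ENNReal.toReal_nonneg
    · have := h1 t (EA.std fun _ => true) (EA.std fun _ => true)
      exact ENNReal.toReal_le_of_le_ofReal zero_le_one (by simpa using prob_le_one)

end
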